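/- The integral solutions (X, Y) of the Mordell equation Y^2 = X^3 − 10584 are exactly the pairs (X, Y) with X ∈ {22, 25, 42, 105, 294, 394} and correspondingly Y = ±8, ±71, ±252, ±1071, ±5040, ±7820, and the Mordell equation Y^2 = X^3 + 10584 has no integral solutions. -/

import Mathlib

set_option linter.all false

open NumberField in
theorem units_dep {K : Type} [Field K] [NumberField K] (hdeg : Module.finrank ℚ K = 4)
    (φ : K →+* ℂ) (hφ : ¬ ComplexEmbedding.IsReal φ) (a b c : (𝓞 K)ˣ) :
    ∃ l m n : ℤ, ¬ (l = 0 ∧ m = 0 ∧ n = 0) ∧ a ^ l * b ^ m * c ^ n = 1 := by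
  have h1 := InfinitePlace.card_add_two_mul_card_eq_rank K
  have h2 : 1 ≤ InfinitePlace.nrComplexPlaces K := by
    have : InfinitePlace.IsComplex (InfinitePlace.mk φ) := InfinitePlace.isComplex_mk_iff.mpr hφ
    classical
    unfold InfinitePlace.nrComplexPlaces
    exact Fintype.card_pos_iff.mpr ⟨⟨_, this⟩⟩
  have h3 := InfinitePlace.card_eq_nrRealPlaces_add_nrComplexPlaces K
  have h4 : Units.rank K ≤ 2 := by
    unfold Units.rank; omega
  let v : Fin 3 → Additive (𝓞 K)ˣ := ![Additive.ofMul a, Additive.ofMul b, Additive.ofMul c]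
  have h5 : ¬ LinearIndependent ℤ v := by
    intro h
    have := h.fintype_card_le_finrank
    rw [Units.finrank_eq] at this
    simp at this
    omega
  rw [Fintype.not_linearIndependent_iff] at h5
  obtain ⟨g, hg, i, hi⟩ := h5
  simp only [Fin.sum_univ_three, v, Matrix.cons_val_zero, Matrix.cons_val_one, Matrix.cons_val] at hg
  refine ⟨g 0, g 1, g 2, ?_, hg⟩
  rintro ⟨e0, e1, e2⟩
  fin_cases i <;> simp_all

/-- transfer to a coordinate ring -/
theorem ring_dep {R K : Type} [CommRing R] [Module.Finite ℤ R] [Field K] [NumberField K]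
    (hdeg : Module.finrank ℚ K = 4)
    (φ : K →+* ℂ) (hφ : ¬ NumberField.ComplexEmbedding.IsReal φ) (ι : R →+* K)
    (hι : Function.Injective ι) (a b c : Rˣ) :
    ∃ l m n : ℤ, ¬ (l = 0 ∧ m = 0 ∧ n = 0) ∧ a ^ l * b ^ m * c ^ n = 1 := by
  have h_integ : ∀ x : R, IsIntegral ℤ (ι x) := fun x => (Algebra.IsIntegral.isIntegral (R := ℤ) x).map ι.toIntAlgHom
  let j : R →+* NumberField.RingOfIntegers K := ι.codRestrict (integralClosure ℤ K) h_integ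
  have hj : Function.Injective j := by
    intro x y h
    apply hι
    exact congrArg (fun z : NumberField.RingOfIntegers K => (z : K)) h
  have hj' : Function.Injective (Units.map (j : R →* NumberField.RingOfIntegers K)) := Units.map_injective hj
  obtain ⟨l, m, n, h0, h1⟩ := units_dep hdeg φ hφ (Units.map (j : R →* _) a) (Units.map (j : R →* _) b) (Units.map (j : R →* _) c)
  refine ⟨l, m, n, h0, ?_⟩
  apply hj'
  simpa using h1

theorem real_tor {R : Type} [CommRing R] (σ : R →+* ℝ) (hσ : Function.Injective σ) (w : Rˣ) (g : ℕ) (hg : 0 < g)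
    (h : w ^ g = 1) : w = 1 ∨ w = -1 := by
  have h1 : (σ w) ^ g = 1 := by
    rw [← map_pow]; rw [← Units.val_pow_eq_pow_val, h]; simp
  have h2 : |σ w| = 1 := by
    have : |σ w| ^ g = 1 := by rw [← abs_pow, h1, abs_one]
    exact (pow_eq_one_iff_of_nonneg (abs_nonneg _) hg.ne').mp this
  rcases eq_or_eq_neg_of_abs_eq h2 with h | h
  · left; ext; apply hσ; simpa using h
  · right; ext; apply hσ; simpa using h

theorem skolem_step {R : Type} [CommRing R]
    (hdep : ∀ a b c : Rˣ, ∃ l m n : ℤ, ¬ (l = 0 ∧ m = 0 ∧ n = 0) ∧ a ^ l * b ^ m * c ^ n = 1)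
    (htor : ∀ (w : Rˣ) (g : ℕ), 0 < g → w ^ g = 1 → w = 1 ∨ w = -1)
    (p : ℕ) [Fact p.Prime] (S : Subgroup Rˣ) (L : Rˣ → ZMod p × ZMod p)
    (hL : ∀ x ∈ S, ∀ y ∈ S, L (x * y) = L x + L y) (hLneg : L (-1) = 0)
    (u v : Rˣ) (hu : u ∈ S) (hv : v ∈ S) (hdet : (L u).1 * (L v).2 - (L u).2 * (L v).1 ≠ 0)
    (x : Rˣ) (hx : x ∈ S) (hLx : L x = 0) : ∃ y ∈ S, x = y ^ p ∨ x = - y ^ p := by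
  let L' : S →* Multiplicative (ZMod p × ZMod p) :=
    MonoidHom.mk' (fun x => Multiplicative.ofAdd (L x)) (by
      rintro ⟨a, ha⟩ ⟨b, hb⟩
      simp [hL a ha b hb])
  have hz : ∀ (x : Rˣ) (hx : x ∈ S) (n : ℤ), L (x ^ n) = n • L x := by
    intro x hx n
    have := map_zpow L' ⟨x, hx⟩ n
    exact congrArg Multiplicative.toAdd this
  obtain ⟨l, m, n, h0, h1⟩ := hdep x u v
  -- divide by gcd
  obtain ⟨g, l', m', n', hg, hl, hm, hn, hco⟩ : ∃ (g : ℕ) (l' m' n' : ℤ), 0 < g ∧ l = l' * g ∧ m = m' * g ∧ n = n' * g ∧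
      ¬ ((p : ℤ) ∣ l' ∧ (p : ℤ) ∣ m' ∧ (p : ℤ) ∣ n') := by
    set g := Int.gcd l (Int.gcd m n : ℕ) with hgdef
    have hgpos : 0 < g := by
      rw [Nat.pos_iff_ne_zero]
      intro hg0
      rw [hgdef, Int.gcd_eq_zero_iff] at hg0
      obtain ⟨e1, e2⟩ := hg0
      have e3 : Int.gcd m n = 0 := by exact_mod_cast e2
      rw [Int.gcd_eq_zero_iff] at e3
      exact h0 ⟨e1, e3.1, e3.2⟩
    have d1 : (g : ℤ) ∣ l := Int.gcd_dvd_left _ _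
    have d2 : (g : ℤ) ∣ (Int.gcd m n : ℕ) := Int.gcd_dvd_right _ _
    have d3 : (g : ℤ) ∣ m := d2.trans (Int.gcd_dvd_left _ _)
    have d4 : (g : ℤ) ∣ n := d2.trans (Int.gcd_dvd_right _ _)
    obtain ⟨l', hl⟩ := d1
    obtain ⟨m', hm⟩ := d3
    obtain ⟨n', hn⟩ := d4
    refine ⟨g, l', m', n', hgpos, by rw [hl]; ring, by rw [hm]; ring, by rw [hn]; ring, ?_⟩
    rintro ⟨⟨l2, rfl⟩, ⟨m2, rfl⟩, ⟨n2, rfl⟩⟩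
    have d5 : ((g * p : ℕ) : ℤ) ∣ (g : ℤ) := by
      have e : ((g * p : ℕ) : ℤ) ∣ (Int.gcd m n : ℕ) := by
        apply Int.dvd_coe_gcd
        · rw [hm]; push_cast; exact ⟨m2, by ring⟩
        · rw [hn]; push_cast; exact ⟨n2, by ring⟩
      have e' : ((g * p : ℕ) : ℤ) ∣ l := by
        rw [hl]; push_cast; exact ⟨l2, by ring⟩
      have := Int.dvd_coe_gcd e' e
      rwa [← hgdef] at this
    have d6 : g * p ∣ g := by exact_mod_cast d5
    have := Nat.le_of_dvd hgpos d6
    have hp2 := (Fact.out : p.Prime).two_le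
    nlinarith
  have h2 : (x ^ l' * u ^ m' * v ^ n') ^ g = 1 := by
    rw [← h1, hl, hm, hn, zpow_mul, zpow_mul, zpow_mul, ← mul_zpow, ← mul_zpow]
    exact_mod_cast rfl
  have h3 := htor _ g hg h2
  have hxl : x ^ l' ∈ S := S.zpow_mem hx _
  have hum : u ^ m' ∈ S := S.zpow_mem hu _
  have hvn : v ^ n' ∈ S := S.zpow_mem hv _
  have hL1 : L 1 = 0 := by
    have := hL 1 S.one_mem 1 S.one_mem
    simpa using this
  have h4 : m' • L u + n' • L v = 0 := by
    have e : L (x ^ l' * u ^ m' * v ^ n') = 0 := by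
      rcases h3 with h | h <;> rw [h] <;> assumption
    rw [hL _ (S.mul_mem hxl hum) _ hvn, hL _ hxl _ hum, hz x hx, hz u hu, hz v hv, hLx] at e
    simpa using e
  have h5a : (m' : ZMod p) * (L u).1 + n' * (L v).1 = 0 := by
    have := congrArg Prod.fst h4
    simpa using this
  have h5b : (m' : ZMod p) * (L u).2 + n' * (L v).2 = 0 := by
    have := congrArg Prod.snd h4
    simpa using this
  have hm0 : (m' : ZMod p) = 0 := by
    have : (m' : ZMod p) * ((L u).1 * (L v).2 - (L u).2 * (L v).1) = 0 := by
      linear_combination (L v).2 * h5a - (L v).1 * h5b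
    exact (mul_eq_zero.mp this).resolve_right hdet
  have hn0 : (n' : ZMod p) = 0 := by
    have : (n' : ZMod p) * ((L u).1 * (L v).2 - (L u).2 * (L v).1) = 0 := by
      linear_combination (L u).1 * h5b - (L u).2 * h5a
    exact (mul_eq_zero.mp this).resolve_right hdet
  rw [ZMod.intCast_zmod_eq_zero_iff_dvd] at hm0 hn0
  have hl0 : ¬ (p : ℤ) ∣ l' := fun h => hco ⟨h, hm0, hn0⟩
  have hcop : IsCoprime (p : ℤ) l' := by
    rw [Prime.coprime_iff_not_dvd]
    · exact hl0
    · exact Nat.prime_iff_prime_int.mp Fact.out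
  obtain ⟨β, α, hαβ⟩ := hcop
  obtain ⟨m2, rfl⟩ := hm0
  obtain ⟨n2, rfl⟩ := hn0
  refine ⟨x ^ β * (u ^ (-m2) * v ^ (-n2)) ^ α, S.mul_mem (S.zpow_mem hx _) (S.zpow_mem (S.mul_mem (S.zpow_mem hu _) (S.zpow_mem hv _)) _), ?_⟩
  have key : (x ^ β * (u ^ (-m2) * v ^ (-n2)) ^ α) ^ p * (x ^ l' * u ^ ((p:ℤ) * m2) * v ^ ((p:ℤ) * n2)) ^ α = x := by
    rw [← zpow_natCast]
    simp only [mul_zpow, ← zpow_mul]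
    have e1 : x ^ (β * (p:ℤ)) * x ^ (l' * α) = x := by
      rw [← zpow_add]
      have : β * (p:ℤ) + l' * α = 1 := by linarith
      rw [this, zpow_one]
    have e2 : u ^ (-m2 * α * (p:ℤ)) * u ^ ((p:ℤ) * m2 * α) = 1 := by
      rw [← zpow_add]
      have : -m2 * α * (p:ℤ) + (p:ℤ) * m2 * α = 0 := by ring
      rw [this, zpow_zero]
    have e3 : v ^ (-n2 * α * (p:ℤ)) * v ^ ((p:ℤ) * n2 * α) = 1 := by
      rw [← zpow_add]
      have : -n2 * α * (p:ℤ) + (p:ℤ) * n2 * α = 0 := by ring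
      rw [this, zpow_zero]
    calc _ = (x ^ (β * (p:ℤ)) * x ^ (l' * α)) * (u ^ (-m2 * α * (p:ℤ)) * u ^ ((p:ℤ) * m2 * α)) * (v ^ (-n2 * α * (p:ℤ)) * v ^ ((p:ℤ) * n2 * α)) := by
          ac_rfl
      _ = x := by rw [e1, e2, e3]; simp
  rcases h3 with h | h
  · left; rw [h] at key; simpa using key.symm
  · rw [h] at key
    rcases Int.even_or_odd α with ha | ha
    · left; rw [ha.neg_one_zpow] at key; simpa using key.symm
    · right; rw [ha.neg_one_zpow] at key; simpa using key.symm

/-- inverse closure -/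
theorem unit_inv_mem {R : Type} [CommRing R] [Module.Finite ℤ R] (M : Subring R) (x : Rˣ) (hx : (x : R) ∈ M) :
    ((x⁻¹ : Rˣ) : R) ∈ M := by
  have hi : M.subtype.IsIntegral := by
    intro r
    have : IsIntegral ℤ r := Algebra.IsIntegral.isIntegral r
    obtain ⟨q, hq, hq2⟩ := this
    refine ⟨q.map (Int.castRingHom M), hq.map _, ?_⟩
    have e : M.subtype.comp (Int.castRingHom M) = algebraMap ℤ R := RingHom.ext_int _ _
    rw [Polynomial.eval₂_map, e]
    exact hq2
  have hl := hi.isLocalHom Subtype.val_injective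
  have : IsUnit (M.subtype ⟨x, hx⟩) := x.isUnit
  obtain ⟨y, hy⟩ := (isUnit_map_iff M.subtype _).mp this
  have : ((y : M) : R) = x := congrArg Subtype.val hy
  have h2 : ((y⁻¹ : Mˣ) : M).1 * x = 1 := by
    rw [← this, ← Subring.coe_mul]; simp
  have h3 : ((x⁻¹ : Rˣ) : R) = ((y⁻¹ : Mˣ) : M).1 := by
    have := congrArg (· * ((x⁻¹ : Rˣ) : R)) h2
    simpa [mul_assoc] using this.symm
  rw [h3]; exact Subtype.property _

set_option linter.style.haveILetI false
theorem quartic_nonreal (a b c d t : ℝ)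
    (h : 3 * (4*t^3+3*a*t^2+2*b*t+c)^2 < 8 * (t^4+a*t^3+b*t^2+c*t+d) * (6*t^2+3*a*t+b)) :
    ∃ z : ℂ, z^4+a*z^3+b*z^2+c*z+d = 0 ∧ z.im ≠ 0 := by
  by_contra hcon
  push Not at hcon
  obtain ⟨z1, h1⟩ : ∃ z : ℂ, z^4+a*z^3+b*z^2+c*z+d = 0 := by
    have hd : (Polynomial.X^4 + Polynomial.C (a:ℂ) * Polynomial.X^3 + Polynomial.C (b:ℂ) * Polynomial.X^2 + Polynomial.C (c:ℂ) * Polynomial.X + Polynomial.C (d:ℂ)).degree = 4 := by compute_degree!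
    obtain ⟨z, hz⟩ := IsAlgClosed.exists_root _ (by rw [hd]; decide)
    exact ⟨z, by simpa [Polynomial.IsRoot] using hz⟩
  obtain ⟨z2, h2⟩ : ∃ z : ℂ, z^3+(a+z1)*z^2+(b+a*z1+z1^2)*z+(c+b*z1+a*z1^2+z1^3) = 0 := by
    have hd : (Polynomial.X^3 + Polynomial.C (a+z1:ℂ) * Polynomial.X^2 + Polynomial.C (b+a*z1+z1^2:ℂ) * Polynomial.X + Polynomial.C (c+b*z1+a*z1^2+z1^3:ℂ)).degree = 3 := by compute_degree!
    obtain ⟨z, hz⟩ := IsAlgClosed.exists_root _ (by rw [hd]; decide)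
    exact ⟨z, by simpa [Polynomial.IsRoot] using hz⟩
  obtain ⟨z3, h3⟩ : ∃ z : ℂ, z^2+(a+z1+z2)*z+(b+a*z1+z1^2+(a+z1)*z2+z2^2) = 0 := by
    have hd : (Polynomial.X^2 + Polynomial.C (a+z1+z2:ℂ) * Polynomial.X + Polynomial.C (b+a*z1+z1^2+(a+z1)*z2+z2^2:ℂ)).degree = 2 := by compute_degree!
    obtain ⟨z, hz⟩ := IsAlgClosed.exists_root _ (by rw [hd]; decide)
    exact ⟨z, by simpa [Polynomial.IsRoot] using hz⟩
  obtain ⟨z4, h4⟩ : ∃ z : ℂ, z = -(a+z1+z2+z3) := ⟨_, rfl⟩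
  have f2 : z2^4+a*z2^3+b*z2^2+c*z2+d = 0 := by linear_combination (z2-z1)*h2 + h1
  have c2 : z3^3+(a+z1)*z3^2+(b+a*z1+z1^2)*z3+(c+b*z1+a*z1^2+z1^3) = 0 := by linear_combination (z3-z2)*h3 + h2
  have f3 : z3^4+a*z3^3+b*z3^2+c*z3+d = 0 := by linear_combination (z3-z1)*c2 + h1
  have q4 : z4^2+(a+z1+z2)*z4+(b+a*z1+z1^2+(a+z1)*z2+z2^2) = 0 := by rw [h4]; linear_combination h3
  have c4 : z4^3+(a+z1)*z4^2+(b+a*z1+z1^2)*z4+(c+b*z1+a*z1^2+z1^3) = 0 := by linear_combination (z4-z2)*q4 + h2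
  have f4 : z4^4+a*z4^3+b*z4^2+c*z4+d = 0 := by linear_combination (z4-z1)*c4 + h1
  have i1 := hcon z1 h1
  have i2 := hcon z2 f2
  have i3 := hcon z3 f3
  have i4 := hcon z4 f4
  have r1 : z1 = (z1.re : ℂ) := Complex.ext (by simp) (by simp [i1])
  have r2 : z2 = (z2.re : ℂ) := Complex.ext (by simp) (by simp [i2])
  have r3 : z3 = (z3.re : ℂ) := Complex.ext (by simp) (by simp [i3])
  have r4 : z4 = (z4.re : ℂ) := Complex.ext (by simp) (by simp [i4])
  generalize z1.re = x1 at r1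
  generalize z2.re = x2 at r2
  generalize z3.re = x3 at r3
  generalize z4.re = x4 at r4
  subst r1 r2 r3 r4
  have e1 : a = -(x1+x2+x3+x4) := by
    have : (a:ℂ) = -(x1+x2+x3+x4) := by rw [h4]; ring
    exact_mod_cast this
  have e2 : b = x1*x2+x1*x3+x1*x4+x2*x3+x2*x4+x3*x4 := by
    have : (b:ℂ) = x1*x2+x1*x3+x1*x4+x2*x3+x2*x4+x3*x4 := by rw [h4]; linear_combination h3
    exact_mod_cast this
  have e3 : c = -(x1*x2*x3+x1*x2*x4+x1*x3*x4+x2*x3*x4) := by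
    have h2' : x2^3+(a+x1)*x2^2+(b+a*x1+x1^2)*x2+(c+b*x1+a*x1^2+x1^3) = 0 := by exact_mod_cast h2
    rw [e1, e2] at h2'
    linear_combination h2'
  have e4 : d = x1*x2*x3*x4 := by
    have h1' : x1^4+a*x1^3+b*x1^2+c*x1+d = 0 := by exact_mod_cast h1
    rw [e1, e2, e3] at h1'
    linear_combination h1'
  subst e1 e2 e3 e4
  nlinarith [sq_nonneg ((x1-x2)*(t-x3)*(t-x4)), sq_nonneg ((x1-x3)*(t-x2)*(t-x4)), sq_nonneg ((x1-x4)*(t-x3)*(t-x2)),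
    sq_nonneg ((x2-x3)*(t-x1)*(t-x4)), sq_nonneg ((x2-x4)*(t-x3)*(t-x1)), sq_nonneg ((x3-x4)*(t-x1)*(t-x2))]

open Polynomial in
theorem quartic_field (a b c d : ℤ) (q : ℕ) [Fact q.Prime]
    (h1 : ∀ x : ZMod q, x^4+a*x^3+b*x^2+c*x+d ≠ 0)
    (h2 : ∀ x y u v : ZMod q, ¬ (x+u = a ∧ y+v+x*u = b ∧ x*v+y*u = c ∧ y*v = d))
    (t : ℝ) (ht : 3 * (4*t^3+3*a*t^2+2*b*t+c)^2 < 8 * (t^4+a*t^3+b*t^2+c*t+d) * (6*t^2+3*a*t+b))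
    (r : ℝ) (hr : r^4+a*r^3+b*r^2+c*r+d = 0) :
    ∃ (K : Type) (_ : Field K) (_ : NumberField K) (θ : K), θ^4+a*θ^3+b*θ^2+c*θ+d = 0 ∧
      (∀ c0 c1 c2 c3 : ℚ, (c0:K)+c1*θ+c2*θ^2+c3*θ^3 = 0 → c0 = 0 ∧ c1 = 0 ∧ c2 = 0 ∧ c3 = 0) ∧
      Module.finrank ℚ K = 4 ∧ (∃ φ : K →+* ℂ, ¬ NumberField.ComplexEmbedding.IsReal φ) ∧
      Nonempty (K →+* ℝ) := by
  let f : ℤ[X] := X^4 + C a * X^3 + C b * X^2 + C c * X + C d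
  have hdeg : f.natDegree = 4 := by simp only [f]; compute_degree!
  have hmon : f.Monic := by simp only [f]; monicity!
  let g : (ZMod q)[X] := X^4 + C (a:ZMod q) * X^3 + C (b:ZMod q) * X^2 + C (c:ZMod q) * X + C (d:ZMod q)
  have hgd : g.natDegree = 4 := by simp only [g]; compute_degree!
  have hgm : g.Monic := by simp only [g]; monicity!
  have hmap : f.map (Int.castRingHom (ZMod q)) = g := by simp [f, g]
  have hgirr : Irreducible g := by
    rw [hgm.irreducible_iff_lt_natDegree_lt (by intro h; rw [h] at hgd; simp at hgd)]
    intro k hk hkd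
    rw [hgd] at hkd
    simp only [Finset.mem_Ioc] at hkd
    rintro ⟨m, hm⟩
    have hmm : m.Monic := hk.of_mul_monic_left (hm ▸ hgm)
    have hsum : k.natDegree + m.natDegree = 4 := by
      rw [← hk.natDegree_mul hmm, ← hm, hgd]
    have hcase : k.natDegree = 1 ∨ k.natDegree = 2 := by omega
    rcases hcase with hc | hc
    · have hk1 : k = X + C (k.coeff 0) := by
        have := hk.eq_X_add_C hc
        exact this
      apply h1 (- k.coeff 0)
      have : g.eval (- k.coeff 0) = 0 := by
        rw [hm, eval_mul, hk1]; simp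
      simpa [g] using this
    · have hmd : m.natDegree = 2 := by omega
      have hk2 : k = X^2 + C (k.coeff 1) * X + C (k.coeff 0) := by
        ext n
        rcases n with _ | _ | _ | n
        · simp
        · simp [coeff_X, coeff_C]
        · have := hk.coeff_natDegree
          rw [hc] at this
          simp [coeff_X, coeff_C, this]
        · rw [coeff_eq_zero_of_natDegree_lt (by omega)]
          simp [coeff_X, coeff_C, coeff_X_pow]
      have hm2 : m = X^2 + C (m.coeff 1) * X + C (m.coeff 0) := by
        ext n
        rcases n with _ | _ | _ | n
        · simp
        · simp [coeff_X, coeff_C]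
        · have := hmm.coeff_natDegree
          rw [hmd] at this
          simp [coeff_X, coeff_C, this]
        · rw [coeff_eq_zero_of_natDegree_lt (by omega)]
          simp [coeff_X, coeff_C, coeff_X_pow]
      apply h2 (k.coeff 1) (k.coeff 0) (m.coeff 1) (m.coeff 0)
      generalize k.coeff 1 = x at hk2 ⊢
      generalize k.coeff 0 = y at hk2 ⊢
      generalize m.coeff 1 = u at hm2 ⊢
      generalize m.coeff 0 = v at hm2 ⊢
      have hprod : g = X^4 + C (x+u) * X^3 + C (y+v+x*u) * X^2 + C (x*v+y*u) * X + C (y*v) := by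
        rw [hm, hk2, hm2]
        simp only [C_add, C_mul]
        ring
      have hco : ∀ n, g.coeff n = (X^4 + C (x+u) * X^3 + C (y+v+x*u) * X^2 + C (x*v+y*u) * X + C (y*v)).coeff n := fun n => by rw [hprod]
      have k0 := hco 0
      have k1 := hco 1
      have k2 := hco 2
      have k3 := hco 3
      simp only [g, coeff_add, coeff_C_mul, coeff_X, coeff_C, coeff_X_pow] at k0 k1 k2 k3
      norm_num at k0 k1 k2 k3
      refine ⟨k3.symm, k2.symm, k1.symm, k0.symm⟩
  have hfirr : Irreducible f := hmon.irreducible_of_irreducible_map (Int.castRingHom (ZMod q)) f (by rw [hmap]; exact hgirr)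
  let F : ℚ[X] := X^4 + C (a:ℚ) * X^3 + C (b:ℚ) * X^2 + C (c:ℚ) * X + C (d:ℚ)
  have hFmap : f.map (algebraMap ℤ ℚ) = F := by simp [f, F]
  have hFirr : Irreducible F := by
    rw [← hFmap]; exact (hmon.irreducible_iff_irreducible_map_fraction_map (K := ℚ)).mp hfirr
  have hFd : F.natDegree = 4 := by simp only [F]; compute_degree!
  have hF0 : F ≠ 0 := hFirr.ne_zero
  haveI : Fact (Irreducible F) := ⟨hFirr⟩
  let pb := AdjoinRoot.powerBasis hF0
  haveI : Module.Finite ℚ (AdjoinRoot F) := pb.finite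
  haveI : NumberField (AdjoinRoot F) := { to_charZero := inferInstance, to_finiteDimensional := inferInstance }
  refine ⟨AdjoinRoot F, inferInstance, inferInstance, AdjoinRoot.root F, ?_, ?_, ?_, ?_, ?_⟩
  · have := AdjoinRoot.eval₂_root F
    simp only [F, eval₂_add, eval₂_mul, eval₂_pow, eval₂_X, eval₂_C] at this
    simp only [map_intCast] at this
    exact this
  · intro c0 c1 c2 c3 h
    have hz : AdjoinRoot.mk F (C c0 + C c1 * X + C c2 * X^2 + C c3 * X^3) = 0 := by
      simpa using h
    rw [AdjoinRoot.mk_eq_zero] at hz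
    have hlt : (C c0 + C c1 * X + C c2 * X^2 + C c3 * X^3).natDegree < F.natDegree := by
      rw [hFd]
      have : (C c0 + C c1 * X + C c2 * X^2 + C c3 * X^3).natDegree ≤ 3 := by compute_degree!
      omega
    have := Polynomial.eq_zero_of_dvd_of_natDegree_lt hz hlt
    have hc : ∀ n, (C c0 + C c1 * X + C c2 * X^2 + C c3 * X^3).coeff n = 0 := fun n => by rw [this]; simp
    have k0 := hc 0
    have k1 := hc 1
    have k2 := hc 2
    have k3 := hc 3
    simp [coeff_X, coeff_C, coeff_X_pow] at k0 k1 k2 k3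
    exact ⟨k0, k1, k2, k3⟩
  · rw [pb.finrank, AdjoinRoot.powerBasis_dim, hFd]
  · obtain ⟨z, hz, hzim⟩ := quartic_nonreal a b c d t ht
    refine ⟨AdjoinRoot.lift (algebraMap ℚ ℂ) z (by simp only [F, eval₂_add, eval₂_mul, eval₂_pow, eval₂_X, eval₂_C]; simp only [map_intCast]; exact_mod_cast hz), ?_⟩
    intro hreal
    have := RingHom.congr_fun hreal (AdjoinRoot.root F)
    simp at this
    rw [Complex.conj_eq_iff_im] at this
    exact hzim this
  · exact ⟨AdjoinRoot.lift (algebraMap ℚ ℝ) r (by simp only [F, eval₂_add, eval₂_mul, eval₂_pow, eval₂_X, eval₂_C]; simp only [map_intCast]; exact_mod_cast hr)⟩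

theorem skolem_gen {R : Type} [CommRing R] [Module.Finite ℤ R]
    (hdep : ∀ a b c : Rˣ, ∃ l m n : ℤ, ¬ (l = 0 ∧ m = 0 ∧ n = 0) ∧ a ^ l * b ^ m * c ^ n = 1)
    (htor : ∀ (w : Rˣ) (g : ℕ), 0 < g → w ^ g = 1 → w = 1 ∨ w = -1)
    (p : ℕ) [Fact p.Prime] (q : ℤ) (hq0 : q ≠ 0) (hpq : (p : ℤ) ∣ q)
    (hpow : ∀ (d e : ℤ) (W : R), ∃ W' : R, ((d:R) + (q:R) * e * W) ^ p
      = (d:R) ^ p + (p:R) * q * e * ((d:R) ^ (p-1) * W + (p:R) * W'))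
    (c0 c2 c3 : R →+ ℤ) (h01 : c0 1 = 1) (h21 : c2 1 = 0) (h31 : c3 1 = 0)
    (u v : Rˣ) (du dv : ℤ) (wu wv : R) (hu : (u : R) = du + q * wu) (hv : (v : R) = dv + q * wv)
    (hdet : ¬ (p : ℤ) ∣ (c2 wu * c3 wv - c3 wu * c2 wv))
    (η : Rˣ) (dη : ℤ) (wη : R) (hη : (η : R) = dη + q * wη) (h2 : c2 (η : R) = 0) (h3 : c3 (η : R) = 0) (k : ℕ) :
    ∃ (d : ℤ) (w : R), (η : R) = d + ((p ^ k : ℤ) : R) * w := by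
  have hp : Prime (p : ℤ) := Nat.prime_iff_prime_int.mp Fact.out
  have hlin : ∀ (c : R →+ ℤ) (n : ℤ) (w : R), c ((n : R) * w) = n * c w := by
    intro c n w
    rw [← zsmul_eq_mul, map_zsmul, smul_eq_mul]
  have h_integ : ∀ (c : R →+ ℤ) (n : ℤ), c (n : R) = n * c 1 := by
    intro c n
    rw [← hlin, mul_one]
  let M : Subring R :=
    { carrier := {x | ∃ (d : ℤ) (w : R), x = d + (q : R) * w}
      mul_mem' := by
        rintro a b ⟨d, w, rfl⟩ ⟨d', w', rfl⟩
        refine ⟨d * d', d * w' + d' * w + q * w * w', ?_⟩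
        push_cast; ring
      one_mem' := ⟨1, 0, by simp⟩
      add_mem' := by
        rintro a b ⟨d, w, rfl⟩ ⟨d', w', rfl⟩
        refine ⟨d + d', w + w', ?_⟩
        push_cast; ring
      zero_mem' := ⟨0, 0, by simp⟩
      neg_mem' := by
        rintro a ⟨d, w, rfl⟩
        refine ⟨-d, -w, ?_⟩
        push_cast; ring }
  let S : Subgroup Rˣ :=
    { carrier := {x | (x : R) ∈ M}
      mul_mem' := by
        intro a b ha hb
        exact M.mul_mem ha hb
      one_mem' := M.one_mem
      inv_mem' := by
        intro a ha
        exact unit_inv_mem M a ha }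
  have hS : ∀ x : Rˣ, x ∈ S ↔ ∃ (d : ℤ) (w : R), (x:R) = d + (q : R) * w := fun x => Iff.rfl
  let L : Rˣ → ZMod p × ZMod p := fun x =>
    (((c2 (x:R) / q : ℤ) : ZMod p) * ((c0 (x:R) : ℤ) : ZMod p)⁻¹, ((c3 (x:R) / q : ℤ) : ZMod p) * ((c0 (x:R) : ℤ) : ZMod p)⁻¹)
  have hq : ((q : ℤ) : ZMod p) = 0 := by
    rw [ZMod.intCast_zmod_eq_zero_iff_dvd]; exact hpq
  have hLv : ∀ (x : Rˣ) (d : ℤ) (w : R), (x:R) = d + (q : R) * w →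
      L x = (((c2 w : ℤ) : ZMod p) * (d : ZMod p)⁻¹, ((c3 w : ℤ) : ZMod p) * (d : ZMod p)⁻¹) := by
    intro x d w hx
    have e2 : c2 (x:R) / q = c2 w := by
      rw [hx, map_add, hlin, h_integ, h21, mul_zero, zero_add, Int.mul_ediv_cancel_left _ hq0]
    have e3 : c3 (x:R) / q = c3 w := by
      rw [hx, map_add, hlin, h_integ, h31, mul_zero, zero_add, Int.mul_ediv_cancel_left _ hq0]
    have e0 : ((c0 (x:R) : ℤ) : ZMod p) = d := by
      rw [hx, map_add, hlin, h_integ, h01]; push_cast; rw [hq]; ring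
    simp only [L, e2, e3, e0]
  have hunit : ∀ (x : Rˣ) (d : ℤ) (w : R), (x:R) = d + (q : R) * w → ((d : ℤ) : ZMod p) ≠ 0 := by
    intro x d w hx hd
    obtain ⟨d', w', hx'⟩ := unit_inv_mem M x ⟨d, w, hx⟩
    have e : (x : R) * ((x⁻¹ : Rˣ) : R) = 1 := by simp
    rw [hx, hx'] at e
    have e2 : ((d * d' : ℤ) : R) + (q : R) * (d * w' + d' * w + q * w * w') = 1 := by
      rw [← e]; push_cast; ring
    have e3 := congrArg c0 e2
    rw [map_add, hlin, h_integ, h01, mul_one] at e3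
    have e4 := congrArg (fun z : ℤ => (z : ZMod p)) e3
    push_cast at e4
    rw [hq, hd] at e4
    simp at e4
  have hL : ∀ x ∈ S, ∀ y ∈ S, L (x * y) = L x + L y := by
    rintro x ⟨d, w, hx⟩ y ⟨d', w', hy⟩
    have e : ((x * y : Rˣ) : R) = ((d * d' : ℤ) : R) + (q : R) * (d * w' + d' * w + q * (w * w')) := by
      rw [Units.val_mul, hx, hy]; push_cast; ring
    rw [hLv x d w hx, hLv y d' w' hy, hLv _ _ _ e]
    have n1 := hunit x d w hx
    have n2 := hunit y d' w' hy
    simp only [map_add, hlin]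
    push_cast
    rw [hq]
    ext
    · simp only [Prod.fst_add]; field_simp; ring
    · simp only [Prod.snd_add]; field_simp; ring
  have hLneg : L (-1) = 0 := by
    rw [hLv (-1) (-1) 0 (by simp)]; simp
  have hdet' : (L u).1 * (L v).2 - (L u).2 * (L v).1 ≠ 0 := by
    rw [hLv u du wu hu, hLv v dv wv hv]
    have n1 := hunit u du wu hu
    have n2 := hunit v dv wv hv
    intro h
    apply hdet
    rw [← ZMod.intCast_zmod_eq_zero_iff_dvd]
    push_cast
    field_simp at h
    linear_combination h
  have key : ∀ k : ℕ, ∃ y : Rˣ, y ∈ S ∧ (η = y ^ (p ^ k) ∨ η = - y ^ (p ^ k)) := by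
    intro k
    induction k with
    | zero => exact ⟨η, ⟨dη, wη, hη⟩, by simp⟩
    | succ k ih =>
      obtain ⟨y, hy, hyη⟩ := ih
      obtain ⟨d, w, hdw⟩ := hy
      have hd := hunit y d w hdw
      have hpw : ∀ k : ℕ, ∃ (D G : ℤ) (w' : R), ((G : ℤ) : ZMod p) ≠ 0 ∧
          ((y ^ (p ^ k) : Rˣ) : R) = (D : R) + (q : R) * ((p^k : ℤ) : R) * (G * w + (p : R) * w') ∧ ((D : ℤ) : ZMod p) ≠ 0 := by
        intro k
        induction k with
        | zero => exact ⟨d, 1, 0, by simp, by simp [hdw], hd⟩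
        | succ k ih =>
          obtain ⟨D, G, w', hG, hyk, hD⟩ := ih
          obtain ⟨W', hW'⟩ := hpow D (p^k) (G * w + (p : R) * w')
          refine ⟨D ^ p, D ^ (p - 1) * G, D ^ (p-1) * w' + W', ?_, ?_, ?_⟩
          · push_cast
            exact mul_ne_zero (pow_ne_zero _ hD) hG
          · rw [pow_succ, pow_mul, Units.val_pow_eq_pow_val, hyk, hW']
            push_cast
            ring
          · push_cast
            exact pow_ne_zero _ hD
      have hz : ∀ (c : R →+ ℤ), c 1 = 0 → c (η : R) = 0 → ((c w : ℤ) : ZMod p) = 0 := by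
        intro c hc1 hcη
        obtain ⟨D, G, w', hG, hyk, hD⟩ := hpw k
        have e1 : c ((y ^ (p ^ k) : Rˣ) : R) = 0 := by
          rcases hyη with h | h
          · rw [← h]; exact hcη
          · have : y ^ (p ^ k) = - η := by rw [h]; simp
            rw [this, Units.val_neg, map_neg, hcη, neg_zero]
        have e2 : ((y ^ (p ^ k) : Rˣ) : R) = (D : R) + ((q * p^k : ℤ) : R) * (((G : ℤ) : R) * w + ((p : ℤ) : R) * w') := by
          rw [hyk]; push_cast; ring
        rw [e2, map_add, hlin, h_integ, hc1, map_add, hlin, hlin, mul_zero, zero_add] at e1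
        have e3 : G * c w + p * c w' = 0 := by
          rcases mul_eq_zero.mp e1 with h | h
          · exfalso
            rcases mul_eq_zero.mp h with h | h
            · exact hq0 h
            · exact pow_ne_zero k hp.ne_zero h
          · exact h
        have e4 := congrArg (fun z : ℤ => (z : ZMod p)) e3
        push_cast at e4
        rw [ZMod.natCast_self] at e4
        simp only [zero_mul, add_zero] at e4
        exact (mul_eq_zero.mp e4).resolve_left hG
      have hLy : L y = 0 := by
        rw [hLv y d w hdw, hz c2 h21 h2, hz c3 h31 h3]; simp
      obtain ⟨y', hy'S, hy'⟩ := skolem_step hdep htor p S L hL hLneg u v ⟨du, wu, hu⟩ ⟨dv, wv, hv⟩ hdet' y ⟨d, w, hdw⟩ hLy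
      refine ⟨y', hy'S, ?_⟩
      have e5 : y ^ (p ^ k) = y' ^ (p ^ (k+1)) ∨ y ^ (p ^ k) = - y' ^ (p ^ (k+1)) := by
        rcases hy' with h | h
        · left; rw [h, ← pow_mul, pow_succ, mul_comm]
        · rw [h, neg_pow, ← pow_mul, pow_succ, mul_comm p]
          rcases neg_one_pow_eq_or Rˣ (p^k) with h' | h'
          · left; rw [h']; simp
          · right; rw [h']; simp
      rcases hyη with h | h <;> rcases e5 with h' | h' <;> rw [h, h'] <;> simp
  obtain ⟨y, ⟨d, w, hdw⟩, hyη⟩ := key k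
  have hpw : ∀ k : ℕ, ∃ (D : ℤ) (w' : R),
          ((y ^ (p ^ k) : Rˣ) : R) = (D : R) + (q : R) * ((p^k : ℤ) : R) * w' := by
    intro k
    induction k with
    | zero => exact ⟨d, w, by simp [hdw]⟩
    | succ k ih =>
      obtain ⟨D, w', hyk⟩ := ih
      obtain ⟨W', hW'⟩ := hpow D (p^k) w'
      refine ⟨D ^ p, D ^ (p-1) * w' + p * W', ?_⟩
      rw [pow_succ, pow_mul, Units.val_pow_eq_pow_val, hyk, hW']
      push_cast
      ring
  obtain ⟨D, w', hD⟩ := hpw k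
  rcases hyη with h | h
  · exact ⟨D, q * w', by rw [h, hD]; push_cast; ring⟩
  · exact ⟨-D, -(q * w'), by rw [h, Units.val_neg, hD]; push_cast; ring⟩

theorem eq_zero_of_pow_dvd (p : ℤ) (hp : 2 ≤ p) (s : ℤ) (h : ∀ k : ℕ, p ^ k ∣ s) : s = 0 := by
  by_contra hs
  have h1 := h s.natAbs
  have h2 := Int.le_of_dvd (abs_pos.mpr hs) ((dvd_abs _ _).mpr h1)
  have h3 : (s.natAbs : ℤ) < 2 ^ s.natAbs := by exact_mod_cast Nat.lt_two_pow_self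
  have h4 : (2:ℤ) ^ s.natAbs ≤ p ^ s.natAbs := pow_le_pow_left₀ (by norm_num) hp _
  rw [Int.natCast_natAbs] at h3
  linarith

instance fact_prime_5 : Fact (Nat.Prime 5) := ⟨by norm_num⟩
instance fact_prime_11 : Fact (Nat.Prime 11) := ⟨by norm_num⟩

structure QA where
  c0 : ℤ
  c1 : ℤ
  c2 : ℤ
  c3 : ℤ

namespace QA

@[ext] theorem ext' {x y : QA} (h0 : x.c0 = y.c0) (h1 : x.c1 = y.c1) (h2 : x.c2 = y.c2) (h3 : x.c3 = y.c3) : x = y := by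
  cases x; cases y; simp_all

instance : Zero QA := ⟨⟨0, 0, 0, 0⟩⟩
instance : One QA := ⟨⟨1, 0, 0, 0⟩⟩
instance : Add QA := ⟨fun x y => ⟨x.c0 + y.c0, x.c1 + y.c1, x.c2 + y.c2, x.c3 + y.c3⟩⟩
instance : Neg QA := ⟨fun x => ⟨-x.c0, -x.c1, -x.c2, -x.c3⟩⟩
instance : Mul QA := ⟨fun x y => ⟨x.c0*y.c0 + (-18)*x.c1*y.c1 + (-6)*(x.c1*y.c2 + x.c2*y.c1) + (-6)*(x.c1*y.c3 + x.c3*y.c1) + (6)*x.c2*y.c2 + (-6)*(x.c2*y.c3 + x.c3*y.c2) + (-2)*x.c3*y.c3,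
    x.c0*y.c1 + x.c1*y.c0 + (-9)*(x.c1*y.c2 + x.c2*y.c1) + (4)*(x.c1*y.c3 + x.c3*y.c1) + (10)*x.c2*y.c2 + (-8)*(x.c2*y.c3 + x.c3*y.c2) + (4)*x.c3*y.c3,
    x.c0*y.c2 + x.c2*y.c0 + (24)*x.c1*y.c1 + (-18)*(x.c1*y.c2 + x.c2*y.c1) + (18)*(x.c1*y.c3 + x.c3*y.c1) + (21)*x.c2*y.c2 + (-14)*(x.c2*y.c3 + x.c3*y.c2) + (14)*x.c3*y.c3,
    x.c0*y.c3 + x.c3*y.c0 + (21)*(x.c1*y.c2 + x.c2*y.c1) + (-6)*(x.c1*y.c3 + x.c3*y.c1) + (-21)*x.c2*y.c2 + (18)*(x.c2*y.c3 + x.c3*y.c2) + (-6)*x.c3*y.c3⟩⟩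

@[simp] theorem zero_c0 : (0 : QA).c0 = 0 := rfl
@[simp] theorem one_c0 : (1 : QA).c0 = 1 := rfl
@[simp] theorem add_c0 (x y : QA) : (x + y).c0 = x.c0 + y.c0 := rfl
@[simp] theorem neg_c0 (x : QA) : (-x).c0 = -x.c0 := rfl
theorem mul_c0 (x y : QA) : (x * y).c0 = x.c0*y.c0 + (-18)*x.c1*y.c1 + (-6)*(x.c1*y.c2 + x.c2*y.c1) + (-6)*(x.c1*y.c3 + x.c3*y.c1) + (6)*x.c2*y.c2 + (-6)*(x.c2*y.c3 + x.c3*y.c2) + (-2)*x.c3*y.c3 := rfl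
@[simp] theorem zero_c1 : (0 : QA).c1 = 0 := rfl
@[simp] theorem one_c1 : (1 : QA).c1 = 0 := rfl
@[simp] theorem add_c1 (x y : QA) : (x + y).c1 = x.c1 + y.c1 := rfl
@[simp] theorem neg_c1 (x : QA) : (-x).c1 = -x.c1 := rfl
theorem mul_c1 (x y : QA) : (x * y).c1 = x.c0*y.c1 + x.c1*y.c0 + (-9)*(x.c1*y.c2 + x.c2*y.c1) + (4)*(x.c1*y.c3 + x.c3*y.c1) + (10)*x.c2*y.c2 + (-8)*(x.c2*y.c3 + x.c3*y.c2) + (4)*x.c3*y.c3 := rfl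
@[simp] theorem zero_c2 : (0 : QA).c2 = 0 := rfl
@[simp] theorem one_c2 : (1 : QA).c2 = 0 := rfl
@[simp] theorem add_c2 (x y : QA) : (x + y).c2 = x.c2 + y.c2 := rfl
@[simp] theorem neg_c2 (x : QA) : (-x).c2 = -x.c2 := rfl
theorem mul_c2 (x y : QA) : (x * y).c2 = x.c0*y.c2 + x.c2*y.c0 + (24)*x.c1*y.c1 + (-18)*(x.c1*y.c2 + x.c2*y.c1) + (18)*(x.c1*y.c3 + x.c3*y.c1) + (21)*x.c2*y.c2 + (-14)*(x.c2*y.c3 + x.c3*y.c2) + (14)*x.c3*y.c3 := rfl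
@[simp] theorem zero_c3 : (0 : QA).c3 = 0 := rfl
@[simp] theorem one_c3 : (1 : QA).c3 = 0 := rfl
@[simp] theorem add_c3 (x y : QA) : (x + y).c3 = x.c3 + y.c3 := rfl
@[simp] theorem neg_c3 (x : QA) : (-x).c3 = -x.c3 := rfl
theorem mul_c3 (x y : QA) : (x * y).c3 = x.c0*y.c3 + x.c3*y.c0 + (21)*(x.c1*y.c2 + x.c2*y.c1) + (-6)*(x.c1*y.c3 + x.c3*y.c1) + (-21)*x.c2*y.c2 + (18)*(x.c2*y.c3 + x.c3*y.c2) + (-6)*x.c3*y.c3 := rfl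

instance : CommRing QA where
  add_assoc x y z := by ext <;> simp <;> ring
  zero_add x := by ext <;> simp
  add_zero x := by ext <;> simp
  add_comm x y := by ext <;> simp <;> ring
  neg_add_cancel x := by ext <;> simp
  mul_assoc x y z := by ext <;> simp only [mul_c0, mul_c1, mul_c2, mul_c3] <;> ring
  one_mul x := by ext <;> simp [mul_c0, mul_c1, mul_c2, mul_c3]
  mul_one x := by ext <;> simp [mul_c0, mul_c1, mul_c2, mul_c3]
  zero_mul x := by ext <;> simp [mul_c0, mul_c1, mul_c2, mul_c3]
  mul_zero x := by ext <;> simp [mul_c0, mul_c1, mul_c2, mul_c3]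
  mul_comm x y := by ext <;> simp only [mul_c0, mul_c1, mul_c2, mul_c3] <;> ring
  left_distrib x y z := by ext <;> simp only [mul_c0, mul_c1, mul_c2, mul_c3, add_c0, add_c1, add_c2, add_c3] <;> ring
  right_distrib x y z := by ext <;> simp only [mul_c0, mul_c1, mul_c2, mul_c3, add_c0, add_c1, add_c2, add_c3] <;> ring
  nsmul := nsmulRec
  zsmul := zsmulRec
  natCast n := ⟨n, 0, 0, 0⟩
  natCast_zero := by ext <;> simp
  natCast_succ n := by ext <;> simp
  intCast n := ⟨n, 0, 0, 0⟩
  intCast_ofNat n := rfl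
  intCast_negSucc n := rfl

theorem int_c0 (n : ℤ) : (n : QA).c0 = n := rfl
def p0 : QA →+ ℤ where
  toFun := c0
  map_zero' := rfl
  map_add' _ _ := rfl
theorem p0_apply (x : QA) : p0 x = x.c0 := rfl
theorem int_c1 (n : ℤ) : (n : QA).c1 = 0 := rfl
def p1 : QA →+ ℤ where
  toFun := c1
  map_zero' := rfl
  map_add' _ _ := rfl
theorem p1_apply (x : QA) : p1 x = x.c1 := rfl
theorem int_c2 (n : ℤ) : (n : QA).c2 = 0 := rfl
def p2 : QA →+ ℤ where
  toFun := c2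
  map_zero' := rfl
  map_add' _ _ := rfl
theorem p2_apply (x : QA) : p2 x = x.c2 := rfl
theorem int_c3 (n : ℤ) : (n : QA).c3 = 0 := rfl
def p3 : QA →+ ℤ where
  toFun := c3
  map_zero' := rfl
  map_add' _ _ := rfl
theorem p3_apply (x : QA) : p3 x = x.c3 := rfl

instance : Module.Finite ℤ QA := by
  let g : (Fin 4 → ℤ) →+ QA :=
    { toFun := fun v => ⟨v 0, v 1, v 2, v 3⟩
      map_zero' := rfl
      map_add' := fun _ _ => rfl }
  refine Module.Finite.of_surjective g.toIntLinearMap ?_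
  intro x
  exact ⟨![x.c0, x.c1, x.c2, x.c3], rfl⟩

def th : QA := ⟨0, 1, 0, 0⟩

theorem th_rel : th^4 + (24)*th^3 + (-36)*th^2 + (-144)*th + (-972) = 0 := by
  have e2 : th^2 = ⟨-18, 0, 24, 0⟩ := by rw [pow_two]; rfl
  have e3 : th^3 = ⟨-144, -234, -432, 504⟩ := by rw [pow_succ, e2]; rfl
  have e4 : th^4 = ⟨3780, 5760, 11232, -12096⟩ := by rw [pow_succ, e3]; rfl
  rw [e2, e3, e4]; rfl

/-- the element t - s θ as a unit -/
def eta (t s : ℤ) (h : t^4 + (24)*t^3*s + (-36)*t^2*s^2 + (-144)*t*s^3 + (-972)*s^4 = 1) : QAˣ :=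
  have h' : (t:QA)^4 + (24)*t^3*s + (-36)*t^2*s^2 + (-144)*t*s^3 + (-972)*s^4 = 1 := by exact_mod_cast congrArg (fun z : ℤ => (z : QA)) h
  Units.mkOfMulEqOne ((t:QA) - s * th) ((t:QA)^3 + t^2*s*th + t*s^2*th^2 + s^3*th^3 + (24)*s*(t^2+t*s*th+s^2*th^2) + (-36)*s^2*(t+s*th) + (-144)*s^3)
    (by linear_combination h' - (s:QA)^4 * th_rel)

theorem eta_val (t s : ℤ) (h) : ((eta t s h : QAˣ) : QA) = ⟨t, -s, 0, 0⟩ := by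
  have : ((eta t s h : QAˣ) : QA) = (t:QA) - s * th := rfl
  rw [this, sub_eq_add_neg]
  ext <;> simp [mul_c0, mul_c1, mul_c2, mul_c3, int_c0, int_c1, int_c2, int_c3, th]

/-- embedding in a number field -/
theorem exists_emb : ∃ (K : Type) (_ : Field K) (_ : NumberField K) (ι : QA →+* K), Function.Injective ι ∧
      Module.finrank ℚ K = 4 ∧ (∃ φ : K →+* ℂ, ¬ NumberField.ComplexEmbedding.IsReal φ) ∧
      Nonempty (K →+* ℝ) := by
  obtain ⟨r, hr⟩ : ∃ r : ℝ, r^4+((24:ℤ):ℝ)*r^3+((-36:ℤ):ℝ)*r^2+((-144:ℤ):ℝ)*r+((-972:ℤ):ℝ) = 0 := by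
    have hc : ContinuousOn (fun r : ℝ => r^4+((24:ℤ):ℝ)*r^3+((-36:ℤ):ℝ)*r^2+((-144:ℤ):ℝ)*r+((-972:ℤ):ℝ)) (Set.Icc 4 5) := by fun_prop
    have := intermediate_value_Icc (by norm_num) hc
    obtain ⟨r, -, hr⟩ := this (show (0:ℝ) ∈ _ by constructor <;> norm_num)
    exact ⟨r, hr⟩
  obtain ⟨K, iF, iN, θ, hθ, hind, hdeg, hφ, hσ⟩ := quartic_field (24) (-36) (-144) (-972) 5
    (by decide +kernel) (by decide +kernel) (0) (by norm_num) r hr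
  refine ⟨K, iF, iN, ?_⟩
  push_cast at hθ
  obtain ⟨w2, hw2⟩ : ∃ w2 : K, w2 = (3/4)*θ^0 + (0)*θ^1 + (1/24)*θ^2 := ⟨_, rfl⟩
  obtain ⟨w3, hw3⟩ : ∃ w3 : K, w3 = (13/14)*θ^0 + (13/28)*θ^1 + (1/28)*θ^2 + (1/504)*θ^3 := ⟨_, rfl⟩
  have r11 : θ*θ = (-18)*1 + (0)*θ + (24)*w2 + (0)*w3 := by
    rw [hw2, hw3]; ring
  have r12 : θ*w2 = (-6)*1 + (-9)*θ + (-18)*w2 + (21)*w3 := by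
    rw [hw2, hw3]; linear_combination ((0)*θ^0 + (0)*θ^1 + (0)*θ^2) * hθ
  have r13 : θ*w3 = (-6)*1 + (4)*θ + (18)*w2 + (-6)*w3 := by
    rw [hw2, hw3]; linear_combination ((1/504)*θ^0 + (0)*θ^1 + (0)*θ^2) * hθ
  have r22 : w2*w2 = (6)*1 + (10)*θ + (21)*w2 + (-21)*w3 := by
    rw [hw2, hw3]; linear_combination ((1/576)*θ^0 + (0)*θ^1 + (0)*θ^2) * hθ
  have r23 : w2*w3 = (-6)*1 + (-8)*θ + (-14)*w2 + (18)*w3 := by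
    rw [hw2, hw3]; linear_combination ((-1/2016)*θ^0 + (1/12096)*θ^1 + (0)*θ^2) * hθ
  have r33 : w3*w3 = (-2)*1 + (4)*θ + (14)*w2 + (-6)*w3 := by
    rw [hw2, hw3]; linear_combination ((5/2352)*θ^0 + (1/21168)*θ^1 + (1/254016)*θ^2) * hθ
  let ι : QA →+* K :=
    { toFun := fun x => (x.c0:K) + x.c1*θ + x.c2*w2 + x.c3*w3
      map_one' := by simp
      map_zero' := by simp
      map_add' := by intro x y; simp only [add_c0, add_c1, add_c2, add_c3]; push_cast; ring
      map_mul' := by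
        intro x y
        simp only [mul_c0, mul_c1, mul_c2, mul_c3]
        push_cast
        linear_combination (-1) * ((x.c1*y.c1)*r11 + (x.c1*y.c2 + x.c2*y.c1)*r12 + (x.c1*y.c3 + x.c3*y.c1)*r13 + (x.c2*y.c2)*r22 + (x.c2*y.c3 + x.c3*y.c2)*r23 + (x.c3*y.c3)*r33) }
  refine ⟨ι, ?_, hdeg, hφ, hσ⟩
  rw [injective_iff_map_eq_zero]
  intro x hx
  have hx' : (x.c0:K) + x.c1*θ + x.c2*w2 + x.c3*w3 = 0 := hx
  rw [hw2, hw3] at hx'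
  obtain ⟨k0, k1, k2, k3⟩ := hind ((x.c0:ℚ) + (3/4)*x.c2 + (13/14)*x.c3) ((x.c1:ℚ) + (0)*x.c2 + (13/28)*x.c3) ((1/24)*x.c2 + (1/28)*x.c3) ((0)*x.c2 + (1/504)*x.c3) (by
    push_cast; linear_combination hx')
  have j3 : (x.c3:ℚ) = 0 := by linarith
  have j2 : (x.c2:ℚ) = 0 := by linarith
  have j1 : (x.c1:ℚ) = 0 := by linarith
  have j0 : (x.c0:ℚ) = 0 := by linarith
  ext
  · exact_mod_cast j0
  · exact_mod_cast j1
  · exact_mod_cast j2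
  · exact_mod_cast j3

theorem dep (a b c : QAˣ) : ∃ l m n : ℤ, ¬ (l = 0 ∧ m = 0 ∧ n = 0) ∧ a ^ l * b ^ m * c ^ n = 1 := by
  obtain ⟨K, _, _, ι, hι, hdeg, ⟨φ, hφ⟩, hσ⟩ := exists_emb
  exact ring_dep hdeg φ hφ ι hι a b c

theorem tor (w : QAˣ) (g : ℕ) (hg : 0 < g) (h : w ^ g = 1) : w = 1 ∨ w = -1 := by
  obtain ⟨K, _, _, ι, hι, hdeg, hφ, ⟨σ⟩⟩ := exists_emb
  exact real_tor (σ.comp ι) (σ.injective.comp hι) w g hg h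

end QA

structure QB where
  c0 : ℤ
  c1 : ℤ
  c2 : ℤ
  c3 : ℤ

namespace QB

@[ext] theorem ext' {x y : QB} (h0 : x.c0 = y.c0) (h1 : x.c1 = y.c1) (h2 : x.c2 = y.c2) (h3 : x.c3 = y.c3) : x = y := by
  cases x; cases y; simp_all

instance : Zero QB := ⟨⟨0, 0, 0, 0⟩⟩
instance : One QB := ⟨⟨1, 0, 0, 0⟩⟩
instance : Add QB := ⟨fun x y => ⟨x.c0 + y.c0, x.c1 + y.c1, x.c2 + y.c2, x.c3 + y.c3⟩⟩
instance : Neg QB := ⟨fun x => ⟨-x.c0, -x.c1, -x.c2, -x.c3⟩⟩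
instance : Mul QB := ⟨fun x y => ⟨x.c0*y.c0 + (-6)*x.c1*y.c1 + (-18)*(x.c1*y.c2 + x.c2*y.c1) + (24)*(x.c1*y.c3 + x.c3*y.c1) + (116)*x.c2*y.c2 + (-172)*(x.c2*y.c3 + x.c3*y.c2) + (253)*x.c3*y.c3,
    x.c0*y.c1 + x.c1*y.c0 + (-28)*(x.c1*y.c2 + x.c2*y.c1) + (41)*(x.c1*y.c3 + x.c3*y.c1) + (170)*x.c2*y.c2 + (-252)*(x.c2*y.c3 + x.c3*y.c2) + (373)*x.c3*y.c3,
    x.c0*y.c2 + x.c2*y.c0 + (12)*x.c1*y.c1 + (-12)*(x.c1*y.c2 + x.c2*y.c1) + (21)*(x.c1*y.c3 + x.c3*y.c1) + (58)*x.c2*y.c2 + (-85)*(x.c2*y.c3 + x.c3*y.c2) + (129)*x.c3*y.c3,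
    x.c0*y.c3 + x.c3*y.c0 + (42)*(x.c1*y.c2 + x.c2*y.c1) + (-60)*(x.c1*y.c3 + x.c3*y.c1) + (-252)*x.c2*y.c2 + (374)*(x.c2*y.c3 + x.c3*y.c2) + (-552)*x.c3*y.c3⟩⟩

@[simp] theorem zero_c0 : (0 : QB).c0 = 0 := rfl
@[simp] theorem one_c0 : (1 : QB).c0 = 1 := rfl
@[simp] theorem add_c0 (x y : QB) : (x + y).c0 = x.c0 + y.c0 := rfl
@[simp] theorem neg_c0 (x : QB) : (-x).c0 = -x.c0 := rfl
theorem mul_c0 (x y : QB) : (x * y).c0 = x.c0*y.c0 + (-6)*x.c1*y.c1 + (-18)*(x.c1*y.c2 + x.c2*y.c1) + (24)*(x.c1*y.c3 + x.c3*y.c1) + (116)*x.c2*y.c2 + (-172)*(x.c2*y.c3 + x.c3*y.c2) + (253)*x.c3*y.c3 := rfl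
@[simp] theorem zero_c1 : (0 : QB).c1 = 0 := rfl
@[simp] theorem one_c1 : (1 : QB).c1 = 0 := rfl
@[simp] theorem add_c1 (x y : QB) : (x + y).c1 = x.c1 + y.c1 := rfl
@[simp] theorem neg_c1 (x : QB) : (-x).c1 = -x.c1 := rfl
theorem mul_c1 (x y : QB) : (x * y).c1 = x.c0*y.c1 + x.c1*y.c0 + (-28)*(x.c1*y.c2 + x.c2*y.c1) + (41)*(x.c1*y.c3 + x.c3*y.c1) + (170)*x.c2*y.c2 + (-252)*(x.c2*y.c3 + x.c3*y.c2) + (373)*x.c3*y.c3 := rfl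
@[simp] theorem zero_c2 : (0 : QB).c2 = 0 := rfl
@[simp] theorem one_c2 : (1 : QB).c2 = 0 := rfl
@[simp] theorem add_c2 (x y : QB) : (x + y).c2 = x.c2 + y.c2 := rfl
@[simp] theorem neg_c2 (x : QB) : (-x).c2 = -x.c2 := rfl
theorem mul_c2 (x y : QB) : (x * y).c2 = x.c0*y.c2 + x.c2*y.c0 + (12)*x.c1*y.c1 + (-12)*(x.c1*y.c2 + x.c2*y.c1) + (21)*(x.c1*y.c3 + x.c3*y.c1) + (58)*x.c2*y.c2 + (-85)*(x.c2*y.c3 + x.c3*y.c2) + (129)*x.c3*y.c3 := rfl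
@[simp] theorem zero_c3 : (0 : QB).c3 = 0 := rfl
@[simp] theorem one_c3 : (1 : QB).c3 = 0 := rfl
@[simp] theorem add_c3 (x y : QB) : (x + y).c3 = x.c3 + y.c3 := rfl
@[simp] theorem neg_c3 (x : QB) : (-x).c3 = -x.c3 := rfl
theorem mul_c3 (x y : QB) : (x * y).c3 = x.c0*y.c3 + x.c3*y.c0 + (42)*(x.c1*y.c2 + x.c2*y.c1) + (-60)*(x.c1*y.c3 + x.c3*y.c1) + (-252)*x.c2*y.c2 + (374)*(x.c2*y.c3 + x.c3*y.c2) + (-552)*x.c3*y.c3 := rfl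

instance : CommRing QB where
  add_assoc x y z := by ext <;> simp <;> ring
  zero_add x := by ext <;> simp
  add_zero x := by ext <;> simp
  add_comm x y := by ext <;> simp <;> ring
  neg_add_cancel x := by ext <;> simp
  mul_assoc x y z := by ext <;> simp only [mul_c0, mul_c1, mul_c2, mul_c3] <;> ring
  one_mul x := by ext <;> simp [mul_c0, mul_c1, mul_c2, mul_c3]
  mul_one x := by ext <;> simp [mul_c0, mul_c1, mul_c2, mul_c3]
  zero_mul x := by ext <;> simp [mul_c0, mul_c1, mul_c2, mul_c3]
  mul_zero x := by ext <;> simp [mul_c0, mul_c1, mul_c2, mul_c3]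
  mul_comm x y := by ext <;> simp only [mul_c0, mul_c1, mul_c2, mul_c3] <;> ring
  left_distrib x y z := by ext <;> simp only [mul_c0, mul_c1, mul_c2, mul_c3, add_c0, add_c1, add_c2, add_c3] <;> ring
  right_distrib x y z := by ext <;> simp only [mul_c0, mul_c1, mul_c2, mul_c3, add_c0, add_c1, add_c2, add_c3] <;> ring
  nsmul := nsmulRec
  zsmul := zsmulRec
  natCast n := ⟨n, 0, 0, 0⟩
  natCast_zero := by ext <;> simp
  natCast_succ n := by ext <;> simp
  intCast n := ⟨n, 0, 0, 0⟩
  intCast_ofNat n := rfl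
  intCast_negSucc n := rfl

theorem int_c0 (n : ℤ) : (n : QB).c0 = n := rfl
def p0 : QB →+ ℤ where
  toFun := c0
  map_zero' := rfl
  map_add' _ _ := rfl
theorem p0_apply (x : QB) : p0 x = x.c0 := rfl
theorem int_c1 (n : ℤ) : (n : QB).c1 = 0 := rfl
def p1 : QB →+ ℤ where
  toFun := c1
  map_zero' := rfl
  map_add' _ _ := rfl
theorem p1_apply (x : QB) : p1 x = x.c1 := rfl
theorem int_c2 (n : ℤ) : (n : QB).c2 = 0 := rfl
def p2 : QB →+ ℤ where
  toFun := c2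
  map_zero' := rfl
  map_add' _ _ := rfl
theorem p2_apply (x : QB) : p2 x = x.c2 := rfl
theorem int_c3 (n : ℤ) : (n : QB).c3 = 0 := rfl
def p3 : QB →+ ℤ where
  toFun := c3
  map_zero' := rfl
  map_add' _ _ := rfl
theorem p3_apply (x : QB) : p3 x = x.c3 := rfl

instance : Module.Finite ℤ QB := by
  let g : (Fin 4 → ℤ) →+ QB :=
    { toFun := fun v => ⟨v 0, v 1, v 2, v 3⟩
      map_zero' := rfl
      map_add' := fun _ _ => rfl }
  refine Module.Finite.of_surjective g.toIntLinearMap ?_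
  intro x
  exact ⟨![x.c0, x.c1, x.c2, x.c3], rfl⟩

def th : QB := ⟨0, 1, 0, 0⟩

theorem th_rel : th^4 + (72)*th^3 + (180)*th^2 + (144)*th + (-108) = 0 := by
  have e2 : th^2 = ⟨-6, 0, 12, 0⟩ := by rw [pow_two]; rfl
  have e3 : th^3 = ⟨-216, -342, -144, 504⟩ := by rw [pow_succ, e2]; rfl
  have e4 : th^4 = ⟨16740, 24480, 8208, -36288⟩ := by rw [pow_succ, e3]; rfl
  rw [e2, e3, e4]; rfl

/-- the element t - s θ as a unit -/
def eta (t s : ℤ) (h : t^4 + (72)*t^3*s + (180)*t^2*s^2 + (144)*t*s^3 + (-108)*s^4 = 1) : QBˣ :=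
  have h' : (t:QB)^4 + (72)*t^3*s + (180)*t^2*s^2 + (144)*t*s^3 + (-108)*s^4 = 1 := by exact_mod_cast congrArg (fun z : ℤ => (z : QB)) h
  Units.mkOfMulEqOne ((t:QB) - s * th) ((t:QB)^3 + t^2*s*th + t*s^2*th^2 + s^3*th^3 + (72)*s*(t^2+t*s*th+s^2*th^2) + (180)*s^2*(t+s*th) + (144)*s^3)
    (by linear_combination h' - (s:QB)^4 * th_rel)

theorem eta_val (t s : ℤ) (h) : ((eta t s h : QBˣ) : QB) = ⟨t, -s, 0, 0⟩ := by
  have : ((eta t s h : QBˣ) : QB) = (t:QB) - s * th := rfl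
  rw [this, sub_eq_add_neg]
  ext <;> simp [mul_c0, mul_c1, mul_c2, mul_c3, int_c0, int_c1, int_c2, int_c3, th]

/-- embedding in a number field -/
theorem exists_emb : ∃ (K : Type) (_ : Field K) (_ : NumberField K) (ι : QB →+* K), Function.Injective ι ∧
      Module.finrank ℚ K = 4 ∧ (∃ φ : K →+* ℂ, ¬ NumberField.ComplexEmbedding.IsReal φ) ∧
      Nonempty (K →+* ℝ) := by
  obtain ⟨r, hr⟩ : ∃ r : ℝ, r^4+((72:ℤ):ℝ)*r^3+((180:ℤ):ℝ)*r^2+((144:ℤ):ℝ)*r+((-108:ℤ):ℝ) = 0 := by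
    have hc : ContinuousOn (fun r : ℝ => r^4+((72:ℤ):ℝ)*r^3+((180:ℤ):ℝ)*r^2+((144:ℤ):ℝ)*r+((-108:ℤ):ℝ)) (Set.Icc 0 1) := by fun_prop
    have := intermediate_value_Icc (by norm_num) hc
    obtain ⟨r, -, hr⟩ := this (show (0:ℝ) ∈ _ by constructor <;> norm_num)
    exact ⟨r, hr⟩
  obtain ⟨K, iF, iN, θ, hθ, hind, hdeg, hφ, hσ⟩ := quartic_field (72) (180) (144) (-108) 5
    (by decide +kernel) (by decide +kernel) (-2) (by norm_num) r hr
  refine ⟨K, iF, iN, ?_⟩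
  push_cast at hθ
  obtain ⟨w2, hw2⟩ : ∃ w2 : K, w2 = (1/2)*θ^0 + (0)*θ^1 + (1/12)*θ^2 := ⟨_, rfl⟩
  obtain ⟨w3, hw3⟩ : ∃ w3 : K, w3 = (4/7)*θ^0 + (19/28)*θ^1 + (1/42)*θ^2 + (1/504)*θ^3 := ⟨_, rfl⟩
  have r11 : θ*θ = (-6)*1 + (0)*θ + (12)*w2 + (0)*w3 := by
    rw [hw2, hw3]; ring
  have r12 : θ*w2 = (-18)*1 + (-28)*θ + (-12)*w2 + (42)*w3 := by
    rw [hw2, hw3]; linear_combination ((0)*θ^0 + (0)*θ^1 + (0)*θ^2) * hθ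
  have r13 : θ*w3 = (24)*1 + (41)*θ + (21)*w2 + (-60)*w3 := by
    rw [hw2, hw3]; linear_combination ((1/504)*θ^0 + (0)*θ^1 + (0)*θ^2) * hθ
  have r22 : w2*w2 = (116)*1 + (170)*θ + (58)*w2 + (-252)*w3 := by
    rw [hw2, hw3]; linear_combination ((1/144)*θ^0 + (0)*θ^1 + (0)*θ^2) * hθ
  have r23 : w2*w3 = (-172)*1 + (-252)*θ + (-85)*w2 + (374)*w3 := by
    rw [hw2, hw3]; linear_combination ((-5/504)*θ^0 + (1/6048)*θ^1 + (0)*θ^2) * hθ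
  have r33 : w3*w3 = (253)*1 + (373)*θ + (129)*w2 + (-552)*w3 := by
    rw [hw2, hw3]; linear_combination ((19/1176)*θ^0 + (-1/5292)*θ^1 + (1/254016)*θ^2) * hθ
  let ι : QB →+* K :=
    { toFun := fun x => (x.c0:K) + x.c1*θ + x.c2*w2 + x.c3*w3
      map_one' := by simp
      map_zero' := by simp
      map_add' := by intro x y; simp only [add_c0, add_c1, add_c2, add_c3]; push_cast; ring
      map_mul' := by
        intro x y
        simp only [mul_c0, mul_c1, mul_c2, mul_c3]
        push_cast
        linear_combination (-1) * ((x.c1*y.c1)*r11 + (x.c1*y.c2 + x.c2*y.c1)*r12 + (x.c1*y.c3 + x.c3*y.c1)*r13 + (x.c2*y.c2)*r22 + (x.c2*y.c3 + x.c3*y.c2)*r23 + (x.c3*y.c3)*r33) }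
  refine ⟨ι, ?_, hdeg, hφ, hσ⟩
  rw [injective_iff_map_eq_zero]
  intro x hx
  have hx' : (x.c0:K) + x.c1*θ + x.c2*w2 + x.c3*w3 = 0 := hx
  rw [hw2, hw3] at hx'
  obtain ⟨k0, k1, k2, k3⟩ := hind ((x.c0:ℚ) + (1/2)*x.c2 + (4/7)*x.c3) ((x.c1:ℚ) + (0)*x.c2 + (19/28)*x.c3) ((1/12)*x.c2 + (1/42)*x.c3) ((0)*x.c2 + (1/504)*x.c3) (by
    push_cast; linear_combination hx')
  have j3 : (x.c3:ℚ) = 0 := by linarith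
  have j2 : (x.c2:ℚ) = 0 := by linarith
  have j1 : (x.c1:ℚ) = 0 := by linarith
  have j0 : (x.c0:ℚ) = 0 := by linarith
  ext
  · exact_mod_cast j0
  · exact_mod_cast j1
  · exact_mod_cast j2
  · exact_mod_cast j3

theorem dep (a b c : QBˣ) : ∃ l m n : ℤ, ¬ (l = 0 ∧ m = 0 ∧ n = 0) ∧ a ^ l * b ^ m * c ^ n = 1 := by
  obtain ⟨K, _, _, ι, hι, hdeg, ⟨φ, hφ⟩, hσ⟩ := exists_emb
  exact ring_dep hdeg φ hφ ι hι a b c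

theorem tor (w : QBˣ) (g : ℕ) (hg : 0 < g) (h : w ^ g = 1) : w = 1 ∨ w = -1 := by
  obtain ⟨K, _, _, ι, hι, hdeg, hφ, ⟨σ⟩⟩ := exists_emb
  exact real_tor (σ.comp ι) (σ.injective.comp hι) w g hg h

end QB

structure QC where
  c0 : ℤ
  c1 : ℤ
  c2 : ℤ
  c3 : ℤ

namespace QC

@[ext] theorem ext' {x y : QC} (h0 : x.c0 = y.c0) (h1 : x.c1 = y.c1) (h2 : x.c2 = y.c2) (h3 : x.c3 = y.c3) : x = y := by
  cases x; cases y; simp_all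

instance : Zero QC := ⟨⟨0, 0, 0, 0⟩⟩
instance : One QC := ⟨⟨1, 0, 0, 0⟩⟩
instance : Add QC := ⟨fun x y => ⟨x.c0 + y.c0, x.c1 + y.c1, x.c2 + y.c2, x.c3 + y.c3⟩⟩
instance : Neg QC := ⟨fun x => ⟨-x.c0, -x.c1, -x.c2, -x.c3⟩⟩
instance : Mul QC := ⟨fun x y => ⟨x.c0*y.c0 + (-9)*(x.c1*y.c2 + x.c2*y.c1) + (-21)*(x.c1*y.c3 + x.c3*y.c1) + (-120)*x.c2*y.c2 + (-201)*(x.c2*y.c3 + x.c3*y.c2) + (-327)*x.c3*y.c3,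
    x.c0*y.c1 + x.c1*y.c0 + (-9)*(x.c1*y.c2 + x.c2*y.c1) + (-10)*(x.c1*y.c3 + x.c3*y.c1) + (-46)*x.c2*y.c2 + (-65)*(x.c2*y.c3 + x.c3*y.c2) + (-96)*x.c3*y.c3,
    x.c0*y.c2 + x.c2*y.c0 + (3)*x.c1*y.c1 + (-9)*(x.c1*y.c2 + x.c2*y.c1) + (-24)*(x.c1*y.c3 + x.c3*y.c1) + (-150)*x.c2*y.c2 + (-250)*(x.c2*y.c3 + x.c3*y.c2) + (-407)*x.c3*y.c3,
    x.c0*y.c3 + x.c3*y.c0 + (21)*(x.c1*y.c2 + x.c2*y.c1) + (39)*(x.c1*y.c3 + x.c3*y.c1) + (210)*x.c2*y.c2 + (339)*(x.c2*y.c3 + x.c3*y.c2) + (542)*x.c3*y.c3⟩⟩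

@[simp] theorem zero_c0 : (0 : QC).c0 = 0 := rfl
@[simp] theorem one_c0 : (1 : QC).c0 = 1 := rfl
@[simp] theorem add_c0 (x y : QC) : (x + y).c0 = x.c0 + y.c0 := rfl
@[simp] theorem neg_c0 (x : QC) : (-x).c0 = -x.c0 := rfl
theorem mul_c0 (x y : QC) : (x * y).c0 = x.c0*y.c0 + (-9)*(x.c1*y.c2 + x.c2*y.c1) + (-21)*(x.c1*y.c3 + x.c3*y.c1) + (-120)*x.c2*y.c2 + (-201)*(x.c2*y.c3 + x.c3*y.c2) + (-327)*x.c3*y.c3 := rfl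
@[simp] theorem zero_c1 : (0 : QC).c1 = 0 := rfl
@[simp] theorem one_c1 : (1 : QC).c1 = 0 := rfl
@[simp] theorem add_c1 (x y : QC) : (x + y).c1 = x.c1 + y.c1 := rfl
@[simp] theorem neg_c1 (x : QC) : (-x).c1 = -x.c1 := rfl
theorem mul_c1 (x y : QC) : (x * y).c1 = x.c0*y.c1 + x.c1*y.c0 + (-9)*(x.c1*y.c2 + x.c2*y.c1) + (-10)*(x.c1*y.c3 + x.c3*y.c1) + (-46)*x.c2*y.c2 + (-65)*(x.c2*y.c3 + x.c3*y.c2) + (-96)*x.c3*y.c3 := rfl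
@[simp] theorem zero_c2 : (0 : QC).c2 = 0 := rfl
@[simp] theorem one_c2 : (1 : QC).c2 = 0 := rfl
@[simp] theorem add_c2 (x y : QC) : (x + y).c2 = x.c2 + y.c2 := rfl
@[simp] theorem neg_c2 (x : QC) : (-x).c2 = -x.c2 := rfl
theorem mul_c2 (x y : QC) : (x * y).c2 = x.c0*y.c2 + x.c2*y.c0 + (3)*x.c1*y.c1 + (-9)*(x.c1*y.c2 + x.c2*y.c1) + (-24)*(x.c1*y.c3 + x.c3*y.c1) + (-150)*x.c2*y.c2 + (-250)*(x.c2*y.c3 + x.c3*y.c2) + (-407)*x.c3*y.c3 := rfl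
@[simp] theorem zero_c3 : (0 : QC).c3 = 0 := rfl
@[simp] theorem one_c3 : (1 : QC).c3 = 0 := rfl
@[simp] theorem add_c3 (x y : QC) : (x + y).c3 = x.c3 + y.c3 := rfl
@[simp] theorem neg_c3 (x : QC) : (-x).c3 = -x.c3 := rfl
theorem mul_c3 (x y : QC) : (x * y).c3 = x.c0*y.c3 + x.c3*y.c0 + (21)*(x.c1*y.c2 + x.c2*y.c1) + (39)*(x.c1*y.c3 + x.c3*y.c1) + (210)*x.c2*y.c2 + (339)*(x.c2*y.c3 + x.c3*y.c2) + (542)*x.c3*y.c3 := rfl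

instance : CommRing QC where
  add_assoc x y z := by ext <;> simp <;> ring
  zero_add x := by ext <;> simp
  add_zero x := by ext <;> simp
  add_comm x y := by ext <;> simp <;> ring
  neg_add_cancel x := by ext <;> simp
  mul_assoc x y z := by ext <;> simp only [mul_c0, mul_c1, mul_c2, mul_c3] <;> ring
  one_mul x := by ext <;> simp [mul_c0, mul_c1, mul_c2, mul_c3]
  mul_one x := by ext <;> simp [mul_c0, mul_c1, mul_c2, mul_c3]
  zero_mul x := by ext <;> simp [mul_c0, mul_c1, mul_c2, mul_c3]
  mul_zero x := by ext <;> simp [mul_c0, mul_c1, mul_c2, mul_c3]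
  mul_comm x y := by ext <;> simp only [mul_c0, mul_c1, mul_c2, mul_c3] <;> ring
  left_distrib x y z := by ext <;> simp only [mul_c0, mul_c1, mul_c2, mul_c3, add_c0, add_c1, add_c2, add_c3] <;> ring
  right_distrib x y z := by ext <;> simp only [mul_c0, mul_c1, mul_c2, mul_c3, add_c0, add_c1, add_c2, add_c3] <;> ring
  nsmul := nsmulRec
  zsmul := zsmulRec
  natCast n := ⟨n, 0, 0, 0⟩
  natCast_zero := by ext <;> simp
  natCast_succ n := by ext <;> simp
  intCast n := ⟨n, 0, 0, 0⟩
  intCast_ofNat n := rfl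
  intCast_negSucc n := rfl

theorem int_c0 (n : ℤ) : (n : QC).c0 = n := rfl
def p0 : QC →+ ℤ where
  toFun := c0
  map_zero' := rfl
  map_add' _ _ := rfl
theorem p0_apply (x : QC) : p0 x = x.c0 := rfl
theorem int_c1 (n : ℤ) : (n : QC).c1 = 0 := rfl
def p1 : QC →+ ℤ where
  toFun := c1
  map_zero' := rfl
  map_add' _ _ := rfl
theorem p1_apply (x : QC) : p1 x = x.c1 := rfl
theorem int_c2 (n : ℤ) : (n : QC).c2 = 0 := rfl
def p2 : QC →+ ℤ where
  toFun := c2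
  map_zero' := rfl
  map_add' _ _ := rfl
theorem p2_apply (x : QC) : p2 x = x.c2 := rfl
theorem int_c3 (n : ℤ) : (n : QC).c3 = 0 := rfl
def p3 : QC →+ ℤ where
  toFun := c3
  map_zero' := rfl
  map_add' _ _ := rfl
theorem p3_apply (x : QC) : p3 x = x.c3 := rfl

instance : Module.Finite ℤ QC := by
  let g : (Fin 4 → ℤ) →+ QC :=
    { toFun := fun v => ⟨v 0, v 1, v 2, v 3⟩
      map_zero' := rfl
      map_add' := fun _ _ => rfl }
  refine Module.Finite.of_surjective g.toIntLinearMap ?_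
  intro x
  exact ⟨![x.c0, x.c1, x.c2, x.c3], rfl⟩

def th : QC := ⟨0, 1, 0, 0⟩

theorem th_rel : th^4 + (-30)*th^3 + (180)*th^2 + (-396)*th + (270) = 0 := by
  have e2 : th^2 = ⟨0, 0, 3, 0⟩ := by rw [pow_two]; rfl
  have e3 : th^3 = ⟨-27, -27, -27, 63⟩ := by rw [pow_succ, e2]; rfl
  have e4 : th^4 = ⟨-1080, -414, -1350, 1890⟩ := by rw [pow_succ, e3]; rfl
  rw [e2, e3, e4]; rfl

/-- the element t - s θ as a unit -/
def eta (t s : ℤ) (h : t^4 + (-30)*t^3*s + (180)*t^2*s^2 + (-396)*t*s^3 + (270)*s^4 = 1) : QCˣ :=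
  have h' : (t:QC)^4 + (-30)*t^3*s + (180)*t^2*s^2 + (-396)*t*s^3 + (270)*s^4 = 1 := by exact_mod_cast congrArg (fun z : ℤ => (z : QC)) h
  Units.mkOfMulEqOne ((t:QC) - s * th) ((t:QC)^3 + t^2*s*th + t*s^2*th^2 + s^3*th^3 + (-30)*s*(t^2+t*s*th+s^2*th^2) + (180)*s^2*(t+s*th) + (-396)*s^3)
    (by linear_combination h' - (s:QC)^4 * th_rel)

theorem eta_val (t s : ℤ) (h) : ((eta t s h : QCˣ) : QC) = ⟨t, -s, 0, 0⟩ := by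
  have : ((eta t s h : QCˣ) : QC) = (t:QC) - s * th := rfl
  rw [this, sub_eq_add_neg]
  ext <;> simp [mul_c0, mul_c1, mul_c2, mul_c3, int_c0, int_c1, int_c2, int_c3, th]

/-- embedding in a number field -/
theorem exists_emb : ∃ (K : Type) (_ : Field K) (_ : NumberField K) (ι : QC →+* K), Function.Injective ι ∧
      Module.finrank ℚ K = 4 ∧ (∃ φ : K →+* ℂ, ¬ NumberField.ComplexEmbedding.IsReal φ) ∧
      Nonempty (K →+* ℝ) := by
  obtain ⟨r, hr⟩ : ∃ r : ℝ, r^4+((-30:ℤ):ℝ)*r^3+((180:ℤ):ℝ)*r^2+((-396:ℤ):ℝ)*r+((270:ℤ):ℝ) = 0 := by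
    have hc : ContinuousOn (fun r : ℝ => r^4+((-30:ℤ):ℝ)*r^3+((180:ℤ):ℝ)*r^2+((-396:ℤ):ℝ)*r+((270:ℤ):ℝ)) (Set.Icc 1 2) := by fun_prop
    have := intermediate_value_Icc' (by norm_num) hc
    obtain ⟨r, -, hr⟩ := this (show (0:ℝ) ∈ _ by constructor <;> norm_num)
    exact ⟨r, hr⟩
  obtain ⟨K, iF, iN, θ, hθ, hind, hdeg, hφ, hσ⟩ := quartic_field (-30) (180) (-396) (270) 11
    (by decide +kernel) (by decide +kernel) (3) (by norm_num) r hr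
  refine ⟨K, iF, iN, ?_⟩
  push_cast at hθ
  obtain ⟨w2, hw2⟩ : ∃ w2 : K, w2 = (0)*θ^0 + (0)*θ^1 + (1/3)*θ^2 := ⟨_, rfl⟩
  obtain ⟨w3, hw3⟩ : ∃ w3 : K, w3 = (3/7)*θ^0 + (3/7)*θ^1 + (1/7)*θ^2 + (1/63)*θ^3 := ⟨_, rfl⟩
  have r11 : θ*θ = (0)*1 + (0)*θ + (3)*w2 + (0)*w3 := by
    rw [hw2, hw3]; ring
  have r12 : θ*w2 = (-9)*1 + (-9)*θ + (-9)*w2 + (21)*w3 := by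
    rw [hw2, hw3]; linear_combination ((0)*θ^0 + (0)*θ^1 + (0)*θ^2) * hθ
  have r13 : θ*w3 = (-21)*1 + (-10)*θ + (-24)*w2 + (39)*w3 := by
    rw [hw2, hw3]; linear_combination ((1/63)*θ^0 + (0)*θ^1 + (0)*θ^2) * hθ
  have r22 : w2*w2 = (-120)*1 + (-46)*θ + (-150)*w2 + (210)*w3 := by
    rw [hw2, hw3]; linear_combination ((1/9)*θ^0 + (0)*θ^1 + (0)*θ^2) * hθ
  have r23 : w2*w3 = (-201)*1 + (-65)*θ + (-250)*w2 + (339)*w3 := by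
    rw [hw2, hw3]; linear_combination ((13/63)*θ^0 + (1/189)*θ^1 + (0)*θ^2) * hθ
  have r33 : w3*w3 = (-327)*1 + (-96)*θ + (-407)*w2 + (542)*w3 := by
    rw [hw2, hw3]; linear_combination ((155/441)*θ^0 + (16/1323)*θ^1 + (1/3969)*θ^2) * hθ
  let ι : QC →+* K :=
    { toFun := fun x => (x.c0:K) + x.c1*θ + x.c2*w2 + x.c3*w3
      map_one' := by simp
      map_zero' := by simp
      map_add' := by intro x y; simp only [add_c0, add_c1, add_c2, add_c3]; push_cast; ring
      map_mul' := by
        intro x y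
        simp only [mul_c0, mul_c1, mul_c2, mul_c3]
        push_cast
        linear_combination (-1) * ((x.c1*y.c1)*r11 + (x.c1*y.c2 + x.c2*y.c1)*r12 + (x.c1*y.c3 + x.c3*y.c1)*r13 + (x.c2*y.c2)*r22 + (x.c2*y.c3 + x.c3*y.c2)*r23 + (x.c3*y.c3)*r33) }
  refine ⟨ι, ?_, hdeg, hφ, hσ⟩
  rw [injective_iff_map_eq_zero]
  intro x hx
  have hx' : (x.c0:K) + x.c1*θ + x.c2*w2 + x.c3*w3 = 0 := hx
  rw [hw2, hw3] at hx'
  obtain ⟨k0, k1, k2, k3⟩ := hind ((x.c0:ℚ) + (0)*x.c2 + (3/7)*x.c3) ((x.c1:ℚ) + (0)*x.c2 + (3/7)*x.c3) ((1/3)*x.c2 + (1/7)*x.c3) ((0)*x.c2 + (1/63)*x.c3) (by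
    push_cast; linear_combination hx')
  have j3 : (x.c3:ℚ) = 0 := by linarith
  have j2 : (x.c2:ℚ) = 0 := by linarith
  have j1 : (x.c1:ℚ) = 0 := by linarith
  have j0 : (x.c0:ℚ) = 0 := by linarith
  ext
  · exact_mod_cast j0
  · exact_mod_cast j1
  · exact_mod_cast j2
  · exact_mod_cast j3

theorem dep (a b c : QCˣ) : ∃ l m n : ℤ, ¬ (l = 0 ∧ m = 0 ∧ n = 0) ∧ a ^ l * b ^ m * c ^ n = 1 := by
  obtain ⟨K, _, _, ι, hι, hdeg, ⟨φ, hφ⟩, hσ⟩ := exists_emb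
  exact ring_dep hdeg φ hφ ι hι a b c

theorem tor (w : QCˣ) (g : ℕ) (hg : 0 < g) (h : w ^ g = 1) : w = 1 ∨ w = -1 := by
  obtain ⟨K, _, _, ι, hι, hdeg, hφ, ⟨σ⟩⟩ := exists_emb
  exact real_tor (σ.comp ι) (σ.injective.comp hι) w g hg h

end QC

namespace QA
def e1 : QAˣ := Units.mkOfMulEqOne ⟨-107, -37, 62, 126⟩ ⟨-65, -25, 10, 42⟩ (by rfl)
def e2 : QAˣ := Units.mkOfMulEqOne ⟨23, 34, 66, -72⟩ ⟨-25, -10, 18, 36⟩ (by rfl)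
def g1 : QAˣ := Units.mkOfMulEqOne ⟨25081262537408219191, 37382099158841237678, 72548168707347351280, -79103136314669244288⟩ ⟨-39143345, -11496286, 7418672, 22713600⟩ (by rfl)
def g2 : QAˣ := Units.mkOfMulEqOne ⟨10704589106846845329640897, 15954540201075188921724784, 30963287247126264090544320, -33760922921981837923455792⟩ ⟨-2224935127246271, -770464821842800, 1286505182734656, 2621528646662448⟩ (by rfl)
def u1 : QAˣ := Units.mkOfMulEqOne ⟨464247442894275082420875413309979194305062562229568052015425876450975304226476638769, 691932629732187867498172292695603080880552343191517698817084582609935098624148993352, 1342847145705482474054192846580848156264214009005973154114179974015270132747832015232, -1464177838106442288614354526096376196974860914401702526272687201363545186738415912320⟩ ⟨-47843286817237135745937952175, 35601608580417690511236975032, 11404268173174465463175896192, -31785283610714552053671785088⟩ (by rfl)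
def v1 : QAˣ := Units.mkOfMulEqOne ⟨25025410785574651451145870448953543621722628175878381061693417407525786467689114765459573207318527700560945608153786059658812066059204303775395612462888987224921068456481183033273830743523936720703073918244945055233, 37298855513425723780794853402849482036689695317689917168335748624699641653582130530030871232902041768266374158694223002937390913126931830433271097480559595352784760739990550253735419764904095316665148591096565205888, 72386616141619083998219098498980092066512864451967158745899639751514755112064884376579830413942322650403578025407101314570776120121477770624029304634062618402455712309640211743208192281071983242213685477357371571712, -78926986938930508952227684564365090962998541421256965841405769794438518968674420692503208126996182902999255718308322616121070152019695250577129747065000106600321482433822785039443373980138207441479670655842366648704⟩ ⟨-821558363840418930277189887379374517289709958150990047097655953234106167826221627810242740476529342330406929930236822662729215, -284494505405022881024874007461103478397110887913065334705310040652707298200187257579482450292198067756604102222551120426503040, 475042656296756637302753177154259176601505841505662219355819256088045771128130272721170972664384058365723401303778417980981760, 968000711321902453335803693731678698569882383738155996246151257551976541449516982476686249810028536000737358922938943068664192⟩ (by rfl)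

theorem g1_eq : g1 = e1^2*e2^6 := by
  ext1; rw [Units.val_mul, Units.val_pow_eq_pow_val, Units.val_pow_eq_pow_val]; rfl
theorem g2_eq : g2 = e2^8 := by
  ext1; rw [Units.val_pow_eq_pow_val]; rfl

theorem step (α β : ℤ) (hα : 2 ∣ α) (hαβ : α ∣ β) (h24 : 2*β ∣ 24*α^2) (hβ : β ≠ 0)
    (u v : QAˣ) (du au bu cu dv av bv cv : ℤ) (hu : u.1 = ⟨du, α*au, β*bu, β*cu⟩) (hv : v.1 = ⟨dv, α*av, β*bv, β*cv⟩)
    (hdet : ¬ (2:ℤ) ∣ bu*cv - cu*bv) (x : QAˣ) (d a b c : ℤ) (hx : x.1 = ⟨d, α*a, β*b, β*c⟩) (hb : 2 ∣ b) (hc : 2 ∣ c) :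
    ∃ (y : QAˣ) (d a b c : ℤ), y.1 = ⟨d, α*a, β*b, β*c⟩ ∧ (x = y^2 ∨ x = -y^2) := by
  obtain ⟨α', hα'⟩ := hα
  obtain ⟨m, hm⟩ := hαβ
  obtain ⟨l, hl⟩ := h24
  have hmul : ∀ (x y : QA) (d a b c d' a' b' c' : ℤ), x = ⟨d, α*a, β*b, β*c⟩ → y = ⟨d', α*a', β*b', β*c'⟩ →
     ∃ d'' a'' i j k : ℤ, x * y = ⟨d'', α*a'', β*(d*b'+d'*b+2*i), β*(d*c'+d'*c+2*j)⟩ ∧ d'' = d*d' + 2*k := by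
    rintro x y d a b c d' a' b' c' rfl rfl
    refine ⟨_, d*a'+d'*a + (-9*β)*(a*b'+a'*b) + 4*β*(a*c'+a'*c) + 10*m*β*b*b' - 8*m*β*(b*c'+b'*c) + 4*m*β*c*c',
      l*a*a' - 9*α*(a*b'+a'*b) + 9*α*(a*c'+a'*c) + 21*m*α'*b*b' - 7*β*(b*c'+b'*c) + 7*β*c*c',
      21*α'*(a*b'+a'*b) - 3*α*(a*c'+a'*c) - 21*m*α'*b*b' + 9*β*(b*c'+b'*c) - 3*β*c*c',
      -9*α^2*a*a' - 3*α*β*(a*b'+a'*b) - 3*α*β*(a*c'+a'*c) + 3*β^2*b*b' - 3*β^2*(b*c'+b'*c) - β^2*c*c', ?_, rfl⟩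
    ext
    · simp only [mul_c0]; ring
    · simp only [mul_c1]
      rw [hm]; ring
    · simp only [mul_c2]
      linear_combination a*a'*hl + 21*β*b*b'*hm + 21*β*b*b'*m*hα'
    · simp only [mul_c3]
      linear_combination 21*β*(a*b'+a'*b)*hα' - 21*β*b*b'*hm - 21*β*b*b'*m*hα'
  let M : Subring QA :=
    { carrier := {x | ∃ d a b c : ℤ, x = ⟨d, α*a, β*b, β*c⟩}
      mul_mem' := by
        rintro x y ⟨d, a, b, c, hx⟩ ⟨d', a', b', c', hy⟩
        obtain ⟨d'', a'', i, j, k, h, -⟩ := hmul x y d a b c d' a' b' c' hx hy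
        exact ⟨_, _, _, _, h⟩
      one_mem' := ⟨1, 0, 0, 0, by ext <;> simp⟩
      add_mem' := by
        rintro x y ⟨d, a, b, c, hx⟩ ⟨d', a', b', c', hy⟩
        refine ⟨d+d', a+a', b+b', c+c', ?_⟩
        rw [hx, hy]; ext <;> simp <;> ring
      zero_mem' := ⟨0, 0, 0, 0, by ext <;> simp⟩
      neg_mem' := by
        rintro x ⟨d, a, b, c, hx⟩
        refine ⟨-d, -a, -b, -c, ?_⟩
        rw [hx]; ext <;> simp }
  let S : Subgroup QAˣ :=
    { carrier := {x | (x : QA) ∈ M}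
      mul_mem' := by
        intro a b ha hb
        exact M.mul_mem ha hb
      one_mem' := M.one_mem
      inv_mem' := by
        intro a ha
        exact unit_inv_mem M a ha }
  have two0 : (2 : ZMod 2) = 0 := by decide
  have odd : ∀ (x : QAˣ) (d a b c : ℤ), x.1 = ⟨d, α*a, β*b, β*c⟩ → (d : ZMod 2) = 1 := by
    intro x d a b c hx
    obtain ⟨d', a', b', c', hx'⟩ := unit_inv_mem M x ⟨d, a, b, c, hx⟩
    obtain ⟨d'', a'', i, j, k, h, h'⟩ := hmul _ _ d a b c d' a' b' c' hx hx'
    have e : x.1 * (x⁻¹ : QAˣ).1 = 1 := x.mul_inv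
    rw [e] at h
    have e0 := congrArg c0 h
    simp only [one_c0] at e0
    rw [h'] at e0
    have e1 := congrArg (fun z : ℤ => (z : ZMod 2)) e0
    push_cast at e1
    rw [two0] at e1
    simp only [zero_mul, add_zero] at e1
    generalize (d : ZMod 2) = p at e1 ⊢
    generalize (d' : ZMod 2) = q at e1
    revert p q; decide
  let L : QAˣ → ZMod 2 × ZMod 2 := fun x => (((x.1.c2 / β : ℤ) : ZMod 2), ((x.1.c3 / β : ℤ) : ZMod 2))
  have hLv : ∀ (x : QAˣ) (d a b c : ℤ), x.1 = ⟨d, α*a, β*b, β*c⟩ → L x = ((b : ZMod 2), (c : ZMod 2)) := by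
    intro x d a b c hx
    simp only [L, hx, Int.mul_ediv_cancel_left _ hβ]
  have hL : ∀ x ∈ S, ∀ y ∈ S, L (x * y) = L x + L y := by
    rintro x ⟨d, a, b, c, hx⟩ y ⟨d', a', b', c', hy⟩
    obtain ⟨d'', a'', i, j, k, h, h'⟩ := hmul _ _ d a b c d' a' b' c' hx hy
    rw [hLv (x*y) _ _ _ _ h, hLv _ _ _ _ _ hx, hLv _ _ _ _ _ hy]
    have o1 := odd x _ _ _ _ hx
    have o2 := odd y _ _ _ _ hy
    push_cast
    rw [two0, o1, o2]
    ext <;> simp <;> ring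
  obtain ⟨y, ⟨d', a', b', c', hy⟩, hxy⟩ := skolem_step dep tor 2 S L hL (by rw [hLv (-1) (-1) 0 0 0 (by ext <;> simp)]; simp)
    u v ⟨_, _, _, _, hu⟩ ⟨_, _, _, _, hv⟩ (by
      rw [hLv _ _ _ _ _ hu, hLv _ _ _ _ _ hv]
      intro h
      apply hdet
      rw [← Nat.cast_two, ← ZMod.intCast_zmod_eq_zero_iff_dvd]
      push_cast; exact h) x ⟨_, _, _, _, hx⟩ (by
      rw [hLv _ _ _ _ _ hx]
      rw [← Nat.cast_two, ← ZMod.intCast_zmod_eq_zero_iff_dvd] at hb hc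
      rw [hb, hc]; rfl)
  exact ⟨y, d', a', b', c', hy, hxy⟩

theorem odd_c0 (x : QAˣ) (h1 : 2 ∣ x.1.c1) (h2 : 2 ∣ x.1.c2) (h3 : 2 ∣ x.1.c3) : ¬ 2 ∣ x.1.c0 := by
  have e : x.1 * (x⁻¹ : QAˣ).1 = 1 := x.mul_inv
  have e0 := congrArg c0 e
  rw [mul_c0, one_c0] at e0
  rintro h0
  have : (2:ℤ) ∣ 1 := by
    rw [← e0]
    obtain ⟨p, hp⟩ := h0
    obtain ⟨q, hq⟩ := h1
    obtain ⟨r, hr⟩ := h2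
    obtain ⟨s, hs⟩ := h3
    rw [hp, hq, hr, hs]
    generalize (x⁻¹ : QAˣ).1 = w
    refine ⟨p*w.c0 + (-18)*q*w.c1 + (-6)*(q*w.c2+r*w.c1) + (-6)*(q*w.c3+s*w.c1) + 6*r*w.c2 + (-6)*(r*w.c3+s*w.c2) + (-2)*s*w.c3, by ring⟩
  omega

theorem sq_iter (y : QAˣ) (d a b c : ℤ) (hy : y.1 = ⟨d, 8*a, 128*b, 128*c⟩) (k : ℕ) :
    ∃ D A B C : ℤ, (y^(2^k)).1 = ⟨D, 8*(2^k)*A, 128*2^k*B, 128*2^k*C⟩ ∧ ¬ 2 ∣ D ∧ 2 ∣ B - b ∧ 2 ∣ C - c := by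
  have hodd : ∀ (y : QAˣ) (D A B C : ℤ), y.1 = ⟨D, 2*A, 2*B, 2*C⟩ → ¬ 2 ∣ D := by
    intro y D A B C hy
    have := odd_c0 y (by rw [hy]; exact ⟨_, rfl⟩) (by rw [hy]; exact ⟨_, rfl⟩) (by rw [hy]; exact ⟨_, rfl⟩)
    rw [hy] at this; exact this
  induction k with
  | zero => exact ⟨d, a, b, c, by rw [pow_zero, pow_one, hy]; ext <;> simp, hodd y d (4*a) (64*b) (64*c) (by rw [hy]; ext <;> simp <;> ring), by simp, by simp⟩
  | succ k ih =>
    obtain ⟨D, A, B, C, h, hD, hB, hC⟩ := ih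
    have e : (y^(2^(k+1))).1 = (y^(2^k)).1 * (y^(2^k)).1 := by
      rw [← Units.val_mul, ← pow_add, pow_succ]; ring_nf
    rw [h] at e
    obtain ⟨e2, he⟩ : ∃ z : ℤ, z = 2^k := ⟨_, rfl⟩
    have e' : (y^(2^(k+1))).1 = ⟨D^2 + (-18)*(8*e2*A)^2 + (-12)*(8*e2*A)*(128*e2*B) + (-12)*(8*e2*A)*(128*e2*C) + 6*(128*e2*B)^2 + (-12)*(128*e2*B)*(128*e2*C) - 2*(128*e2*C)^2,
      8*2^(k+1)*(D*A + (-9)*A*e2*128*B + 4*A*e2*128*C + 5*128*16*e2*B^2 - 8*128*16*e2*B*C + 2*16*128*e2*C^2),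
      128*2^(k+1)*(D*B + 2*(3*e2*A^2 - 9*e2*8*A*B + 9*e2*8*A*C + 21*32*e2*B^2 - 7*128*e2*B*C + 7*64*e2*C^2)),
      128*2^(k+1)*(D*C + 2*(21*4*e2*A*B - 3*8*e2*A*C - 21*32*e2*B^2 + 9*128*e2*B*C - 3*64*e2*C^2))⟩ := by
      rw [e, pow_succ (2:ℤ) k, ← he]
      ext
      · simp only [mul_c0]; ring
      · simp only [mul_c1]; ring
      · simp only [mul_c2]; ring
      · simp only [mul_c3]; ring
    have hev : ∀ m z : ℤ, (2:ℤ) ∣ m → 2 ∣ m * 2^(k+1) * z := fun m z hm => dvd_mul_of_dvd_left (dvd_mul_of_dvd_left hm _) _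
    refine ⟨_, _, _, _, e', ?_, ?_, ?_⟩
    · have := odd_c0 (y^(2^(k+1))) (by rw [e']; exact hev 8 _ (by norm_num)) (by rw [e']; exact hev 128 _ (by norm_num)) (by rw [e']; exact hev 128 _ (by norm_num))
      rw [e'] at this; exact this
    · have : (D - 1) * B % 2 = 0 := by
        rw [Int.mul_emod]; have : (D-1)%2 = 0 := by omega
        rw [this]; simp
      have e3 : D*B = (D-1)*B + B := by ring
      omega
    · have : (D - 1) * C % 2 = 0 := by
        rw [Int.mul_emod]; have : (D-1)%2 = 0 := by omega
        rw [this]; simp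
      have e3 : D*C = (D-1)*C + C := by ring
      omega

theorem final (t s : ℤ) (h : t^4 + 24*t^3*s + (-36)*t^2*s^2 + (-144)*t*s^3 + (-972)*s^4 = 1) (h8 : 8 ∣ s) : s = 0 := by
  obtain ⟨s', hs'⟩ := h8
  have key : ∀ k : ℕ, ∃ (y : QAˣ) (d a b c : ℤ), y.1 = ⟨d, 8*a, 128*b, 128*c⟩ ∧ (eta t s h = y^(2^k) ∨ eta t s h = -y^(2^k)) := by
    intro k
    induction k with
    | zero => exact ⟨eta t s h, t, -s', 0, 0, by rw [eta_val]; ext <;> simp [hs'], by simp⟩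
    | succ k ih =>
      obtain ⟨y, d, a, b, c, hy, hyη⟩ := ih
      obtain ⟨hb, hc⟩ : 2 ∣ b ∧ 2 ∣ c := by
        obtain ⟨D, A, B, C, hyk, -, hB, hC⟩ := sq_iter y d a b c hy k
        have hz : (y^(2^k)).1.c2 = 0 ∧ (y^(2^k)).1.c3 = 0 := by
          rcases hyη with h' | h'
          · rw [← h', eta_val]; exact ⟨rfl, rfl⟩
          · have : y ^ (2 ^ k) = - eta t s h := by rw [h']; simp
            rw [this, Units.val_neg, eta_val]; exact ⟨rfl, rfl⟩
        rw [hyk] at hz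
        have e2 : (2:ℤ)^k ≠ 0 := by positivity
        have hB0 : B = 0 := by simpa [e2] using hz.1
        have hC0 : C = 0 := by simpa [e2] using hz.2
        rw [hB0] at hB; rw [hC0] at hC
        omega
      obtain ⟨y', d', a', b', c', hy', hyy⟩ := step 8 128 (by norm_num) (by norm_num) (by norm_num) (by norm_num) u1 v1
        (464247442894275082420875413309979194305062562229568052015425876450975304226476638769) (86491578716523483437271536586950385110069042898939712352135572826241887328018624169) (10490993325824081828548381613912876220814171945359165266517031046994297912092437619) (-11438889360206580379799644735127939038866100893763300986505368760652696771393874315) (25025410785574651451145870448953543621722628175878381061693417407525786467689114765459573207318527700560945608153786059658812066059204303775395612462888987224921068456481183033273830743523936720703073918244945055233) (4662356939178215472599356675356185254586211914711239646041968578087455206697766316253858904112755221033296769836777875367173864140866478804158887185069949419098095092498818781716927470613011914583143573887070650736) (565520438606399093736086707023281969269631753530993427702340935558709024313006909192029925108924395706277953323492979020084188438449045083000228942453614206269185252419064154243814002195874869079794417791854465404) (-616617085460394601189278785659102273148426104853570045635982576519050929442768911660181313492157678929681685299283770438445860562653869145133826148945313332815011581514240508120651359219829745636559926998768489443)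
        (by rfl) (by rfl) (by norm_num) y d a b c hy hb hc
      refine ⟨y', d', a', b', c', hy', ?_⟩
      have e5 : y ^ (2 ^ k) = y' ^ (2 ^ (k+1)) ∨ y ^ (2 ^ k) = - y' ^ (2 ^ (k+1)) := by
        rcases hyy with h | h
        · left; rw [h, ← pow_mul, pow_succ, mul_comm]
        · rw [h, neg_pow, ← pow_mul, pow_succ, mul_comm 2]
          rcases neg_one_pow_eq_or QAˣ (2^k) with h' | h'
          · left; rw [h']; simp
          · right; rw [h']; simp
      rcases hyη with h | h <;> rcases e5 with h' | h' <;> rw [h, h'] <;> simp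
  apply eq_zero_of_pow_dvd 2 (by norm_num)
  intro k
  obtain ⟨y, d, a, b, c, hy, hyη⟩ := key k
  obtain ⟨D, A, B, C, hyk, -, -, -⟩ := sq_iter y d a b c hy k
  rcases hyη with h' | h'
  · have := congrArg c1 (congrArg Units.val h')
    rw [eta_val, hyk] at this
    simp only at this
    exact ⟨-(8*A), by linarith⟩
  · have := congrArg c1 (congrArg Units.val h')
    rw [eta_val, Units.val_neg, neg_c1, hyk] at this
    simp only at this
    exact ⟨8*A, by linarith⟩

theorem fmul (x y : QA) (d a b c d' a' b' c' : ℤ) (hx : x = ⟨d, 2*a, 16*b, 16*c⟩) (hy : y = ⟨d', 2*a', 16*b', 16*c'⟩) :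
    ∃ d'' a'' i j : ℤ, x * y = ⟨d'', 2*a'', 16*(d*b'+d'*b+6*a*a'+2*i), 16*(d*c'+d'*c+2*j)⟩ := by
  subst hx; subst hy
  refine ⟨d*d' + (-18)*(2*a)*(2*a') + (-6)*(2*a*(16*b') + 16*b*(2*a')) + (-6)*(2*a*(16*c') + 16*c*(2*a')) + 6*(16*b)*(16*b') + (-6)*(16*b*(16*c') + 16*c*(16*b')) + (-2)*(16*c)*(16*c'),
    d*a'+d'*a + (-9*16)*(a*b'+a'*b) + 64*(a*c'+a'*c) + 10*8*16*b*b' - 8*8*16*(b*c'+b'*c) + 4*8*16*c*c',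
    - 18*(a*b'+a'*b) + 18*(a*c'+a'*c) + 21*8*b*b' - 7*16*(b*c'+b'*c) + 7*16*c*c',
    21*(a*b'+a'*b) - 6*(a*c'+a'*c) - 21*8*b*b' + 9*16*(b*c'+b'*c) - 3*16*c*c', ?_⟩
  ext
  · simp only [mul_c0]
  · simp only [mul_c1]; ring
  · simp only [mul_c2]; ring
  · simp only [mul_c3]; ring

theorem fodd (x : QAˣ) (d a b c : ℤ) (hx : x.1 = ⟨d, 2*a, 16*b, 16*c⟩) : d % 2 = 1 := by
  have := odd_c0 x (by rw [hx]; exact ⟨_, rfl⟩) (by rw [hx]; exact ⟨8*b, by ring⟩) (by rw [hx]; exact ⟨8*c, by ring⟩)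
  rw [hx] at this
  simp only at this
  omega

theorem step16 (x : QAˣ) (d a b c : ℤ) (hx : x.1 = ⟨d, 2*a, 16*b, 16*c⟩) (hb : 2 ∣ b) (hc : 2 ∣ c) :
    ∃ (y : QAˣ) (d a b c : ℤ), y.1 = ⟨d, 2*a, 16*b, 16*c⟩ ∧ (x = y^2 ∨ x = -y^2) :=
  step 2 16 (by norm_num) (by norm_num) (by norm_num) (by norm_num) g1 g2
        (25081262537408219191) (18691049579420618839) (4534260544209209455) (-4943946019666827768) (10704589106846845329640897) (7977270100537594460862392) (1935205452945391505659020) (-2110057682623864870215987)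
        (by rfl) (by rfl) (by norm_num) x d a b c hx hb hc

theorem step_g1 (x : QAˣ) (d a b c : ℤ) (hx : x.1 = ⟨d, 2*a, 16*b, 16*c⟩) :
    ∃ (d' a' b' c' : ℤ), (x*g1).1 = ⟨d', 2*a', 16*b', 16*c'⟩ ∧ 2 ∣ b' - b - 1 ∧ 2 ∣ c' - c := by
  obtain ⟨d'', a'', i, j, h⟩ := fmul x.1 g1.1 d a b c (25081262537408219191) (18691049579420618839) (4534260544209209455) (-4943946019666827768) hx rfl
  refine ⟨_, _, _, _, h, ?_, ?_⟩
  · have := fodd x d a b c hx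
    omega
  · omega

theorem step_g2 (x : QAˣ) (d a b c : ℤ) (hx : x.1 = ⟨d, 2*a, 16*b, 16*c⟩) :
    ∃ (d' a' b' c' : ℤ), (x*g2).1 = ⟨d', 2*a', 16*b', 16*c'⟩ ∧ 2 ∣ b' - b ∧ 2 ∣ c' - c - 1 := by
  obtain ⟨d'', a'', i, j, h⟩ := fmul x.1 g2.1 d a b c (10704589106846845329640897) (7977270100537594460862392) (1935205452945391505659020) (-2110057682623864870215987) hx rfl
  refine ⟨_, _, _, _, h, ?_, ?_⟩
  · omega
  · have := fodd x d a b c hx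
    omega

theorem step_gen (x : QAˣ) (d a b c : ℤ) (hx : x.1 = ⟨d, 2*a, 16*b, 16*c⟩) :
    ∃ (i j : ℕ) (y : QAˣ), (x * g1^i * g2^j = y^2 ∨ x * g1^i * g2^j = -y^2) := by
  have h1 : ∃ (i : ℕ) (d a b c : ℤ), (x * g1^i).1 = ⟨d, 2*a, 16*b, 16*c⟩ ∧ 2 ∣ b := by
    by_cases hb : 2 ∣ b
    · exact ⟨0, d, a, b, c, by simpa using hx, hb⟩
    · obtain ⟨d', a', b', c', h, h', -⟩ := step_g1 x d a b c hx
      exact ⟨1, d', a', b', c', by simpa using h, by omega⟩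
  obtain ⟨i, d1, a1, b1, c1, h1, hb1⟩ := h1
  have h2 : ∃ (j : ℕ) (d a b c : ℤ), (x * g1^i * g2^j).1 = ⟨d, 2*a, 16*b, 16*c⟩ ∧ 2 ∣ b ∧ 2 ∣ c := by
    by_cases hc : 2 ∣ c1
    · exact ⟨0, d1, a1, b1, c1, by simpa using h1, hb1, hc⟩
    · obtain ⟨d', a', b', c', h, h', h''⟩ := step_g2 _ d1 a1 b1 c1 h1
      exact ⟨1, d', a', b', c', by simpa using h, by omega, by omega⟩
  obtain ⟨j, d2, a2, b2, c2, h2, hb2, hc2⟩ := h2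
  obtain ⟨y, -, -, -, -, -, h⟩ := step16 _ d2 a2 b2 c2 h2 hb2 hc2
  exact ⟨i, j, y, h⟩

/-- ring homomorphism determined by the images of the basis -/
def lift {K : Type} [CommRing K] (a b c : K) (h11 : a*a = -18 + 24*b) (h12 : a*b = -6 - 9*a - 18*b + 21*c)
    (h13 : a*c = -6 + 4*a + 18*b - 6*c) (h22 : b*b = 6 + 10*a + 21*b - 21*c) (h23 : b*c = -6 - 8*a - 14*b + 18*c)
    (h33 : c*c = -2 + 4*a + 14*b - 6*c) : QA →+* K where
  toFun x := x.c0 + x.c1*a + x.c2*b + x.c3*c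
  map_zero' := by simp
  map_one' := by simp
  map_add' x y := by simp only [add_c0, add_c1, add_c2, add_c3]; push_cast; ring
  map_mul' x y := by
    simp only [mul_c0, mul_c1, mul_c2, mul_c3]; push_cast
    linear_combination -(x.c1*y.c1:K)*h11 - (x.c1*y.c2+x.c2*y.c1:K)*h12 - (x.c1*y.c3+x.c3*y.c1:K)*h13
      - (x.c2*y.c2:K)*h22 - (x.c2*y.c3+x.c3*y.c2:K)*h23 - (x.c3*y.c3:K)*h33

instance fact_prime_53 : Fact (Nat.Prime 53) := ⟨by norm_num⟩
instance fact_irr : Fact (∀ r : ZMod 53, r^2 ≠ 31 + 51*r) := ⟨by decide +kernel⟩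
abbrev K53 := QuadraticAlgebra (ZMod 53) 31 51
instance fintype_K53 : Fintype K53 := Fintype.ofEquiv _ (QuadraticAlgebra.equivProd _ _).symm

def phi : QA →+* ZMod 53 := lift 34 18 14 (by decide) (by decide) (by decide) (by decide) (by decide) (by decide)
def psi : QA →+* K53 := lift ⟨0,1⟩ ⟨44,22⟩ ⟨20,42⟩ (by decide +kernel) (by decide +kernel) (by decide +kernel) (by decide +kernel) (by decide +kernel) (by decide +kernel)

def chain {K : Type} [CommRing K] (x : K) : K :=
  let x2 := x*x
  let x4 := x2*x2
  let x5 := x4*x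
  let x10 := x5*x5
  let x20 := x10*x10
  let x21 := x20*x
  let x42 := x21*x21
  let x43 := x42*x
  let x86 := x43*x43
  let x87 := x86*x
  let x174 := x87*x87
  let x175 := x174*x
  let x350 := x175*x175
  x350*x

theorem chain_eq {K : Type} [CommRing K] (x : K) : chain x = x^351 := by
  unfold chain; ring

theorem local_check : ∀ t s : ZMod 53, t^4 + 24*t^3*s + (-36)*t^2*s^2 + (-144)*t*s^3 + (-972)*s^4 = 1 →
    ((t - 34*s)^13 = 1 → chain (⟨t, -s⟩ : K53) ≠ ⟨-1, 0⟩) ∧ ((t - 34*s)^13 = -1 → chain (⟨t, -s⟩ : K53) ≠ ⟨1, 0⟩) := by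
  decide +kernel

theorem no_odd (t s : ℤ) (h : t^4 + 24*t^3*s + (-36)*t^2*s^2 + (-144)*t*s^3 + (-972)*s^4 = 1) (Y : QAˣ)
    (hY : eta t s h * (e1*e2)^4 = Y^8 ∨ eta t s h * (e1*e2)^4 = -Y^8) : False := by
  have hmod := congrArg (fun z : ℤ => (z : ZMod 53)) h
  push_cast at hmod
  obtain ⟨l1, l2⟩ := local_check t s hmod
  have card : Fintype.card K53 = 53^2 := by
    rw [Fintype.card_congr (QuadraticAlgebra.equivProd _ _), Fintype.card_prod, ZMod.card]; norm_num
  have hY1 : (phi Y.1)^104 = 1 := by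
    have : phi Y.1 ≠ 0 := (Y.isUnit.map phi).ne_zero
    have := ZMod.pow_card_sub_one_eq_one this
    calc (phi Y.1)^104 = ((phi Y.1)^(53-1))^2 := by rw [← pow_mul]
      _ = 1 := by rw [this]; simp
  have hY2 : (psi Y.1)^2808 = 1 := by
    have : psi Y.1 ≠ 0 := (Y.isUnit.map psi).ne_zero
    have := FiniteField.pow_card_sub_one_eq_one _ this
    rw [card] at this
    exact this
  have p1 : phi (eta t s h).1 = t - 34*s := by
    rw [eta_val]; simp [phi, lift]; ring
  have p2 : psi (eta t s h).1 = (⟨t, -s⟩ : K53) := by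
    rw [eta_val]; simp only [psi, lift, RingHom.coe_mk, MonoidHom.coe_mk, OneHom.coe_mk]
    ext <;> simp
  have q1 : (phi (e1*e2).1)^52 = 1 := by decide +kernel
  have q2 : (psi (e1*e2).1)^1404 = -1 := by
    have : psi (e1*e2).1 = ⟨27, 23⟩ := by decide +kernel
    rw [this]
    have e : (⟨27, 23⟩ : K53)^1404 = (chain (⟨27, 23⟩ : K53))^4 := by rw [chain_eq, ← pow_mul]
    rw [e]; decide +kernel
  rcases hY with hY | hY
  · have hv := congrArg Units.val hY
    rw [Units.val_mul, Units.val_pow_eq_pow_val, Units.val_pow_eq_pow_val] at hv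
    have w1 := congrArg phi hv
    have w2 := congrArg psi hv
    rw [map_mul, map_pow, map_pow] at w1 w2
    have v1 : (phi (eta t s h).1)^13 * (phi (e1*e2).1)^52 = (phi Y.1)^104 := by
      calc _ = (phi (eta t s h).1 * (phi (e1*e2).1)^4)^13 := by rw [mul_pow, ← pow_mul]
        _ = _ := by rw [w1, ← pow_mul]
    have v2 : (psi (eta t s h).1)^351 * (psi (e1*e2).1)^1404 = (psi Y.1)^2808 := by
      calc _ = (psi (eta t s h).1 * (psi (e1*e2).1)^4)^351 := by rw [mul_pow, ← pow_mul]
        _ = _ := by rw [w2, ← pow_mul]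
    rw [hY1, q1, p1, mul_one] at v1
    rw [hY2, q2, p2, ← chain_eq] at v2
    apply l1 v1
    have : chain (⟨t, -s⟩ : K53) = -1 := by linear_combination -v2
    rw [this]; rfl
  · have hv := congrArg Units.val hY
    rw [Units.val_neg, Units.val_mul, Units.val_pow_eq_pow_val, Units.val_pow_eq_pow_val] at hv
    have w1 := congrArg phi hv
    have w2 := congrArg psi hv
    rw [map_neg, map_mul, map_pow, map_pow] at w1 w2
    have v1 : (phi (eta t s h).1)^13 * (phi (e1*e2).1)^52 = -(phi Y.1)^104 := by
      calc _ = (phi (eta t s h).1 * (phi (e1*e2).1)^4)^13 := by rw [mul_pow, ← pow_mul]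
        _ = _ := by rw [w1, Odd.neg_pow (by decide), ← pow_mul]
    have v2 : (psi (eta t s h).1)^351 * (psi (e1*e2).1)^1404 = -(psi Y.1)^2808 := by
      calc _ = (psi (eta t s h).1 * (psi (e1*e2).1)^4)^351 := by rw [mul_pow, ← pow_mul]
        _ = _ := by rw [w2, Odd.neg_pow (by decide), ← pow_mul]
    rw [hY1, q1, p1, mul_one] at v1
    rw [hY2, q2, p2, ← chain_eq] at v2
    apply l2 v1
    have : chain (⟨t, -s⟩ : K53) = 1 := by linear_combination -v2
    rw [this]; rfl

theorem thue (t s : ℤ) (h : t^4 + 24*t^3*s + (-36)*t^2*s^2 + (-144)*t*s^3 + (-972)*s^4 = 1) : s = 0 := by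
  have hs : 2 ∣ s := by
    have hmod := congrArg (fun z : ℤ => (z : ZMod 16)) h
    push_cast at hmod
    have key : ∀ t s : ZMod 16, t^4 + 24*t^3*s + (-36)*t^2*s^2 + (-144)*t*s^3 + (-972)*s^4 = 1 → 8 * s = 0 := by
      decide +kernel
    have := key _ _ hmod
    have h2 : ((8 * s : ℤ) : ZMod 16) = 0 := by push_cast; exact this
    rw [ZMod.intCast_zmod_eq_zero_iff_dvd] at h2
    push_cast at h2
    omega
  obtain ⟨s', hs'⟩ := hs
  have hη : (eta t s h).1 = ⟨t, 2*(-s'), 16*0, 16*0⟩ := by rw [eta_val, hs']; ext <;> simp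
  obtain ⟨y, d, r, b, c, hy, hyη⟩ := step16 _ _ _ _ _ hη (by norm_num) (by norm_num)
  have hd := fodd y d r b c hy
  have hy2 : (y^2).1 = y.1 * y.1 := by rw [pow_two, Units.val_mul]
  have hc1 : s = (y^2).1.c1 ∨ s = -(y^2).1.c1 := by
    rcases hyη with h' | h'
    · right; rw [← h', eta_val]; simp
    · left
      have : y^2 = -eta t s h := by rw [h']; simp
      rw [this, Units.val_neg, neg_c1, eta_val]; simp
  have hz : (y^2).1.c2 = 0 ∧ (y^2).1.c3 = 0 := by
    rcases hyη with h' | h'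
    · rw [← h', eta_val]; exact ⟨rfl, rfl⟩
    · have : y^2 = -eta t s h := by rw [h']; simp
      rw [this, Units.val_neg, eta_val]; exact ⟨rfl, rfl⟩
  obtain ⟨z2, z3⟩ := hz
  rw [hy2, hy, mul_c2] at z2
  rw [hy2, hy, mul_c3] at z3
  rw [hy2, hy, mul_c1] at hc1
  simp only at z2 z3 hc1
  have m1 : d*b+3*r^2-36*r*b+36*r*c+168*b^2-224*b*c+112*c^2 = 0 := by linarith
  have m2 : d*c+42*r*b-12*r*c-168*b^2+288*b*c-48*c^2 = 0 := by linarith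
  have hceven : 2 ∣ c := by
    have e : c = 2*(-(d/2)*c - (21*r*b-6*r*c-84*b^2+144*b*c-24*c^2)) := by
      have : d = 2*(d/2) + 1 := by omega
      rw [this] at m2
      linarith
    exact ⟨_, e⟩
  have hrb : 2 ∣ b - r := by
    obtain ⟨r2, hr2⟩ := Int.even_mul_succ_self r
    have e : b - r = 2*(-(d/2)*b - (r^2-18*r*b+18*r*c+84*b^2-112*b*c+56*c^2) - r2) := by
      have : d = 2*(d/2) + 1 := by omega
      rw [this] at m1
      linarith
    exact ⟨_, e⟩
  by_cases hr : 2 ∣ r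
  · apply final t s h
    obtain ⟨r', hr'⟩ := hr
    have e : ∃ m, s = 8*m := by
      rcases hc1 with h' | h'
      · exact ⟨d*r'-72*r*b+32*r*c+320*b^2-512*b*c+128*c^2, by rw [h', hr']; ring⟩
      · exact ⟨-(d*r'-72*r*b+32*r*c+320*b^2-512*b*c+128*c^2), by rw [h', hr']; ring⟩
    exact e
  · exfalso
    obtain ⟨d', a', b', c', hg, hb', hc'⟩ := step_g1 y d r b c hy
    obtain ⟨y', d2, a2, b2, c2, hy', hyy⟩ := step16 _ d' a' b' c' hg (by omega) (by omega)
    obtain ⟨i, j, y'', hy''⟩ := step_gen y' d2 a2 b2 c2 hy'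
    have s1 : y^2*g1^2 = y'^4 := by
      rcases hyy with h' | h'
      · calc y^2*g1^2 = (y*g1)^2 := by rw [mul_pow]
          _ = _ := by rw [h', ← pow_mul]
      · calc y^2*g1^2 = (y*g1)^2 := by rw [mul_pow]
          _ = _ := by rw [h', neg_sq, ← pow_mul]
    have s2 : y'^4*(g1^i*g2^j)^4 = y''^8 := by
      rcases hy'' with h' | h'
      · calc y'^4*(g1^i*g2^j)^4 = (y'*g1^i*g2^j)^4 := by rw [← mul_pow, mul_assoc]
          _ = _ := by rw [h', ← pow_mul]
      · calc y'^4*(g1^i*g2^j)^4 = (y'*g1^i*g2^j)^4 := by rw [← mul_pow, mul_assoc]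
          _ = _ := by rw [h', Even.neg_pow (by decide), ← pow_mul]
    have s3 : y^2*(e1*e2)^4*(e2*(e1*e2^3)^i*(e2^4)^j)^8 = y''^8 := by
      rw [← s2, ← s1, g1_eq, g2_eq]
      simp only [mul_pow, ← pow_mul]
      have a1 : ∀ n, e2^(n) = e2^(n) := fun _ => rfl
      rw [show 3*i*8 = 6*i*4 by ring, show 4*j*8 = 8*j*4 by ring, show i*8 = 2*i*4 by ring]
      rw [show e2^(6*2) = e2^4*e2^8 by rw [← pow_add]]
      simp only [mul_comm, mul_left_comm, mul_assoc]
    have s4 : y^2*(e1*e2)^4 = (y''*(e2*(e1*e2^3)^i*(e2^4)^j)⁻¹)^8 := by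
      rw [mul_pow y'', inv_pow, ← s3, mul_inv_cancel_right]
    apply no_odd t s h (y''*(e2*(e1*e2^3)^i*(e2^4)^j)⁻¹)
    rw [← s4]
    rcases hyη with h' | h'
    · left; rw [h']
    · right; rw [h', neg_mul]
end QA

namespace QB
def u1 : QBˣ := Units.mkOfMulEqOne ⟨451651328929944338873, 142187154622325562150, -797293968271028932205, -553947271555332252750⟩ ⟨-17822305059604975988315696821568969944227363, -26007512356889045388616114450733634231286600, -8665656937960582025056250960246139967539505, 38563222781675109586107358942475967828904350⟩ (by rfl)
def v1 : QBˣ := Units.mkOfMulEqOne ⟨97123447820617207771644203, 141729100749157853767713695, 47223884713275599938788520, -210152005766469966707243220⟩ ⟨-777961172855411739851949045297643767278135630258758753343283, -244914778116461767636152266075941896158311407384556849381305, 1373324276455818326237093556659693479504839847789961731060820, 954164043160221093273206953085413112802088593203525611276980⟩ (by rfl)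

theorem thue_mod : ∀ t s : ZMod 5, t^4 + 72*t^3*s + 180*t^2*s^2 + 144*t*s^3 + (-108)*s^4 = 1 → s = 0 := by decide +kernel

theorem thue (t s : ℤ) (h : t^4 + 72*t^3*s + 180*t^2*s^2 + 144*t*s^3 + (-108)*s^4 = 1) : s = 0 := by
  have h5 : (5:ℤ) ∣ s := by
    have := thue_mod t s (by exact_mod_cast congrArg (fun z : ℤ => (z : ZMod 5)) h)
    exact (ZMod.intCast_zmod_eq_zero_iff_dvd s 5).mp this
  obtain ⟨s', hs'⟩ := h5
  apply eq_zero_of_pow_dvd 5 (by norm_num)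
  intro k
  have key := skolem_gen dep tor 5 5 (by norm_num) (by norm_num)
    (fun d e W => ⟨2*d^3*e*W^2 + 10*d^2*e^2*W^3 + 25*d*e^3*W^4 + 25*e^4*W^5, by push_cast; ring⟩)
    p0 p2 p3 rfl rfl rfl u1 v1 (3) (3) ⟨90330265785988867774, 28437430924465112430, -159458793654205786441, -110789454311066450550⟩ ⟨19424689564123441554328840, 28345820149831570753542739, 9444776942655119987757704, -42030401153293993341448644⟩ (by rfl) (by rfl) (by
      simp only [p2_apply, p3_apply]; norm_num)
    (eta t s h) t ⟨0, -s', 0, 0⟩ (by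
      rw [eta_val]; ext <;> simp only [add_c0, add_c1, add_c2, add_c3, mul_c0, mul_c1, mul_c2, mul_c3, int_c0, int_c1, int_c2, int_c3, hs'] <;> ring)
    (by rw [eta_val]; rfl) (by rw [eta_val]; rfl) k
  obtain ⟨d, w, hdw⟩ := key
  rw [eta_val] at hdw
  have := congrArg c1 hdw
  simp only [add_c1, mul_c1, int_c0, int_c1, int_c2, int_c3] at this
  refine ⟨-w.c1, ?_⟩
  push_cast at this
  linarith
end QB

namespace QC
def u1 : QCˣ := Units.mkOfMulEqOne ⟨154603393, -102694232, 142049552, -82149528⟩ ⟨-486435099652406207, -127780840450377128, -606820770409287440, 789622841340793752⟩ (by rfl)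
def v1 : QCˣ := Units.mkOfMulEqOne ⟨10836130141915, -5223265182448, 5054460431512, -2811845229864⟩ ⟨-8045, 2928, -9496, 7656⟩ (by rfl)
def e1 : QCˣ := Units.mkOfMulEqOne ⟨58, -28, 27, -15⟩ ⟨25, -17, 21, -12⟩ (by rfl)
def e2 : QCˣ := Units.mkOfMulEqOne ⟨232, -161, 242, -141⟩ ⟨460, 121, 574, -747⟩ (by rfl)
def e12 : QCˣ := Units.mkOfMulEqOne ⟨-908, 444, -436, 243⟩ ⟨133, 35, 166, -216⟩ (by rfl)

theorem thue_mod16 : ∀ t s : ZMod 16, t^4 + (-30)*t^3*s + 180*t^2*s^2 + (-396)*t*s^3 + 270*s^4 = 1 →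
    8 * t = 8 ∧ (8 * s = 8 ∨ 2 * s = 0) := by decide +kernel

theorem thue_mod5 : ∀ t s : ZMod 5, t^4 + (-30)*t^3*s + 180*t^2*s^2 + (-396)*t*s^3 + 270*s^4 = 1 →
    t ≠ 0 ∧ s = 0 := by decide +kernel

theorem unit_mod2 : ∀ x0 x1 x2 x3 y0 y1 y2 y3 : ZMod 2,
    x0*y0 + (-9)*(x1*y2 + x2*y1) + (-21)*(x1*y3 + x3*y1) + (-120)*x2*y2 + (-201)*(x2*y3 + x3*y2) + (-327)*x3*y3 = 1 → x0*y1 + x1*y0 + (-9)*(x1*y2 + x2*y1) + (-10)*(x1*y3 + x3*y1) + (-46)*x2*y2 + (-65)*(x2*y3 + x3*y2) + (-96)*x3*y3 = 0 → x0*y2 + x2*y0 + (3)*x1*y1 + (-9)*(x1*y2 + x2*y1) + (-24)*(x1*y3 + x3*y1) + (-150)*x2*y2 + (-250)*(x2*y3 + x3*y2) + (-407)*x3*y3 = 0 → x0*y3 + x3*y0 + (21)*(x1*y2 + x2*y1) + (39)*(x1*y3 + x3*y1) + (210)*x2*y2 + (339)*(x2*y3 + x3*y2) + (542)*x3*y3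 = 0 → x0 + x3 = 1 := by decide +kernel

def L0 (x : QCˣ) : ZMod 2 × ZMod 2 :=
  ((x.1.c1 : ZMod 2) + x.1.c3, (x.1.c3 : ZMod 2) + x.1.c0 * x.1.c1 + x.1.c1 * x.1.c2 + x.1.c2 * x.1.c3)

theorem L0_mod2 : ∀ x0 x1 x2 x3 y0 y1 y2 y3 : ZMod 2, x0 + x3 = 1 → y0 + y3 = 1 →
   (x0*y1 + x1*y0 + (-9)*(x1*y2 + x2*y1) + (-10)*(x1*y3 + x3*y1) + (-46)*x2*y2 + (-65)*(x2*y3 + x3*y2) + (-96)*x3*y3) + (x0*y3 + x3*y0 + (21)*(x1*y2 + x2*y1) + (39)*(x1*y3 + x3*y1) + (210)*x2*y2 + (339)*(x2*y3 + x3*y2) + (542)*x3*y3) = x1 + x3 + (y1 + y3) ∧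
   (x0*y3 + x3*y0 + (21)*(x1*y2 + x2*y1) + (39)*(x1*y3 + x3*y1) + (210)*x2*y2 + (339)*(x2*y3 + x3*y2) + (542)*x3*y3) + (x0*y0 + (-9)*(x1*y2 + x2*y1) + (-21)*(x1*y3 + x3*y1) + (-120)*x2*y2 + (-201)*(x2*y3 + x3*y2) + (-327)*x3*y3) * (x0*y1 + x1*y0 + (-9)*(x1*y2 + x2*y1) + (-10)*(x1*y3 + x3*y1) + (-46)*x2*y2 + (-65)*(x2*y3 + x3*y2) + (-96)*x3*y3) + (x0*y1 + x1*y0 + (-9)*(x1*y2 + x2*y1) + (-10)*(x1*y3 + x3*y1) + (-46)*x2*y2 + (-65)*(x2*y3 + x3*y2) + (-96)*x3*y3) * (x0*y2 + x2*y0 + (3)*x1*y1 + (-9)*(x1*y2 + x2*y1) + (-24)*(x1*y3 + x3*y1) + (-150)*x2*y2 + (-250)*(x2*y3 + x3*y2) + (-407)*x3*y3) + (x0*y2 + x2*y0 + (3)*x1*y1 + (-9)*(x1*y2 + x2*y1) + (-24)*(x1*y3 + x3*y1) + (-150)*x2*y2 + (-250)*(x2*y3 + x3*y2) + (-407)*x3*y3)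 * (x0*y3 + x3*y0 + (21)*(x1*y2 + x2*y1) + (39)*(x1*y3 + x3*y1) + (210)*x2*y2 + (339)*(x2*y3 + x3*y2) + (542)*x3*y3) =
    x3 + x0 * x1 + x1 * x2 + x2 * x3 + (y3 + y0 * y1 + y1 * y2 + y2 * y3) := by decide +kernel

theorem unit_odd (x : QCˣ) : (x.1.c0 : ZMod 2) + x.1.c3 = 1 := by
  have h : x.1 * (x⁻¹ : QCˣ).1 = 1 := x.mul_inv
  have h0 := congrArg (fun z : QC => (z.c0 : ZMod 2)) h
  have h1 := congrArg (fun z : QC => (z.c1 : ZMod 2)) h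
  have h2 := congrArg (fun z : QC => (z.c2 : ZMod 2)) h
  have h3 := congrArg (fun z : QC => (z.c3 : ZMod 2)) h
  simp only [mul_c0, mul_c1, mul_c2, mul_c3, one_c0, one_c1, one_c2, one_c3] at h0 h1 h2 h3
  push_cast at h0 h1 h2 h3
  exact unit_mod2 _ _ _ _ _ _ _ _ h0 h1 h2 h3

theorem L0_mul (x y : QCˣ) : L0 (x * y) = L0 x + L0 y := by
  obtain ⟨h1, h2⟩ := L0_mod2 _ x.1.c1 x.1.c2 _ _ y.1.c1 y.1.c2 _ (unit_odd x) (unit_odd y)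
  ext
  · simp only [L0, Units.val_mul, mul_c0, mul_c1, mul_c2, mul_c3, Prod.fst_add]
    push_cast
    exact h1
  · simp only [L0, Units.val_mul, mul_c0, mul_c1, mul_c2, mul_c3, Prod.snd_add]
    push_cast
    exact h2

theorem sq_mod5 : ∀ y0 y1 y2 y3 : ZMod 5,
      (444)*(y0*y0 + (-9)*(y1*y2 + y2*y1) + (-21)*(y1*y3 + y3*y1) + (-120)*y2*y2 + (-201)*(y2*y3 + y3*y2) + (-327)*y3*y3) + (586)*(y0*y1 + y1*y0 + (-9)*(y1*y2 + y2*y1) + (-10)*(y1*y3 + y3*y1) + (-46)*y2*y2 + (-65)*(y2*y3 + y3*y2) + (-96)*y3*y3) + (265)*(y0*y2 + y2*y0 + (3)*y1*y1 + (-9)*(y1*y2 + y2*y1) + (-24)*(y1*y3 + y3*y1) + (-150)*y2*y2 + (-250)*(y2*y3 + y3*y2) + (-407)*y3*y3) + (572)*(y0*y3 + y3*y0 + (21)*(y1*y2 + y2*y1) + (39)*(y1*y3 + y3*y1) + (210)*y2*y2 + (339)*(y2*y3 + y3*y2) + (542)*y3*y3) = 0 →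
      (-436)*(y0*y0 + (-9)*(y1*y2 + y2*y1) + (-21)*(y1*y3 + y3*y1) + (-120)*y2*y2 + (-201)*(y2*y3 + y3*y2) + (-327)*y3*y3) + (-576)*(y0*y1 + y1*y0 + (-9)*(y1*y2 + y2*y1) + (-10)*(y1*y3 + y3*y1) + (-46)*y2*y2 + (-65)*(y2*y3 + y3*y2) + (-96)*y3*y3) + (-254)*(y0*y2 + y2*y0 + (3)*y1*y1 + (-9)*(y1*y2 + y2*y1) + (-24)*(y1*y3 + y3*y1) + (-150)*y2*y2 + (-250)*(y2*y3 + y3*y2) + (-407)*y3*y3) + (-557)*(y0*y3 + y3*y0 + (21)*(y1*y2 + y2*y1) + (39)*(y1*y3 + y3*y1) + (210)*y2*y2 + (339)*(y2*y3 + y3*y2) + (542)*y3*y3) = 0 →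
      (243)*(y0*y0 + (-9)*(y1*y2 + y2*y1) + (-21)*(y1*y3 + y3*y1) + (-120)*y2*y2 + (-201)*(y2*y3 + y3*y2) + (-327)*y3*y3) + (321)*(y0*y1 + y1*y0 + (-9)*(y1*y2 + y2*y1) + (-10)*(y1*y3 + y3*y1) + (-46)*y2*y2 + (-65)*(y2*y3 + y3*y2) + (-96)*y3*y3) + (141)*(y0*y2 + y2*y0 + (3)*y1*y1 + (-9)*(y1*y2 + y2*y1) + (-24)*(y1*y3 + y3*y1) + (-150)*y2*y2 + (-250)*(y2*y3 + y3*y2) + (-407)*y3*y3) + (310)*(y0*y3 + y3*y0 + (21)*(y1*y2 + y2*y1) + (39)*(y1*y3 + y3*y1) + (210)*y2*y2 + (339)*(y2*y3 + y3*y2) + (542)*y3*y3) = 0 →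
      (-908)*(y0*y0 + (-9)*(y1*y2 + y2*y1) + (-21)*(y1*y3 + y3*y1) + (-120)*y2*y2 + (-201)*(y2*y3 + y3*y2) + (-327)*y3*y3) + (-1179)*(y0*y1 + y1*y0 + (-9)*(y1*y2 + y2*y1) + (-10)*(y1*y3 + y3*y1) + (-46)*y2*y2 + (-65)*(y2*y3 + y3*y2) + (-96)*y3*y3) + (-519)*(y0*y2 + y2*y0 + (3)*y1*y1 + (-9)*(y1*y2 + y2*y1) + (-24)*(y1*y3 + y3*y1) + (-150)*y2*y2 + (-250)*(y2*y3 + y3*y2) + (-407)*y3*y3) + (-1149)*(y0*y3 + y3*y0 + (21)*(y1*y2 + y2*y1) + (39)*(y1*y3 + y3*y1) + (210)*y2*y2 + (339)*(y2*y3 + y3*y2) + (542)*y3*y3) = 0 := by decide +kernel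

theorem thue_odd (t s : ℤ) (h : t^4 + (-30)*t^3*s + 180*t^2*s^2 + (-396)*t*s^3 + 270*s^4 = 1)
    (ht : (t : ZMod 2) = 1) (hs : (s : ZMod 2) = 1) : False := by
  obtain ⟨ht5, hs5⟩ := thue_mod5 t s (by exact_mod_cast congrArg (fun z : ℤ => (z : ZMod 5)) h)
  have hLη : L0 (eta t s h) = (1, 1) := by
    simp only [L0, eta_val]
    push_cast
    rw [ht, hs]; decide
  have hLe : L0 e12⁻¹ = (1, 1) := by decide +kernel
  have hx : L0 (eta t s h * e12⁻¹) = 0 := by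
    rw [L0_mul, hLη, hLe]; decide
  obtain ⟨y, -, hy⟩ := skolem_step dep tor 2 ⊤ L0 (fun x _ y _ => L0_mul x y) (by decide +kernel)
    e1 e2 trivial trivial (by decide +kernel) (eta t s h * e12⁻¹) trivial hx
  have hy' : ((eta t s h : QCˣ) : QC) = e12.1 * (y.1 * y.1) ∨ ((eta t s h : QCˣ) : QC) = - (e12.1 * (y.1 * y.1)) := by
    rcases hy with hy | hy
    · left
      have := congrArg (fun z => e12 * z) hy
      simp only [mul_inv_cancel_comm_assoc, mul_comm e12, inv_mul_cancel_right] at this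
      rw [this]; simp [pow_two]; ring
    · right
      have := congrArg (fun z => e12 * z) hy
      simp only [mul_inv_cancel_comm_assoc, mul_comm e12, inv_mul_cancel_right] at this
      rw [this]; simp [pow_two]; ring
  have he : e12.1 = ⟨-908, 444, -436, 243⟩ := rfl
  rw [eta_val, he] at hy'
  have hk := sq_mod5 y.1.c0 y.1.c1 y.1.c2 y.1.c3
  apply ht5
  rcases hy' with hy' | hy'
  · have h0 := congrArg (fun z : QC => (z.c0 : ZMod 5)) hy'
    have h1 := congrArg (fun z : QC => (z.c1 : ZMod 5)) hy'
    have h2 := congrArg (fun z : QC => (z.c2 : ZMod 5)) hy'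
    have h3 := congrArg (fun z : QC => (z.c3 : ZMod 5)) hy'
    simp only [mul_c0, mul_c1, mul_c2, mul_c3] at h0 h1 h2 h3
    push_cast at h0 h1 h2 h3
    rw [hs5] at h1
    rw [h0, ← hk (by linear_combination -h1) (by linear_combination -h2) (by linear_combination -h3)]
    ring
  · have h0 := congrArg (fun z : QC => (z.c0 : ZMod 5)) hy'
    have h1 := congrArg (fun z : QC => (z.c1 : ZMod 5)) hy'
    have h2 := congrArg (fun z : QC => (z.c2 : ZMod 5)) hy'
    have h3 := congrArg (fun z : QC => (z.c3 : ZMod 5)) hy'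
    simp only [neg_c0, neg_c1, neg_c2, neg_c3, mul_c0, mul_c1, mul_c2, mul_c3] at h0 h1 h2 h3
    push_cast at h0 h1 h2 h3
    rw [hs5] at h1
    have := hk (by linear_combination h1) (by linear_combination h2) (by linear_combination h3)
    rw [h0, ← neg_zero, ← this]
    ring

theorem thue (t s : ℤ) (h : t^4 + (-30)*t^3*s + 180*t^2*s^2 + (-396)*t*s^3 + 270*s^4 = 1) : s = 0 := by
  obtain ⟨ht, hs⟩ := thue_mod16 t s (by exact_mod_cast congrArg (fun z : ℤ => (z : ZMod 16)) h)
  have ht2 : (t : ZMod 2) = 1 := by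
    have h8 : ((8 * t - 8 : ℤ) : ZMod 16) = 0 := by push_cast; rw [ht]; ring
    have := (ZMod.intCast_zmod_eq_zero_iff_dvd _ 16).mp h8
    have h3 : ((t - 1 : ℤ) : ZMod 2) = 0 := (ZMod.intCast_zmod_eq_zero_iff_dvd _ 2).mpr (by push_cast at this ⊢; omega)
    push_cast at h3; linear_combination h3
  rcases hs with hs | hs
  · exfalso
    refine thue_odd t s h ht2 ?_
    have h8 : ((8 * s - 8 : ℤ) : ZMod 16) = 0 := by push_cast; rw [hs]; ring
    have := (ZMod.intCast_zmod_eq_zero_iff_dvd _ 16).mp h8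
    have h3 : ((s - 1 : ℤ) : ZMod 2) = 0 := (ZMod.intCast_zmod_eq_zero_iff_dvd _ 2).mpr (by push_cast at this ⊢; omega)
    push_cast at h3; linear_combination h3
  have h8 : (8:ℤ) ∣ s := by
    have h8 : ((2 * s : ℤ) : ZMod 16) = 0 := by push_cast; rw [hs]
    have := (ZMod.intCast_zmod_eq_zero_iff_dvd _ 16).mp h8
    push_cast at this
    omega
  obtain ⟨s', hs'⟩ := h8
  apply eq_zero_of_pow_dvd 2 (by norm_num)
  intro k
  have key := skolem_gen dep tor 2 8 (by norm_num) (by norm_num)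
    (fun d e W => ⟨2*e*W^2, by push_cast; ring⟩)
    p0 p2 p3 rfl rfl rfl u1 v1 (1) (3) ⟨19325424, -12836779, 17756194, -10268691⟩ ⟨1354516267739, -652908147806, 631807553939, -351480653733⟩ (by rfl) (by rfl) (by
      simp only [p2_apply, p3_apply]; norm_num)
    (eta t s h) t ⟨0, -s', 0, 0⟩ (by
      rw [eta_val]; ext <;> simp only [add_c0, add_c1, add_c2, add_c3, mul_c0, mul_c1, mul_c2, mul_c3, int_c0, int_c1, int_c2, int_c3, hs'] <;> ring)
    (by rw [eta_val]; rfl) (by rw [eta_val]; rfl) k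
  obtain ⟨d, w, hdw⟩ := key
  rw [eta_val] at hdw
  have := congrArg c1 hdw
  simp only [add_c1, mul_c1, int_c0, int_c1, int_c2, int_c3] at this
  refine ⟨-w.c1, ?_⟩
  push_cast at this
  linarith
end QC

theorem exists_prime_three (n : ℕ) (hn : n % 4 = 3) : ∃ p : ℕ, p.Prime ∧ p % 4 = 3 ∧ p ∣ n := by
  induction n using Nat.strong_induction_on with
  | _ n ih =>
    have h1 : n ≠ 1 := by omega
    have hp := Nat.minFac_prime h1
    obtain ⟨m, hm⟩ := Nat.minFac_dvd n
    generalize n.minFac = p at hp hm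
    by_cases h3 : p % 4 = 3
    · exact ⟨p, hp, h3, ⟨m, hm⟩⟩
    · have hmod : (p % 4) * (m % 4) % 4 = 3 := by rw [← Nat.mul_mod, ← hm]; exact hn
      have hp4 : p % 4 < 4 := Nat.mod_lt _ (by norm_num)
      have hm4 : m % 4 < 4 := Nat.mod_lt _ (by norm_num)
      have hm3 : m % 4 = 3 := by
        generalize p % 4 = a at *
        generalize m % 4 = b at *
        interval_cases a <;> interval_cases b <;> omega
      have hlt : m < n := by
        have := hp.two_le
        have : 0 < m := by omega
        nlinarith
      obtain ⟨q, hq, hq3, hqm⟩ := ih m hlt hm3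
      exact ⟨q, hq, hq3, hqm.trans ⟨p, by rw [hm, mul_comm]⟩⟩

theorem sum_sq_three (n y a : ℤ) (hn : n % 4 = 3) (hpos : 0 < n) (h : n ∣ y^2 + a^2) :
    ∃ p : ℕ, p.Prime ∧ p % 4 = 3 ∧ (p : ℤ) ∣ n ∧ (p : ℤ) ∣ a := by
  lift n to ℕ using hpos.le
  obtain ⟨p, hp, hp3, hpn⟩ := exists_prime_three n (by omega)
  refine ⟨p, hp, hp3, by exact_mod_cast hpn, ?_⟩
  haveI : Fact p.Prime := ⟨hp⟩
  rw [← ZMod.intCast_zmod_eq_zero_iff_dvd]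
  by_contra ha
  have h1 : (p : ℤ) ∣ y^2 + a^2 := (Int.natCast_dvd_natCast.mpr hpn).trans h
  rw [← ZMod.intCast_zmod_eq_zero_iff_dvd] at h1
  push_cast at h1
  exact ZMod.mod_four_ne_three_of_sq_eq_neg_sq' ha (eq_neg_of_add_eq_zero_left h1) hp3

theorem no_three_dvd_two_pow (p : ℕ) (hp : p.Prime) (h3 : p % 4 = 3) (k : ℕ) (h : (p : ℤ) ∣ 2^k) : False := by
  have h' : p ∣ 2^k := by exact_mod_cast h
  have := (Nat.prime_dvd_prime_iff_eq hp Nat.prime_two).mp (hp.dvd_of_dvd_pow h')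
  omega

theorem part_two : ¬ ∃ X Y : ℤ, Y ^ 2 = X ^ 3 + 10584 := by
  rintro ⟨X, Y, h⟩
  have hz16 := congrArg (fun z : ℤ => (z : ZMod 16)) h
  push_cast at hz16
  have hz : ∀ x y : ZMod 16, y^2 = x^3 + 10584 → 8*x = 0 → 4*y = 0 := by decide +kernel
  have ho : ∀ x y : ZMod 16, y^2 = x^3 + 10584 → 8*x ≠ 0 → 4*((x-11)^2+363) = 12 := by decide +kernel
  by_cases hX : 2 ∣ X
  · have h8 : (8 * X : ZMod 16) = 0 := by
      have : ((8*X : ℤ) : ZMod 16) = 0 := by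
        rw [ZMod.intCast_zmod_eq_zero_iff_dvd]; push_cast; omega
      push_cast at this; exact this
    have hy4 := hz _ _ hz16 h8
    have hY : 4 ∣ Y := by
      have : ((4*Y : ℤ) : ZMod 16) = 0 := by push_cast; exact hy4
      rw [ZMod.intCast_zmod_eq_zero_iff_dvd] at this
      push_cast at this; omega
    obtain ⟨x, rfl⟩ := hX
    obtain ⟨y, rfl⟩ := hY
    have h' : 2*y^2 = x^3 + 1323 := by linarith
    have hx0 : x % 4 = 1 ∨ x % 4 = 3 := by
      have hmod := congrArg (fun z : ℤ => (z : ZMod 4)) h'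
      push_cast at hmod
      have key : ∀ x y : ZMod 4, 2*y^2 = x^3+1323 → 2*x = 2 := by decide
      have := key _ _ hmod
      have : ((2*x-2 : ℤ) : ZMod 4) = 0 := by push_cast; rw [this]; simp
      rw [ZMod.intCast_zmod_eq_zero_iff_dvd] at this
      push_cast at this; omega
    have hsq : ∀ c : ℤ, x % 4 = 1 → c % 4 = 3 → (x^2 - c*x + c^2) % 4 = 3 := by
      intro c hx hc
      obtain ⟨u, hu⟩ : ∃ u, x = 4*u+1 := ⟨x/4, by omega⟩
      obtain ⟨v, hv⟩ : ∃ v, c = 4*v+3 := ⟨c/4, by omega⟩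
      have : x^2 - c*x + c^2 = 4*(4*u^2+2*u - 4*u*v-3*u-v + 4*v^2+6*v+1) + 3 := by rw [hu, hv]; ring
      omega
    have hsq' : ∀ c : ℤ, x % 4 = 3 → c % 4 = 1 → (x^2 - c*x + c^2) % 4 = 3 := by
      intro c hx hc
      obtain ⟨u, hu⟩ : ∃ u, x = 4*u+3 := ⟨x/4, by omega⟩
      obtain ⟨v, hv⟩ : ∃ v, c = 4*v+1 := ⟨c/4, by omega⟩
      have : x^2 - c*x + c^2 = 4*(4*u^2+6*u - 4*u*v-3*v-u + 4*v^2+2*v+1) + 3 := by rw [hu, hv]; ring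
      omega
    have hcop : ∀ n m : ℤ, n % 4 = 3 → n ∣ 2*m → n ∣ m := by
      intro n m hn hd
      have : IsCoprime n 2 := by
        refine ⟨-1, (n+1)/2, ?_⟩
        omega
      exact this.dvd_of_dvd_mul_left hd
    rcases hx0 with hx | hx
    · have hn := hsq 11 hx (by norm_num)
      obtain ⟨p, hp, hp3, -, hpa⟩ := sum_sq_three (x^2-11*x+11^2) y 2 hn (by nlinarith [sq_nonneg (2*x-11)])
        (hcop _ _ hn ⟨x+11, by linear_combination h'⟩)
      exact no_three_dvd_two_pow p hp hp3 1 (by simpa using hpa)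
    · have hn := hsq' 197 hx (by norm_num)
      obtain ⟨p, hp, hp3, hpn, hpa⟩ := sum_sq_three (x^2-197*x+197^2) y 1955 hn (by nlinarith [sq_nonneg (2*x-197)])
        (hcop _ _ hn ⟨x+197, by linear_combination h'⟩)
      have hpa' : p ∣ 5*17*23 := by exact_mod_cast hpa
      have hp23 : p = 23 := by
        rcases (hp.dvd_mul).mp hpa' with h1 | h1
        · rcases (hp.dvd_mul).mp h1 with h2 | h2
          · have := (Nat.prime_dvd_prime_iff_eq hp (by norm_num)).mp h2; omega
          · have := (Nat.prime_dvd_prime_iff_eq hp (by norm_num)).mp h2; omega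
        · exact (Nat.prime_dvd_prime_iff_eq hp (by norm_num)).mp h1
      rw [hp23, ← ZMod.intCast_zmod_eq_zero_iff_dvd] at hpn
      push_cast at hpn
      have key : ∀ x : ZMod 23, x^2-197*x+197^2 ≠ 0 := by decide
      exact key _ hpn
  · have h8 : (8 * X : ZMod 16) ≠ 0 := by
      intro h0
      have : ((8*X : ℤ) : ZMod 16) = 0 := by push_cast; exact h0
      rw [ZMod.intCast_zmod_eq_zero_iff_dvd] at this
      push_cast at this; omega
    have h4 := ho _ _ hz16 h8
    have hn : ((X-11)^2+363) % 4 = 3 := by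
      have : ((4*((X-11)^2+363) - 12 : ℤ) : ZMod 16) = 0 := by push_cast; rw [h4]; simp
      rw [ZMod.intCast_zmod_eq_zero_iff_dvd] at this
      push_cast at this; omega
    obtain ⟨p, hp, hp3, -, hpa⟩ := sum_sq_three _ Y 8 hn (by positivity) ⟨X+22, by linear_combination h⟩
    exact no_three_dvd_two_pow p hp hp3 3 (by simpa using hpa)

theorem pigeon3 (n : ℕ) (hn : 0 < n) (r0 r1 r2 : ℤ) (P0 P1 P2 : ℕ) (h : n < (P0+1)*(P1+1)*(P2+1)) :
    ∃ x0 x1 x2 : ℤ, ¬ (x0 = 0 ∧ x1 = 0 ∧ x2 = 0) ∧ |x0| ≤ P0 ∧ |x1| ≤ P1 ∧ |x2| ≤ P2 ∧ (n:ℤ) ∣ r0*x0 + r1*x1 + r2*x2 := by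
  haveI : NeZero n := ⟨hn.ne'⟩
  let f : Fin (P0+1) × Fin (P1+1) × Fin (P2+1) → ZMod n := fun v => r0 * (v.1.val : ℤ) + r1 * (v.2.1.val : ℤ) + r2 * (v.2.2.val : ℤ)
  obtain ⟨v, w, hvw, hf⟩ := Fintype.exists_ne_map_eq_of_card_lt f (by
    simp only [Fintype.card_prod, Fintype.card_fin, ZMod.card]; rw [← mul_assoc]; exact h)
  refine ⟨(v.1.val:ℤ) - w.1.val, (v.2.1.val:ℤ) - w.2.1.val, (v.2.2.val:ℤ) - w.2.2.val, ?_, ?_, ?_, ?_, ?_⟩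
  · rintro ⟨h0, h1, h2⟩
    apply hvw
    ext
    · omega
    · omega
    · omega
  · have := v.1.isLt; have := w.1.isLt; rw [abs_le]; omega
  · have := v.2.1.isLt; have := w.2.1.isLt; rw [abs_le]; omega
  · have := v.2.2.isLt; have := w.2.2.isLt; rw [abs_le]; omega
  · rw [← ZMod.intCast_zmod_eq_zero_iff_dvd]
    have := sub_eq_zero.mpr hf
    simp only [f] at this
    push_cast at this ⊢
    linear_combination this

theorem exists_sqrt (n : ℕ) : ∃ P : ℕ, P^2 ≤ n ∧ n < (P+1)^2 :=
  ⟨Nat.sqrt n, by rw [pow_two]; exact Nat.sqrt_le n, by rw [pow_two]; exact Nat.lt_succ_sqrt n⟩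

theorem exists_fourth (n : ℕ) : ∃ P : ℕ, P^4 ≤ n ∧ n < (P+1)^4 := by
  obtain ⟨m, h1, h2⟩ := exists_sqrt n
  obtain ⟨P, h3, h4⟩ := exists_sqrt m
  refine ⟨P, ?_, ?_⟩
  · calc P^4 = (P^2)^2 := by ring
      _ ≤ m^2 := Nat.pow_le_pow_left h3 2
      _ ≤ n := h1
  · calc n < (m+1)^2 := h2
      _ ≤ ((P+1)^2)^2 := Nat.pow_le_pow_left h4 2
      _ = (P+1)^4 := by ring

theorem exists_bound (x a : ℕ) (ha : 0 < a) : ∃ P : ℕ, a^2*P^4 ≤ 6*x^2 ∧ 6*x^2 < a^2*(P+1)^4 := by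
  obtain ⟨P, h1, h2⟩ := exists_fourth (6*x^2/a^2)
  refine ⟨P, ?_, ?_⟩
  · exact (Nat.mul_le_mul_left _ h1).trans (Nat.mul_div_le _ _)
  · rw [mul_comm (a^2)]
    exact (Nat.div_lt_iff_lt_mul (by positivity)).mp h2

theorem norm_small (l1 l2 m : ℤ) (hm0 : 0 < m) (hm5 : m < 5) (hN : l1^2 + 6*l2^2 = m^3) :
    l2 = 0 ∧ (l1 = 1 ∨ l1 = -1 ∨ l1 = 8 ∨ l1 = -8) := by
  have hm64 : m^3 ≤ 64 := by interval_cases m <;> norm_num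
  have b2 : l2 ≤ 3 := by nlinarith
  have b2' : -3 ≤ l2 := by nlinarith
  have b1 : l1 ≤ 8 := by nlinarith
  have b1' : -8 ≤ l1 := by nlinarith
  have key : ∀ m ∈ Finset.Icc (1:ℤ) 4, ∀ l2 ∈ Finset.Icc (-3:ℤ) 3, ∀ l1 ∈ Finset.Icc (-8:ℤ) 8, l1^2+6*l2^2 = m^3 →
    l2 = 0 ∧ (l1 = 1 ∨ l1 = -1 ∨ l1 = 8 ∨ l1 = -8) := by decide +kernel
  exact key m (by simp; omega) l2 (by simp; omega) l1 (by simp; omega) hN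

set_option maxHeartbeats 1000000 in
theorem cube_descent (a b A C x : ℤ) (ha : 0 < a) (hb : 0 < b) (hab : a * b = 6) (h : a*A^2 + b*C^2 = x^3) (hc : IsCoprime C x)
    (hx : 0 < x) :
    ∃ p q : ℤ, A = a*p^3 - 3*b*p*q^2 ∧ C = 3*a*p^2*q - b*q^3 ∧ x = a*p^2+b*q^2 := by
  obtain ⟨u, v, huv⟩ : IsCoprime C (x^3) := hc.pow_right
  obtain ⟨r, hr⟩ : ∃ r, r = A*u := ⟨_, rfl⟩
  have hr1 : A - r*C = x^3*(A*v) := by rw [hr]; linear_combination A*huv*(-1)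
  have hr2 : a*r^2 + b = x^3*(u^2 + b*v*(1+u*C)) := by
    rw [hr]; linear_combination u^2*h - b*(1+u*C)*huv
  obtain ⟨xn, hxn⟩ := Int.eq_ofNat_of_zero_le hx.le
  obtain ⟨an, han⟩ := Int.eq_ofNat_of_zero_le ha.le
  obtain ⟨bn, hbn⟩ := Int.eq_ofNat_of_zero_le hb.le
  obtain ⟨P, hP1, hP2⟩ := exists_bound xn an (by omega)
  obtain ⟨Q, hQ1, hQ2⟩ := exists_bound xn bn (by omega)
  have habn : an*bn = 6 := by
    have : (an:ℤ)*bn = 6 := by rw [← han, ← hbn]; exact hab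
    exact_mod_cast this
  have hprod : xn < (P+1)*(Q+1)*(0+1) := by
    by_contra hle
    push Not at hle
    have h1 : (an^2*(P+1)^4)*(bn^2*(Q+1)^4) ≤ (6*xn^2)*(6*xn^2) := by
      calc (an^2*(P+1)^4)*(bn^2*(Q+1)^4) = (an*bn)^2*((P+1)*(Q+1)*(0+1))^4 := by ring
        _ ≤ (an*bn)^2*xn^4 := Nat.mul_le_mul_left _ (Nat.pow_le_pow_left hle 4)
        _ = _ := by rw [habn]; ring
    have h2 : (6*xn^2)*(6*xn^2) < (an^2*(P+1)^4)*(bn^2*(Q+1)^4) :=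
      Nat.mul_lt_mul'' hP2 hQ2
    omega
  obtain ⟨p, q, z, hne, hp, hq, hz, hdvd⟩ := pigeon3 xn (by omega) 1 (-r) 0 P Q 0 hprod
  have hz0 : z = 0 := by simpa using hz
  rw [← hxn] at hdvd
  obtain ⟨k, hk⟩ := hdvd
  have hk' : p - r*q = x*k := by linear_combination hk
  have hpq : ¬ (p = 0 ∧ q = 0) := fun hh => hne ⟨hh.1, hh.2, hz0⟩
  -- norm bound
  have bp : (a*p^2)^2 ≤ 6*x^2 := by
    have h1 : p^2 ≤ (P:ℤ)^2 := sq_le_sq' (by linarith [(abs_le.mp hp).1]) (abs_le.mp hp).2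
    have h2 : (a:ℤ)^2*P^4 ≤ 6*x^2 := by rw [han, hxn]; exact_mod_cast hP1
    have h3 : (p^2)^2 ≤ ((P:ℤ)^2)^2 := pow_le_pow_left₀ (sq_nonneg p) h1 2
    calc (a*p^2)^2 = a^2*(p^2)^2 := by ring
      _ ≤ a^2*((P:ℤ)^2)^2 := mul_le_mul_of_nonneg_left h3 (sq_nonneg a)
      _ = a^2*P^4 := by ring
      _ ≤ _ := h2
  have bq : (b*q^2)^2 ≤ 6*x^2 := by
    have h1 : q^2 ≤ (Q:ℤ)^2 := sq_le_sq' (by linarith [(abs_le.mp hq).1]) (abs_le.mp hq).2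
    have h2 : (b:ℤ)^2*Q^4 ≤ 6*x^2 := by rw [hbn, hxn]; exact_mod_cast hQ1
    have h3 : (q^2)^2 ≤ ((Q:ℤ)^2)^2 := pow_le_pow_left₀ (sq_nonneg q) h1 2
    calc (b*q^2)^2 = b^2*(q^2)^2 := by ring
      _ ≤ b^2*((Q:ℤ)^2)^2 := mul_le_mul_of_nonneg_left h3 (sq_nonneg b)
      _ = b^2*Q^4 := by ring
      _ ≤ _ := h2
  obtain ⟨m, hm⟩ : x ∣ a*p^2+b*q^2 := by
    refine ⟨k*a*(p+r*q) + q^2*x^2*(u^2 + b*v*(1+u*C)), ?_⟩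
    linear_combination a*(p+r*q)*hk' + q^2*hr2
  have hNpos : 0 < a*p^2+b*q^2 := by
    rcases not_and_or.mp hpq with h0 | h0
    · have : 0 < p^2 := by positivity
      linarith [mul_pos ha this, mul_nonneg hb.le (sq_nonneg q)]
    · have : 0 < q^2 := by positivity
      linarith [mul_pos hb this, mul_nonneg ha.le (sq_nonneg p)]
  have hm0 : 0 < m := by
    rw [hm] at hNpos
    exact (mul_pos_iff_of_pos_left hx).mp hNpos
  have hm5 : m < 5 := by
    by_contra hge
    push Not at hge
    have h1 : 5*x ≤ a*p^2+b*q^2 := by rw [hm, mul_comm]; exact mul_le_mul_of_nonneg_left hge hx.le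
    have h2 : (5*x)^2 ≤ (a*p^2+b*q^2)^2 := pow_le_pow_left₀ (by positivity) h1 2
    clear hr1 hr2 hk' hm hP1 hP2 hQ1 hQ2 hprod hk h1 h huv
    generalize a*p^2 = S at *
    generalize b*q^2 = T at *
    linarith [sq_nonneg (S-T), mul_pos hx hx, two_mul_le_add_sq S T, add_sq S T]
  obtain ⟨U, hU⟩ : ∃ U, U = a*p^3 - 3*b*p*q^2 := ⟨_, rfl⟩
  obtain ⟨V, hV⟩ : ∃ V, V = 3*a*p^2*q - b*q^3 := ⟨_, rfl⟩
  have hUV : U - r*V = x^3*(a*k^3 + (u^2 + b*v*(1+u*C))*(-3*p*q^2+r*q^3)) := by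
    have : U - r*V = a*(p-r*q)^3 + (a*r^2+b)*(-3*p*q^2+r*q^3) := by rw [hU, hV]; ring
    rw [this, hk', hr2]; ring
  obtain ⟨g, hg⟩ : ∃ g, g = a*k^3 + (u^2 + b*v*(1+u*C))*(-3*p*q^2+r*q^3) := ⟨_, rfl⟩
  rw [← hg] at hUV
  obtain ⟨l2, hl2⟩ : x^3 ∣ A*V - C*U := ⟨A*v*V - C*g, by linear_combination V*hr1 - C*hUV⟩
  obtain ⟨l1, hl1⟩ : x^3 ∣ a*A*U + b*C*V :=
    ⟨a*A*v*U + a*r*C*g + C*V*(u^2 + b*v*(1+u*C)), by linear_combination a*U*hr1 + a*r*C*hUV + C*V*hr2⟩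
  have hx3 : x^3 ≠ 0 := by positivity
  have eU : U = A*l1 - b*C*l2 := by
    apply mul_left_cancel₀ hx3
    linear_combination A*hl1 - b*C*hl2 - U*h
  have eV : V = C*l1 + a*A*l2 := by
    apply mul_left_cancel₀ hx3
    linear_combination C*hl1 + a*A*hl2 - V*h
  have hN : l1^2 + 6*l2^2 = m^3 := by
    apply mul_left_cancel₀ hx3
    have e1 : a*U^2 + b*V^2 = (a*p^2+b*q^2)^3 := by rw [hU, hV]; ring
    have e2 : a*U^2 + b*V^2 = (a*A^2+b*C^2)*(l1^2 + a*b*l2^2) := by rw [eU, eV]; ring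
    rw [h, hab] at e2
    rw [← e2, e1, hm]; ring
  have hl : l2 = 0 ∧ (l1 = 1 ∨ l1 = -1 ∨ l1 = 8 ∨ l1 = -8) := by
    exact norm_small l1 l2 m hm0 hm5 hN
  obtain ⟨rfl, hl⟩ := hl
  have cub : ∀ {s t : ℤ}, s^3 = t^3 → s = t := fun {s t} hst => (Odd.strictMono_pow (n := 3) (by decide)).injective hst
  -- conclude
  have finish : ∀ p q : ℤ, A = a*p^3 - 3*b*p*q^2 → C = 3*a*p^2*q - b*q^3 → x = a*p^2+b*q^2 := by
    intro p q hA hC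
    apply cub
    rw [← h, hA, hC]; ring
  have h8 : 8 ∣ U → 8 ∣ V → 2 ∣ p ∧ 2 ∣ q := by
    intro h1 h2
    rw [hU] at h1; rw [hV] at h2
    have ha6 : a ≤ 6 := by
      have h1b : 1 ≤ b := hb
      calc a = a*1 := by ring
        _ ≤ a*b := mul_le_mul_of_nonneg_left h1b ha.le
        _ = 6 := hab
    have key : ∀ p q : ZMod 8, (p^3-18*p*q^2 = 0 → 3*p^2*q-6*q^3 = 0 → 4*p=0 ∧ 4*q=0) ∧
       (2*p^3-9*p*q^2 = 0 → 6*p^2*q-3*q^3 = 0 → 4*p=0 ∧ 4*q=0) ∧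
       (3*p^3-6*p*q^2 = 0 → 9*p^2*q-2*q^3 = 0 → 4*p=0 ∧ 4*q=0) ∧
       (6*p^3-3*p*q^2 = 0 → 18*p^2*q-q^3 = 0 → 4*p=0 ∧ 4*q=0) := by decide +kernel
    obtain ⟨k1, k2, k3, k6⟩ := key p q
    have c1 := (ZMod.intCast_zmod_eq_zero_iff_dvd _ 8).mpr (by exact_mod_cast h1)
    have c2 := (ZMod.intCast_zmod_eq_zero_iff_dvd _ 8).mpr (by exact_mod_cast h2)
    have c3 : (4*p:ZMod 8) = 0 ∧ (4*q:ZMod 8) = 0 := by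
      have hcases : (a = 1 ∧ b = 6) ∨ (a = 2 ∧ b = 3) ∨ (a = 3 ∧ b = 2) ∨ (a = 6 ∧ b = 1) := by
        interval_cases a <;> omega
      rcases hcases with ⟨rfl, rfl⟩ | ⟨rfl, rfl⟩ | ⟨rfl, rfl⟩ | ⟨rfl, rfl⟩
      · apply k1
        · push_cast at c1; linear_combination c1
        · push_cast at c2; linear_combination c2
      · apply k2
        · push_cast at c1; linear_combination c1
        · push_cast at c2; linear_combination c2
      · apply k3
        · push_cast at c1; linear_combination c1
        · push_cast at c2; linear_combination c2
      · apply k6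
        · push_cast at c1; linear_combination c1
        · push_cast at c2; linear_combination c2
    have d1 : (8:ℤ) ∣ 4*p := by
      rw [← Nat.cast_ofNat, ← ZMod.intCast_zmod_eq_zero_iff_dvd]; push_cast; exact c3.1
    have d2 : (8:ℤ) ∣ 4*q := by
      rw [← Nat.cast_ofNat, ← ZMod.intCast_zmod_eq_zero_iff_dvd]; push_cast; exact c3.2
    omega
  rcases hl with rfl | rfl | rfl | rfl
  · have e1 : A = a*p^3 - 3*b*p*q^2 := by linarith
    have e2 : C = 3*a*p^2*q - b*q^3 := by linarith
    exact ⟨p, q, e1, e2, finish p q e1 e2⟩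
  · have e1 : A = a*(-p)^3 - 3*b*(-p)*(-q)^2 := by linarith
    have e2 : C = 3*a*(-p)^2*(-q) - b*(-q)^3 := by linarith
    exact ⟨-p, -q, e1, e2, finish _ _ e1 e2⟩
  · obtain ⟨⟨p', rfl⟩, ⟨q', rfl⟩⟩ := h8 ⟨A, by linarith⟩ ⟨C, by linarith⟩
    have e1 : A = a*p'^3 - 3*b*p'*q'^2 := by linarith
    have e2 : C = 3*a*p'^2*q' - b*q'^3 := by linarith
    exact ⟨_, _, e1, e2, finish _ _ e1 e2⟩
  · obtain ⟨⟨p', rfl⟩, ⟨q', rfl⟩⟩ := h8 ⟨-A, by linarith⟩ ⟨-C, by linarith⟩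
    have e1 : A = a*(-p')^3 - 3*b*(-p')*(-q')^2 := by linarith
    have e2 : C = 3*a*(-p')^2*(-q') - b*(-q')^3 := by linarith
    exact ⟨_, _, e1, e2, finish _ _ e1 e2⟩

theorem four_dvd_of_sq (y : ℤ) (h : 8 ∣ y^2) : 4 ∣ y := by
  have key : ∀ y : ZMod 8, y^2 = 0 → 2*y = 0 := by decide
  have h1 := (ZMod.intCast_zmod_eq_zero_iff_dvd (y^2) 8).mpr (by exact_mod_cast h)
  push_cast at h1
  have h2 : (((2*y:ℤ)) : ZMod 8) = 0 := by push_cast; exact key _ h1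
  rw [ZMod.intCast_zmod_eq_zero_iff_dvd] at h2
  push_cast at h2; omega

theorem nine_dvd_of_sq (y : ℤ) (h : 27 ∣ y^2) : 9 ∣ y := by
  have key : ∀ y : ZMod 27, y^2 = 0 → 3*y = 0 := by decide
  have h1 := (ZMod.intCast_zmod_eq_zero_iff_dvd (y^2) 27).mpr (by exact_mod_cast h)
  push_cast at h1
  have h2 : (((3*y:ℤ)) : ZMod 27) = 0 := by push_cast; exact key _ h1
  rw [ZMod.intCast_zmod_eq_zero_iff_dvd] at h2
  push_cast at h2; omega

theorem dvd14 (q : ℤ) (h : q ∣ 14) : q = 1 ∨ q = 2 ∨ q = 7 ∨ q = 14 ∨ q = -1 ∨ q = -2 ∨ q = -7 ∨ q = -14 := by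
  have h1 : q ≤ 14 := Int.le_of_dvd (by norm_num) h
  have h2 : -q ≤ 14 := Int.le_of_dvd (by norm_num) ((neg_dvd).mpr h)
  have h3 : -14 ≤ q := by linarith
  have key : ∀ q ∈ Finset.Icc (-14:ℤ) 14, q ∣ 14 → q = 1 ∨ q = 2 ∨ q = 7 ∨ q = 14 ∨ q = -1 ∨ q = -2 ∨ q = -7 ∨ q = -14 := by decide +kernel
  exact key q (by simp; omega) h

theorem not_sq_between (p k n : ℤ) (hk : 0 ≤ k) (h : p^2 = n) (h1 : k^2 < n) (h2 : n < (k+1)^2) : False := by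
  rw [← h] at h1 h2
  have a1 : |k| < |p| := sq_lt_sq.mp h1
  have a2 : |p| < |k+1| := sq_lt_sq.mp h2
  rw [abs_of_nonneg hk] at a1
  rw [abs_of_nonneg (a := k+1) (by linarith)] at a2
  omega

theorem cop_int (p : ℕ) (hp : p.Prime) (x : ℤ) (h : ¬ (p:ℤ) ∣ x) : IsCoprime (p:ℤ) x :=
  ((Nat.prime_iff_prime_int.mp hp).coprime_iff_not_dvd).mpr h

theorem case_i (X Y : ℤ) (h : Y^2 = X^3 - 10584) (hX : 0 < X) (h2 : ¬ 2 ∣ X) (h3 : ¬ 3 ∣ X) (h7 : ¬ 7 ∣ X) :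
    X = 22 ∨ X = 25 ∨ X = 394 := by
  have hc : IsCoprime 42 X := by
    have e : (42:ℤ) = 2*3*7 := by norm_num
    rw [e]
    exact ((cop_int 2 (by norm_num) X h2).mul_left (cop_int 3 (by norm_num) X h3)).mul_left (cop_int 7 (by norm_num) X h7)
  obtain ⟨p, q, hA, hC, hx⟩ := cube_descent 1 6 Y 42 X (by norm_num) (by norm_num) (by norm_num) (by linarith) hc hX
  have e : 14 = q*(p^2-2*q^2) := by linarith
  rcases dvd14 q ⟨_, e⟩ with rfl | rfl | rfl | rfl | rfl | rfl | rfl | rfl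
  · left; linarith
  · exfalso; omega
  · right; right; linarith
  · exfalso; exact not_sq_between p 19 393 (by norm_num) (by linarith) (by norm_num) (by norm_num)
  · exfalso; nlinarith [sq_nonneg p]
  · right; left; linarith
  · exfalso; exact not_sq_between p 9 96 (by norm_num) (by linarith) (by norm_num) (by norm_num)
  · exfalso; exact not_sq_between p 19 391 (by norm_num) (by linarith) (by norm_num) (by norm_num)

theorem case_ii (x y : ℤ) (h : 2*y^2 = x^3 - 1323) (hX : 0 < x) (h3 : ¬ 3 ∣ x) (h7 : ¬ 7 ∣ x) :
    x = 11 ∨ x = 197 := by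
  have hc : IsCoprime 21 x := by
    have e : (21:ℤ) = 3*7 := by norm_num
    rw [e]
    exact (cop_int 3 (by norm_num) x h3).mul_left (cop_int 7 (by norm_num) x h7)
  obtain ⟨p, q, hA, hC, hx⟩ := cube_descent 2 3 y 21 x (by norm_num) (by norm_num) (by norm_num) (by linarith) hc hX
  have e : 7 = q*(2*p^2-q^2) := by linarith
  rcases dvd14 q ⟨2*(2*p^2-q^2), by linarith⟩ with rfl | rfl | rfl | rfl | rfl | rfl | rfl | rfl
  · left; linarith
  · exfalso; omega
  · right; linarith
  · exfalso; omega
  · exfalso; nlinarith [sq_nonneg p]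
  · exfalso; omega
  · exfalso; exact not_sq_between p 4 24 (by norm_num) (by linarith) (by norm_num) (by norm_num)
  · exfalso; omega

theorem case_iii (x y : ℤ) (h : 3*y^2 = x^3 - 392) (hX : 0 < x) (h2 : ¬ 2 ∣ x) (h7 : ¬ 7 ∣ x) : False := by
  have hc : IsCoprime 14 x := by
    have e : (14:ℤ) = 2*7 := by norm_num
    rw [e]
    exact (cop_int 2 (by norm_num) x h2).mul_left (cop_int 7 (by norm_num) x h7)
  obtain ⟨p, q, hA, hC, hx⟩ := cube_descent 3 2 y 14 x (by norm_num) (by norm_num) (by norm_num) (by linarith) hc hX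
  have e : 14 = q*(9*p^2-2*q^2) := by linarith
  rcases dvd14 q ⟨_, e⟩ with rfl | rfl | rfl | rfl | rfl | rfl | rfl | rfl <;> omega

theorem case_iv (x y : ℤ) (h : 6*y^2 = x^3 - 49) (hX : 0 < x) (h7 : ¬ 7 ∣ x) : False := by
  have hc : IsCoprime 7 x := cop_int 7 (by norm_num) x h7
  obtain ⟨p, q, hA, hC, hx⟩ := cube_descent 6 1 y 7 x (by norm_num) (by norm_num) (by norm_num) (by linarith) hc hX
  have e : 7 = q*(18*p^2-q^2) := by linarith
  rcases dvd14 q ⟨2*(18*p^2-q^2), by linarith⟩ with rfl | rfl | rfl | rfl | rfl | rfl | rfl | rfl <;> omega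

theorem three_dvd_of_cube (p : ℤ) (h : 3 ∣ p^3) : 3 ∣ p := Int.prime_three.dvd_of_dvd_pow h

/-- when 7 divides X, also 3 does -/
theorem case_v (x y : ℤ) (h : y^2 + 216 = 7*x^3) (hX : 0 < x) : 3 ∣ x := by
  by_contra h3
  have hy0 : y % 7 = 1 ∨ y % 7 = 6 := by
    have h0 : (y^2 + 216) % 7 = 0 := by rw [h]; omega
    have h1 : ((y%7)*(y%7) + 216) % 7 = 0 := by
      rw [← h0, pow_two, Int.add_emod, ← Int.mul_emod, ← Int.add_emod]
    have : 0 ≤ y % 7 := Int.emod_nonneg _ (by norm_num)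
    have : y % 7 < 7 := Int.emod_lt_of_pos _ (by norm_num)
    generalize y % 7 = r at *
    interval_cases r <;> omega
  obtain ⟨y', hy', h'⟩ : ∃ y', y' % 7 = 6 ∧ y'^2 + 216 = 7*x^3 := by
    rcases hy0 with h0 | h0
    · exact ⟨-y, by omega, by rw [neg_sq]; exact h⟩
    · exact ⟨y, h0, h⟩
  obtain ⟨A, hA⟩ : ∃ A, y' = 7*A - 36 := ⟨(y'+36)/7, by omega⟩
  obtain ⟨C, hC⟩ : ∃ C, C = 6 - A := ⟨_, rfl⟩
  have hAC : A^2 + 6*C^2 = x^3 := by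
    rw [hC]; rw [hA] at h'; linarith
  have hcop3 : IsCoprime 3 x := cop_int 3 (by norm_num) x h3
  by_cases h2 : 2 ∣ x
  · obtain ⟨x', hx'⟩ := h2
    have hA2 : 2 ∣ A := by
      apply Int.prime_two.dvd_of_dvd_pow (n := 2)
      exact ⟨4*x'^3 - 3*C^2, by rw [hx'] at hAC; linarith⟩
    obtain ⟨A1, hA1⟩ := hA2
    obtain ⟨C1, hC1⟩ : ∃ C1, C = 2*C1 := ⟨3 - A1, by omega⟩
    have e1 : A1^2 + 6*C1^2 = 2*x'^3 := by
      rw [hx', hA1, hC1] at hAC; linarith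
    have hA2' : 2 ∣ A1 := by
      apply Int.prime_two.dvd_of_dvd_pow (n := 2)
      exact ⟨x'^3 - 3*C1^2, by linarith⟩
    obtain ⟨A2, hA2⟩ := hA2'
    have e2 : 2*A2^2 + 3*C1^2 = x'^3 := by rw [hA2] at e1; linarith
    have e3 : 2*A2 + C1 = 3 := by omega
    have hcop3' : IsCoprime 3 x' := by rw [hx'] at hcop3; exact hcop3.of_mul_right_right
    have hcop : IsCoprime C1 x' := by
      apply isCoprime_of_prime_dvd
      · rintro ⟨-, rfl⟩; omega
      · intro z hz hz1 hz2
        have d1 : z ∣ 2*A2^2 := by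
          have : 2*A2^2 = x'^3 - 3*C1^2 := by linarith
          rw [this]
          exact dvd_sub (dvd_pow hz2 (by norm_num)) (dvd_mul_of_dvd_right (dvd_pow hz1 (by norm_num)) _)
        have d2 : z ∣ 2*A2 := by
          rcases hz.dvd_or_dvd d1 with h | h
          · exact dvd_mul_of_dvd_left h _
          · exact dvd_mul_of_dvd_right (hz.dvd_of_dvd_pow h) _
        have d3 : z ∣ 3 := by rw [← e3]; exact dvd_add d2 hz1
        exact hz.not_unit (hcop3'.isUnit_of_dvd' d3 hz2)
    obtain ⟨p, q, pA, pC, px⟩ := cube_descent 2 3 A2 C1 x' (by norm_num) (by norm_num) (by norm_num) e2 hcop (by omega)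
    have h3p : 3 ∣ p := by
      apply three_dvd_of_cube
      refine ⟨p^3*(-1) + 1 + 6*p*q^2 - 2*p^2*q + q^3, ?_⟩
      rw [pA, pC] at e3; linarith
    obtain ⟨p', rfl⟩ := h3p
    apply h3
    rw [hx', px]
    exact ⟨2*(6*p'^2+q^2), by ring⟩
  · have hcop : IsCoprime C x := by
      apply isCoprime_of_prime_dvd
      · rintro ⟨-, rfl⟩; omega
      · intro z hz hz1 hz2
        have d1 : z ∣ A^2 := by
          have : A^2 = x^3 - 6*C^2 := by linarith
          rw [this]
          exact dvd_sub (dvd_pow hz2 (by norm_num)) (dvd_mul_of_dvd_right (dvd_pow hz1 (by norm_num)) _)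
        have d2 := hz.dvd_of_dvd_pow d1
        have d3 : z ∣ 2*3 := by
          have : (2*3:ℤ) = A + C := by omega
          rw [this]; exact dvd_add d2 hz1
        exact hz.not_unit (((cop_int 2 (by norm_num) x h2).mul_left hcop3).isUnit_of_dvd' d3 hz2)
    obtain ⟨p, q, pA, pC, px⟩ := cube_descent 1 6 A C x (by norm_num) (by norm_num) (by norm_num) (by linarith) hcop hX
    have h3p : 3 ∣ p := by
      apply three_dvd_of_cube
      refine ⟨2 + 6*p*q^2 - p^2*q + 2*q^3, ?_⟩
      have e3 : A + C = 6 := by omega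
      rw [pA, pC] at e3; linarith
    obtain ⟨p', rfl⟩ := h3p
    apply h3
    rw [px]
    exact ⟨3*p'^2+2*q^2, by ring⟩

theorem reduction (hA : ∀ z v : ℤ, 7*z^3 = 6*v^2 + 1 → z = 1 ∨ z = 7)
    (hB : ∀ Z V : ℤ, ¬ 2 ∣ Z → 7*Z^3 = 3*V^2 + 8 → Z = 5) (X Y : ℤ) (h : Y^2 = X^3 - 10584) :
    X = 22 ∨ X = 25 ∨ X = 42 ∨ X = 105 ∨ X = 294 ∨ X = 394 := by
  have hX : 0 < X := by
    by_contra hle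
    push Not at hle
    have : X^3 ≤ 0 := by
      have := mul_nonneg (sq_nonneg X) (neg_nonneg.mpr hle)
      linarith [this, show X^2 * -X = -X^3 by ring]
    linarith [sq_nonneg Y]
  by_cases h7 : 7 ∣ X
  · obtain ⟨x, rfl⟩ := h7
    have hy7 : 7 ∣ Y := by
      apply Int.Prime.dvd_pow' (n := Y) (k := 2) (p := 7) (by norm_num)
      exact ⟨49*x^3 - 1512, by push_cast; linarith⟩
    obtain ⟨y, rfl⟩ := hy7
    have e : y^2 + 216 = 7*x^3 := by linarith
    obtain ⟨Z, rfl⟩ := case_v x y e (by omega)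
    obtain ⟨V, rfl⟩ := nine_dvd_of_sq y ⟨7*Z^3-8, by linarith⟩
    by_cases hZ : 2 ∣ Z
    · obtain ⟨z, rfl⟩ := hZ
      have h3V : 3*V^2 = 8*(7*z^3 - 1) := by linarith
      obtain ⟨v, rfl⟩ := four_dvd_of_sq V (by
        have : (8:ℤ) ∣ 3*V^2 := ⟨_, h3V⟩
        exact (IsCoprime.dvd_of_dvd_mul_left (show IsCoprime (8:ℤ) 3 from ⟨-1, 3, by norm_num⟩) this))
      rcases hA z v (by linarith) with rfl | rfl <;> omega
    · have := hB Z V hZ (by linarith)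
      omega
  · by_cases h2 : 2 ∣ X
    · have hy4 : 4 ∣ Y := by
        obtain ⟨x, rfl⟩ := h2
        exact four_dvd_of_sq Y ⟨x^3-1323, by linarith⟩
      by_cases h3 : 3 ∣ X
      · exfalso
        obtain ⟨x, rfl⟩ : 6 ∣ X := by omega
        have hy9 : 9 ∣ Y := nine_dvd_of_sq Y ⟨8*x^3-392, by linarith⟩
        obtain ⟨y, rfl⟩ : 36 ∣ Y := by omega
        exact case_iv x y (by linarith) (by omega) (by omega)
      · obtain ⟨x, rfl⟩ := h2
        obtain ⟨y, rfl⟩ := hy4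
        rcases case_ii x y (by linarith) (by omega) (by omega) (by omega) with rfl | rfl <;> omega
    · by_cases h3 : 3 ∣ X
      · exfalso
        obtain ⟨x, rfl⟩ := h3
        obtain ⟨y, rfl⟩ := nine_dvd_of_sq Y ⟨x^3-392, by linarith⟩
        exact case_iii x y (by linarith) (by omega) (by omega) (by omega)
      · rcases case_i X Y h hX h2 h3 h7 with h | h | h <;> omega

theorem param_lemma (n p q w : ℤ) (hp : 0 < p) (h : p*q = n*w^2) (hd : ∀ d : ℤ, d ∣ p → d ∣ q → d ∣ w → IsUnit d) :
    ∃ k s t : ℤ, 0 < k ∧ k ∣ n ∧ p = k*s^2 ∧ w = s*t ∧ k*q = n*t^2 := by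
  have hg0 : Int.gcd p w ≠ 0 := by
    intro h0; rw [Int.gcd_eq_zero_iff] at h0; omega
  obtain ⟨p', hp'⟩ := Int.gcd_dvd_left p w
  obtain ⟨t, ht⟩ := Int.gcd_dvd_right p w
  have hcop : IsCoprime p' t := by
    have := Int.gcd_eq_gcd_ab p w
    refine ⟨Int.gcdA p w, Int.gcdB p w, ?_⟩
    have e : ((Int.gcd p w : ℕ):ℤ) * (Int.gcdA p w * p' + Int.gcdB p w * t - 1) = 0 := by
      linear_combination (-1)*Int.gcdA p w * hp' - Int.gcdB p w * ht - this
    rcases mul_eq_zero.mp e with h1 | h1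
    · exact absurd (by exact_mod_cast h1) hg0
    · linarith
  obtain ⟨g, hg⟩ : ∃ g : ℤ, g = ((Int.gcd p w : ℕ):ℤ) := ⟨_, rfl⟩
  rw [← hg] at hp' ht
  have hgne : g ≠ 0 := by rw [hg]; exact_mod_cast hg0
  have e1 : p'*q = n*g*t^2 := by
    apply mul_left_cancel₀ hgne
    rw [hp', ht] at h; linear_combination h
  have hgq : IsCoprime g q := by
    rw [Int.isCoprime_iff_gcd_eq_one]
    have h1 : ((Int.gcd g q : ℕ):ℤ) ∣ g := Int.gcd_dvd_left g q
    have := hd (Int.gcd g q) (h1.trans ⟨_, hp'⟩) (Int.gcd_dvd_right g q) (h1.trans ⟨_, ht⟩)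
    rcases Int.isUnit_iff.mp this with h | h <;> omega
  obtain ⟨k, hk⟩ : g ∣ p' := hgq.dvd_of_dvd_mul_right ⟨n*t^2, by linear_combination e1⟩
  have e2 : k*q = n*t^2 := by
    apply mul_left_cancel₀ hgne
    rw [hk] at e1; linear_combination e1
  have e3 : p = k*g^2 := by rw [hp', hk]; ring
  refine ⟨k, g, t, ?_, ?_, e3, ht, e2⟩
  · by_contra hk0
    push Not at hk0
    have := sq_nonneg g
    nlinarith
  · have : IsCoprime k (t^2) := by
      apply IsCoprime.pow_right
      rw [hk] at hcop
      exact hcop.of_mul_left_right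
    exact this.dvd_of_dvd_mul_right ⟨q, by linear_combination (-1)*e2⟩
theorem dvd_six (k : ℤ) (h0 : 0 < k) (h : k ∣ 6) : k = 1 ∨ k = 2 ∨ k = 3 ∨ k = 6 := by
  have := Int.le_of_dvd (by norm_num) h
  interval_cases k <;> omega
theorem dvd_two (k : ℤ) (h0 : 0 < k) (h : k ∣ 2) : k = 1 ∨ k = 2 := by
  have := Int.le_of_dvd (by norm_num) h
  interval_cases k <;> omega

theorem parA0 (u v w : ZMod 8) (h1 : 2*u*v+7*w^2 = v^2+2*u*w) (h2 : u^2+14*v*w = 7*v^2+14*u*w+1) : 4*v = 0 ∧ 4*w = 0 := by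
  revert u v w; decide +kernel
theorem even_of_zmod8 (v : ℤ) (h : 4*(v : ZMod 8) = 0) : ∃ k, v = 2*k := by
  have : ((4*v : ℤ) : ZMod 8) = 0 := by push_cast; exact h
  rw [ZMod.intCast_zmod_eq_zero_iff_dvd] at this
  push_cast at this
  exact ⟨v/2, by omega⟩
theorem A0k1 : ∀ s t : ZMod 27, (s^2+2*s*t-6*t^2)^2+56*(s^2+s*t)*(s*t)-28*(s^2+s*t)^2-28*(s^2+2*s*t-6*t^2)*(s*t) ≠ 1 := by decide +kernel
theorem A0k2 : ∀ s t : ZMod 27, (2*s^2+2*s*t-3*t^2)^2+56*(2*s^2+s*t)*(s*t)-28*(2*s^2+s*t)^2-28*(2*s^2+2*s*t-3*t^2)*(s*t) ≠ 1 := by decide +kernel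
theorem A0k3 : ∀ s t : ZMod 16, (3*s^2+2*s*t-2*t^2)^2+56*(3*s^2+s*t)*(s*t)-28*(3*s^2+s*t)^2-28*(3*s^2+2*s*t-2*t^2)*(s*t) ≠ 1 := by decide +kernel
theorem A0pos (u v w : ℤ) (hp : 0 < v - w) (h1 : u*(v-w) = v^2-7*w^2) (h2 : u^2+56*v*w-28*v^2-28*u*w=1) : False := by
  obtain ⟨k, s, t, hk0, hk, hps, hw, hq⟩ := param_lemma 6 (v-w) ((v-w)+2*w-u) w hp (by linear_combination (-1)*h1) (by
    intro d d1 d2 d3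
    have hv : d ∣ v := by have := dvd_add d1 d3; simpa using this
    have hu : d ∣ u := by
      have := dvd_sub (dvd_add d1 (d3.mul_left 2)) d2
      simpa using this
    apply isUnit_of_dvd_one
    rw [← h2]
    obtain ⟨a, rfl⟩ := hv
    obtain ⟨b, rfl⟩ := hu
    exact ⟨b*(d*b)+56*a*w-28*a*(d*a)-28*b*w, by ring⟩)
  have hv : v = k*s^2+s*t := by linear_combination hps + hw
  rcases dvd_six k hk0 hk with rfl | rfl | rfl | rfl
  · have hu : u = s^2+2*s*t-6*t^2 := by linear_combination (-1)*hq + hps+2*hw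
    rw [hu, hv, hw] at h2
    have := congrArg (Int.cast : ℤ → ZMod 27) h2
    push_cast at this
    exact A0k1 s t (by linear_combination this)
  · have hu : u = 2*s^2+2*s*t-3*t^2 := by linarith
    rw [hu, hv, hw] at h2
    have := congrArg (Int.cast : ℤ → ZMod 27) h2
    push_cast at this
    exact A0k2 s t (by linear_combination this)
  · have hu : u = 3*s^2+2*s*t-2*t^2 := by linarith
    rw [hu, hv, hw] at h2
    have := congrArg (Int.cast : ℤ → ZMod 16) h2
    push_cast at this
    exact A0k3 s t (by linear_combination this)
  · have hu : u = 6*s^2+2*s*t-t^2 := by linarith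
    rw [hu, hv, hw] at h2
    have := QA.thue t s (by linear_combination h2)
    rw [this] at hps; simp at hps; omega
theorem endA0 (u v w z : ℤ) (h1 : 7*(v^2+2*u*w)-(u^2+14*v*w) = -1) (h2 : (u^2+14*v*w) - (2*u*v+7*w^2) = z)
    (h3 : 2*u*v+7*w^2 = v^2+2*u*w) : z = 1 := by
  have hz := parA0 u v w (by have := congrArg (Int.cast : ℤ → ZMod 8) h3; push_cast at this; exact this)
    (by have := congrArg (Int.cast : ℤ → ZMod 8) h1; push_cast at this; linear_combination (-1)*this)
  obtain ⟨v, rfl⟩ := even_of_zmod8 v hz.1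
  obtain ⟨w, rfl⟩ := even_of_zmod8 w hz.2
  have e1 : u*(v-w) = v^2-7*w^2 := by linarith
  have e2 : u^2+56*v*w-28*v^2-28*u*w=1 := by linarith
  rcases lt_trichotomy (v-w) 0 with hp | hp | hp
  · exact (A0pos (-u) (-v) (-w) (by linarith) (by linarith) (by linarith)).elim
  · rw [hp] at e1
    have : v = w := by linarith
    subst this
    have : v = 0 := by nlinarith
    subst this
    linarith
  · exact (A0pos u v w hp e1 e2).elim

theorem A1k1 : ∀ s t : ZMod 27, (s^2+2*s*t+6*t^2)^2 ≠ 1+12*(s^2-2*s*t)^2-8*(s^2-2*s*t)*(s^2+2*s*t+6*t^2)-84*(s^2+2*s*t+6*t^2)*(s*t)+196*(s*t)^2+112*(s^2-2*s*t)*(s*t) := by decide +kernel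
theorem A1k2 : ∀ s t : ZMod 27, (2*s^2+2*s*t+3*t^2)^2 ≠ 1+12*(2*s^2-2*s*t)^2-8*(2*s^2-2*s*t)*(2*s^2+2*s*t+3*t^2)-84*(2*s^2+2*s*t+3*t^2)*(s*t)+196*(s*t)^2+112*(2*s^2-2*s*t)*(s*t) := by decide +kernel
theorem A1k3 : ∀ s t : ZMod 16, (3*s^2+2*s*t+2*t^2)^2 ≠ 1+12*(3*s^2-2*s*t)^2-8*(3*s^2-2*s*t)*(3*s^2+2*s*t+2*t^2)-84*(3*s^2+2*s*t+2*t^2)*(s*t)+196*(s*t)^2+112*(3*s^2-2*s*t)*(s*t) := by decide +kernel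
theorem A1pos (k e f : ℤ) (hp : 0 < e+2*f) (h1 : e^2+e*k+2*k*f+14*f^2+6*e*f = 0)
    (h2 : k^2 = 1+12*e^2+8*e*k+84*k*f+196*f^2+112*e*f) : False := by
  obtain ⟨j, s, t, hk0, hk, hps, hw, hq⟩ := param_lemma 6 (e+2*f) (-(k+(e+2*f)+2*f)) f hp (by linear_combination (-1)*h1) (by
    intro d d1 d2 d3
    have he : d ∣ e := by have := dvd_sub d1 (d3.mul_left 2); simpa using this
    have hk : d ∣ k := by
      have := dvd_add (dvd_neg.mpr d2) (dvd_neg.mpr (dvd_add d1 (d3.mul_left 2)))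
      have e : - -(k+(e+2*f)+2*f) + -(e+2*f+2*f) = k := by ring
      rwa [e] at this
    apply isUnit_of_dvd_one
    have h3 : k^2-12*e^2-8*e*k-84*k*f-196*f^2-112*e*f = 1 := by linarith
    rw [← h3]
    obtain ⟨a, rfl⟩ := he
    obtain ⟨b, rfl⟩ := hk
    obtain ⟨c, rfl⟩ := d3
    exact ⟨d*(b^2-12*a^2-8*a*b-84*b*c-196*c^2-112*a*c), by ring⟩)
  have hv : e = j*s^2-2*s*t := by linear_combination hps - 2*hw
  rcases dvd_six j hk0 hk with rfl | rfl | rfl | rfl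
  · have hu : k = -(s^2+2*s*t+6*t^2) := by linarith
    rw [hu, hv, hw] at h2
    have := congrArg (Int.cast : ℤ → ZMod 27) h2
    push_cast at this
    exact A1k1 s t (by linear_combination this)
  · have hu : k = -(2*s^2+2*s*t+3*t^2) := by linarith
    rw [hu, hv, hw] at h2
    have := congrArg (Int.cast : ℤ → ZMod 27) h2
    push_cast at this
    exact A1k2 s t (by linear_combination this)
  · have hu : k = -(3*s^2+2*s*t+2*t^2) := by linarith
    rw [hu, hv, hw] at h2
    have := congrArg (Int.cast : ℤ → ZMod 16) h2
    push_cast at this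
    exact A1k3 s t (by linear_combination this)
  · have hu : k = -(6*s^2+2*s*t+t^2) := by linarith
    rw [hu, hv, hw] at h2
    have := QB.thue t s (by linear_combination h2)
    rw [this] at hps; simp at hps; omega
theorem endA1 (u v w z : ℤ) (h1 : (u^2+14*v*w)+2*(2*u*v+7*w^2)+3*(v^2+2*u*w) = 0)
    (h2 : 3*(u^2+14*v*w) + 7*(2*u*v+7*w^2) + 14*(v^2+2*u*w) = -1)
    (h3 : z = 2*(u^2+14*v*w)+3*(2*u*v+7*w^2)+7*(v^2+2*u*w)) : z = 7 := by
  obtain ⟨e, rfl⟩ : ∃ e, u = e - 3*v := ⟨u+3*v, by ring⟩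
  have g1 : e^2 - 2*e*v - 4*v*w+14*w^2+6*e*w = 0 := by linear_combination h1
  have he : 2 ∣ e := by
    apply Int.prime_two.dvd_of_dvd_pow (n := 2)
    exact ⟨e*v+2*v*w-7*w^2-3*e*w, by linear_combination g1⟩
  obtain ⟨e, rfl⟩ := he
  have hw : 2 ∣ w := by
    apply Int.prime_two.dvd_of_dvd_pow (n := 2)
    have : 7*w^2 = 2*(-(e^2 - e*v - v*w+3*e*w)) := by linarith
    omega
  obtain ⟨w, rfl⟩ := hw
  have e1 : e^2+e*(-v)+2*(-v)*w+14*w^2+6*e*w = 0 := by linarith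
  have e2 : (-v)^2 = 1+12*e^2+8*e*(-v)+84*(-v)*w+196*w^2+112*e*w := by linarith
  rcases lt_trichotomy (e+2*w) 0 with hp | hp | hp
  · exact (A1pos v (-e) (-w) (by linarith) (by linarith) (by linarith)).elim
  · have : e = -2*w := by linarith
    subst this
    have : w = 0 := by nlinarith
    subst this
    linarith
  · exact (A1pos (-v) e w hp e1 e2).elim
theorem endB0 (u v w Z : ℤ) (h1 : u^2+14*v*w = -6) (h2 : v^2+2*u*w = 0) : False := by
  have hv : 2 ∣ v := by
    apply Int.prime_two.dvd_of_dvd_pow (n := 2)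
    exact ⟨-u*w, by linarith⟩
  obtain ⟨v, rfl⟩ := hv
  have hu : 2 ∣ u := by
    apply Int.prime_two.dvd_of_dvd_pow (n := 2)
    exact ⟨-3-14*v*w, by linarith⟩
  obtain ⟨u, rfl⟩ := hu
  have : 4*(u^2+7*v*w) = -6 := by linarith
  omega
theorem B1k1 : ∀ s t : ZMod 16, ∀ k h e f u v w : ZMod 16, h = s*t → k = s^2-4*s*t+2*t^2 → f = s^2-4*h → e = 2*(5*h-s^2) → u = 4*k+e → v = k → w = f-2*k →
  4*(u^2+14*v*w)+7*(2*u*v+7*w^2)+14*(v^2+2*u*w) ≠ -6 := by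
  suffices H : ∀ s t : ZMod 16, 4*((4*(s^2-4*s*t+2*t^2)+2*(5*(s*t)-s^2))^2+14*(s^2-4*s*t+2*t^2)*((s^2-4*(s*t))-2*(s^2-4*s*t+2*t^2)))+7*(2*(4*(s^2-4*s*t+2*t^2)+2*(5*(s*t)-s^2))*(s^2-4*s*t+2*t^2)+7*((s^2-4*(s*t))-2*(s^2-4*s*t+2*t^2))^2)+14*((s^2-4*s*t+2*t^2)^2+2*(4*(s^2-4*s*t+2*t^2)+2*(5*(s*t)-s^2))*((s^2-4*(s*t))-2*(s^2-4*s*t+2*t^2))) ≠ -6 by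
    intro s t k h e f u v w h1 h2 h3 h4 h5 h6 h7
    subst h1 h2 h3 h4 h5 h6 h7
    exact H s t
  decide +kernel
theorem B1pos (k h p : ℤ) (hp : 0 < p) (h1 : k*p = p^2-4*h*p+2*h^2)
    (h2 : 4*((4*k+2*(5*h-p))^2+14*k*(p-4*h-2*k))+7*(2*(4*k+2*(5*h-p))*k+7*(p-4*h-2*k)^2)+14*(k^2+2*(4*k+2*(5*h-p))*(p-4*h-2*k)) = -6)
    (hC : ((3:ℕ):ℤ) ∣ k^2+2*(4*k+2*(5*h-p))*(p-4*h-2*k)) : False := by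
  obtain ⟨j, s, t, hk0, hk, hps, hw, hq⟩ := param_lemma 2 p (k-p+4*h) h hp (by linear_combination h1) (by
    intro d d1 d2 d3
    have hk : d ∣ k := by
      have := dvd_sub (dvd_add d2 d1) (d3.mul_left 4)
      have e : k-p+4*h+p-4*h = k := by ring
      rwa [e] at this
    obtain ⟨a, rfl⟩ := d1
    obtain ⟨b, rfl⟩ := hk
    obtain ⟨c, rfl⟩ := d3
    have h3 : d^2*(4*((4*b+2*(5*c-a))^2+14*b*(a-4*c-2*b))+7*(2*(4*b+2*(5*c-a))*b+7*(a-4*c-2*b)^2)+14*(b^2+2*(4*b+2*(5*c-a))*(a-4*c-2*b))) = -6 := by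
      rw [← h2]; ring
    have hd6 : d^2 ∣ 6 := by
      rw [← dvd_neg]; exact ⟨_, h3.symm⟩
    have : d^2 ≤ 6 := Int.le_of_dvd (by norm_num) hd6
    have b1 : d ≤ 2 := by nlinarith
    have b2 : -2 ≤ d := by nlinarith
    interval_cases d <;> first | (exfalso; clear * - hd6; revert hd6; decide) | (exact Int.isUnit_iff.mpr (by norm_num)))
  rcases dvd_two j hk0 hk with rfl | rfl
  · have hu : k = s^2-4*s*t+2*t^2 := by linarith
    have := congrArg (Int.cast : ℤ → ZMod 16) h2
    push_cast at this
    have hps' := congrArg (Int.cast : ℤ → ZMod 16) hps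
    have hw' := congrArg (Int.cast : ℤ → ZMod 16) hw
    have hu' := congrArg (Int.cast : ℤ → ZMod 16) hu
    push_cast at hps' hw' hu'
    rw [one_mul] at hps'
    rw [hps'] at this
    exact B1k1 s t k h _ _ _ _ _ hw' hu' rfl rfl rfl rfl rfl this
  · have hu : k = 2*s^2-4*s*t+t^2 := by linarith
    rw [hps, hu, hw] at h2
    have key : ∀ s t : ZMod 3, 10*s^4-44*s^3*t+60*s^2*t^2-30*s*t^3+3*t^4 = 3 →
      (2*s^2-4*s*t+t^2)^2+2*(4*(2*s^2-4*s*t+t^2)+2*(5*(s*t)-2*s^2))*(2*s^2-4*(s*t)-2*(2*s^2-4*s*t+t^2)) = 0 → s = 0 := by decide +kernel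
    have h4 : 10*s^4-44*s^3*t+60*s^2*t^2-30*s*t^3+3*t^4 = 3 := by linarith
    have h5 := congrArg (Int.cast : ℤ → ZMod 3) h4
    push_cast at h5
    rw [hps, hu, hw] at hC
    have h6 := (ZMod.intCast_zmod_eq_zero_iff_dvd _ 3).mpr hC
    push_cast at h6
    have h7 := key s t h5 h6
    rw [ZMod.intCast_zmod_eq_zero_iff_dvd] at h7
    push_cast at h7
    obtain ⟨r, rfl⟩ : ∃ r, s = 3*r := ⟨s/3, by omega⟩
    have := QC.thue t r (by linarith)
    rw [this] at hps; simp at hps; omega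
theorem endB1 (u v w Z : ℤ) (h1 : (u^2+14*v*w)+2*(2*u*v+7*w^2)+4*(v^2+2*u*w) = 0)
    (h2 : 4*(u^2+14*v*w)+7*(2*u*v+7*w^2)+14*(v^2+2*u*w) = -6)
    (h3 : 3*Z = 2*(u^2+14*v*w)+4*(2*u*v+7*w^2)+7*(v^2+2*u*w)) : Z = 5 := by
  obtain ⟨e, rfl⟩ : ∃ e, u = 4*v+e := ⟨u-4*v, by ring⟩
  obtain ⟨f, rfl⟩ : ∃ f, w = f-2*v := ⟨w+2*v, by ring⟩
  have g1 : e^2 - 4*e*v - 10*v*f+14*f^2+8*e*f = 0 := by linear_combination h1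
  have he : 2 ∣ e := by
    apply Int.prime_two.dvd_of_dvd_pow (n := 2)
    exact ⟨2*e*v+5*v*f-7*f^2-4*e*f, by linear_combination g1⟩
  obtain ⟨e, rfl⟩ := he
  obtain ⟨h, rfl⟩ : ∃ h, e = h - f := ⟨e+f, by ring⟩
  obtain ⟨p, rfl⟩ : ∃ p, f = p - 4*h := ⟨4*h+f, by ring⟩
  have e1 : v*p = p^2-4*h*p+2*h^2 := by linarith
  have hC : (3:ℤ) ∣ v^2+2*(4*v+2*(5*h-p))*(p-4*h-2*v) := by
    refine ⟨-Z, ?_⟩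
    linarith
  rcases lt_trichotomy p 0 with hp | hp | hp
  · refine (B1pos (-v) (-h) (-p) (by linarith) (by linarith) (by linarith) ?_).elim
    have e : (-v)^2+2*(4*(-v)+2*(5*(-h)-(-p)))*((-p)-4*(-h)-2*(-v)) = v^2+2*(4*v+2*(5*h-p))*(p-4*h-2*v) := by ring
    rw [e]; exact_mod_cast hC
  · subst hp
    have : h = 0 := by nlinarith
    subst this
    linarith
  · exact (B1pos v h p hp e1 (by linarith) (by exact_mod_cast hC)).elim

theorem int_prime (p : ℕ) (hp : p.Prime) (x y z : ℤ) (h0 : (p:ℤ)^2 ∣ x^2+14*y*z) (h1 : (p:ℤ)^2 ∣ 2*x*y+7*z^2)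
    (h2 : (p:ℤ)^2 ∣ y^2+2*x*z) : (p:ℤ) ∣ x ∧ (p:ℤ) ∣ y ∧ (p:ℤ) ∣ z := by
  have pp : Prime (p:ℤ) := Nat.prime_iff_prime_int.mp hp
  by_cases p3 : p = 3
  · subst p3
    have key : ∀ x y z : ZMod 9, x^2+14*y*z = 0 → 2*x*y+7*z^2 = 0 → y^2+2*x*z = 0 → 3*x = 0 ∧ 3*y = 0 ∧ 3*z = 0 := by decide +kernel
    have g0 := (ZMod.intCast_zmod_eq_zero_iff_dvd (x^2+14*y*z) 9).mpr (by exact_mod_cast h0)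
    have g1 := (ZMod.intCast_zmod_eq_zero_iff_dvd (2*x*y+7*z^2) 9).mpr (by exact_mod_cast h1)
    have g2 := (ZMod.intCast_zmod_eq_zero_iff_dvd (y^2+2*x*z) 9).mpr (by exact_mod_cast h2)
    push_cast at g0 g1 g2
    obtain ⟨k0, k1, k2⟩ := key x y z g0 g1 g2
    have k0' : (((3*x:ℤ)) : ZMod 9) = 0 := by push_cast; exact k0
    have k1' : (((3*y:ℤ)) : ZMod 9) = 0 := by push_cast; exact k1
    have k2' : (((3*z:ℤ)) : ZMod 9) = 0 := by push_cast; exact k2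
    rw [ZMod.intCast_zmod_eq_zero_iff_dvd] at k0' k1' k2'
    push_cast at k0' k1' k2' ⊢
    omega
  by_cases p7 : p = 7
  · subst p7
    push_cast at h0 h1 h2 pp ⊢
    obtain ⟨k0, h0⟩ := h0
    obtain ⟨k1, h1⟩ := h1
    obtain ⟨k2, h2⟩ := h2
    have hx : (7:ℤ) ∣ x := pp.dvd_of_dvd_pow (n := 2) ⟨7*k0-2*y*z, by linarith⟩
    obtain ⟨x, rfl⟩ := hx
    have hy : (7:ℤ) ∣ y := pp.dvd_of_dvd_pow (n := 2) ⟨7*k2-2*x*z, by linarith⟩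
    obtain ⟨y, rfl⟩ := hy
    have hz : (7:ℤ) ∣ z := pp.dvd_of_dvd_pow (n := 2) ⟨k1-2*x*y, by linarith⟩
    exact ⟨⟨_, rfl⟩, ⟨_, rfl⟩, hz⟩
  have n3 : ¬ (p:ℤ) ∣ 9 := by
    intro h
    have : p ∣ 3^2 := by exact_mod_cast h
    exact p3 ((Nat.prime_dvd_prime_iff_eq hp Nat.prime_three).mp (hp.dvd_of_dvd_pow this))
  have n7 : ¬ (p:ℤ) ∣ 7 := by
    intro h
    have : p ∣ 7 := by exact_mod_cast h
    exact p7 ((Nat.prime_dvd_prime_iff_eq hp (by norm_num)).mp this)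
  have g0 : (p:ℤ) ∣ x^2+14*y*z := (Dvd.intro_left _ (by ring : (p:ℤ)*p = p^2)).trans h0
  have g1 : (p:ℤ) ∣ 2*x*y+7*z^2 := (Dvd.intro_left _ (by ring : (p:ℤ)*p = p^2)).trans h1
  have g2 : (p:ℤ) ∣ y^2+2*x*z := (Dvd.intro_left _ (by ring : (p:ℤ)*p = p^2)).trans h2
  obtain ⟨k0, g0⟩ := g0
  obtain ⟨k1, g1⟩ := g1
  obtain ⟨k2, g2⟩ := g2
  have hS : (p:ℤ) ∣ 9*(7*x*y*z)^3 := by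
    obtain ⟨P, hP⟩ : ∃ P, P = x^3 := ⟨_, rfl⟩
    have e0 : x^3 = p*(x*k0) - 2*(7*x*y*z) := by linear_combination x*g0
    have e1 : 7*y^3 = p*(7*y*k2) - 2*(7*x*y*z) := by linear_combination 7*y*g2
    have e2 : 49*z^3 = p*(7*z*k1) - 2*(7*x*y*z) := by linear_combination 7*z*g1
    have e : (7*x*y*z)^3 = (p*(x*k0) - 2*(7*x*y*z))*(p*(7*y*k2) - 2*(7*x*y*z))*(p*(7*z*k1) - 2*(7*x*y*z)) := by
      rw [← e0, ← e1, ← e2]; ring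
    obtain ⟨S, hS⟩ : ∃ S, S = 7*x*y*z := ⟨_, rfl⟩
    rw [← hS] at e ⊢
    refine ⟨(x*k0)*(p*(7*y*k2) - 2*S)*(p*(7*z*k1) - 2*S) - 2*S*(7*y*k2)*(p*(7*z*k1) - 2*S) + 4*S^2*(7*z*k1), ?_⟩
    linear_combination e
  have hS : (p:ℤ) ∣ 7*x*y*z := by
    rcases pp.dvd_or_dvd hS with h | h
    · exact absurd h n3
    · exact pp.dvd_of_dvd_pow h
  obtain ⟨k, hk⟩ := hS
  refine ⟨?_, ?_, ?_⟩
  · exact pp.dvd_of_dvd_pow (n := 3) ⟨x*k0-2*k, by linear_combination x*g0-2*hk⟩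
  · have : (p:ℤ) ∣ 7*y^3 := ⟨7*y*k2-2*k, by linear_combination 7*y*g2-2*hk⟩
    rcases pp.dvd_or_dvd this with h | h
    · exact absurd h n7
    · exact pp.dvd_of_dvd_pow h
  · have : (p:ℤ) ∣ 7*(7*z^3) := ⟨7*z*k1-2*k, by linear_combination 7*z*g1-2*hk⟩
    rcases pp.dvd_or_dvd this with h | h
    · exact absurd h n7
    rcases pp.dvd_or_dvd h with h | h
    · exact absurd h n7
    · exact pp.dvd_of_dvd_pow h
theorem int_nat (d : ℕ) : d ≠ 0 → ∀ (x y z : ℤ) (h0 : (d:ℤ)^2 ∣ x^2+14*y*z) (h1 : (d:ℤ)^2 ∣ 2*x*y+7*z^2)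
    (h2 : (d:ℤ)^2 ∣ y^2+2*x*z), (d:ℤ) ∣ x ∧ (d:ℤ) ∣ y ∧ (d:ℤ) ∣ z := by
  induction d using Nat.recOnMul with
  | zero => intro h; exact absurd rfl h
  | one => intro _ x y z _ _ _; simp
  | prime p hp => intro _ x y z; exact int_prime p hp x y z
  | mul a b iha ihb =>
    intro hab x y z h0 h1 h2
    have ha : a ≠ 0 := left_ne_zero_of_mul hab
    have hb : b ≠ 0 := right_ne_zero_of_mul hab
    have hd : (a:ℤ)^2 ∣ ((a*b:ℕ):ℤ)^2 := by push_cast; exact ⟨b^2, by ring⟩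
    obtain ⟨⟨x, rfl⟩, ⟨y, rfl⟩, ⟨z, rfl⟩⟩ := iha ha x y z (hd.trans h0) (hd.trans h1) (hd.trans h2)
    have ha2 : (a:ℤ)^2 ≠ 0 := by positivity
    have c : ∀ t s : ℤ, ((a*b:ℕ):ℤ)^2 ∣ t → t = a^2*s → (b:ℤ)^2 ∣ s := by
      intro t s h e
      rw [e] at h; push_cast at h; rw [mul_pow] at h
      exact (mul_dvd_mul_iff_left ha2).mp h
    obtain ⟨⟨x, rfl⟩, ⟨y, rfl⟩, ⟨z, rfl⟩⟩ := ihb hb x y z (c _ _ h0 (by ring)) (c _ _ h1 (by ring)) (c _ _ h2 (by ring))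
    push_cast
    exact ⟨⟨x, by ring⟩, ⟨y, by ring⟩, ⟨z, by ring⟩⟩
theorem int_lem (d : ℤ) (hd : d ≠ 0) (x y z : ℤ) (h0 : d^2 ∣ x^2+14*y*z) (h1 : d^2 ∣ 2*x*y+7*z^2)
    (h2 : d^2 ∣ y^2+2*x*z) : d ∣ x ∧ d ∣ y ∧ d ∣ z := by
  have := int_nat d.natAbs (by omega) x y z
  simp only [Int.natAbs_dvd, Int.natCast_natAbs, sq_abs, abs_dvd] at this
  exact this h0 h1 h2
theorem sqdesc (x y z a b c t0 t1 t2 n : ℤ) (hn : n = a^3+7*b^3+49*c^3-21*a*b*c) (hn0 : n ≠ 0)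
    (h0 : x^2+14*y*z = (a^2+14*b*c)*t0 + 7*(2*a*b+7*c^2)*t2 + 7*(b^2+2*a*c)*t1)
    (h1 : 2*x*y+7*z^2 = (a^2+14*b*c)*t1 + (2*a*b+7*c^2)*t0 + 7*(b^2+2*a*c)*t2)
    (h2 : y^2+2*x*z = (a^2+14*b*c)*t2 + (2*a*b+7*c^2)*t1 + (b^2+2*a*c)*t0) :
    ∃ u v w : ℤ, u^2+14*v*w = t0 ∧ 2*u*v+7*w^2 = t1 ∧ v^2+2*u*w = t2 := by
  obtain ⟨k0, hk0⟩ : ∃ k, k = a^2-7*b*c := ⟨_, rfl⟩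
  obtain ⟨k1, hk1⟩ : ∃ k, k = 7*c^2-a*b := ⟨_, rfl⟩
  obtain ⟨k2, hk2⟩ : ∃ k, k = b^2-a*c := ⟨_, rfl⟩
  have e0 : (x*k0+7*y*k2+7*z*k1)^2+14*(x*k1+y*k0+7*z*k2)*(x*k2+y*k1+z*k0) = n^2*t0 := by
    have : (x*k0+7*y*k2+7*z*k1)^2+14*(x*k1+y*k0+7*z*k2)*(x*k2+y*k1+z*k0) =
      (k0^2+14*k1*k2)*(x^2+14*y*z) + 7*(2*k0*k1+7*k2^2)*(y^2+2*x*z) + 7*(k1^2+2*k0*k2)*(2*x*y+7*z^2) := by ring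
    rw [this, h0, h1, h2, hn, hk0, hk1, hk2]; ring
  have e1 : 2*(x*k0+7*y*k2+7*z*k1)*(x*k1+y*k0+7*z*k2)+7*(x*k2+y*k1+z*k0)^2 = n^2*t1 := by
    have : 2*(x*k0+7*y*k2+7*z*k1)*(x*k1+y*k0+7*z*k2)+7*(x*k2+y*k1+z*k0)^2 =
      (k0^2+14*k1*k2)*(2*x*y+7*z^2) + (2*k0*k1+7*k2^2)*(x^2+14*y*z) + 7*(k1^2+2*k0*k2)*(y^2+2*x*z) := by ring
    rw [this, h0, h1, h2, hn, hk0, hk1, hk2]; ring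
  have e2 : (x*k1+y*k0+7*z*k2)^2+2*(x*k0+7*y*k2+7*z*k1)*(x*k2+y*k1+z*k0) = n^2*t2 := by
    have : (x*k1+y*k0+7*z*k2)^2+2*(x*k0+7*y*k2+7*z*k1)*(x*k2+y*k1+z*k0) =
      (k0^2+14*k1*k2)*(y^2+2*x*z) + (2*k0*k1+7*k2^2)*(2*x*y+7*z^2) + (k1^2+2*k0*k2)*(x^2+14*y*z) := by ring
    rw [this, h0, h1, h2, hn, hk0, hk1, hk2]; ring
  obtain ⟨⟨u, hu⟩, ⟨v, hv⟩, ⟨w, hw⟩⟩ := int_lem n hn0 _ _ _ ⟨_, e0⟩ ⟨_, e1⟩ ⟨_, e2⟩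
  rw [hu, hv, hw] at e0 e1 e2
  have hn2 : n^2 ≠ 0 := pow_ne_zero 2 hn0
  refine ⟨u, v, w, ?_, ?_, ?_⟩
  · apply mul_left_cancel₀ hn2; linear_combination e0
  · apply mul_left_cancel₀ hn2; linear_combination e1
  · apply mul_left_cancel₀ hn2; linear_combination e2

def noSq (M : ℕ) (r0 r1 r2 : ℤ) : Bool :=
  (List.range M).all fun a => (List.range M).all fun b => (List.range M).all fun c =>
    !(Nat.beq ((b*b+2*a*c)%M) (r2 % M).toNat && (Nat.beq ((2*a*b+7*c*c)%M) (r1 % M).toNat && Nat.beq ((a*a+14*b*c)%M) (r0 % M).toNat))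

theorem modnat (M : ℕ) (hM : 0 < M) (f : ℕ) (e r : ℤ) (h1 : (f:ℤ) ≡ e [ZMOD M]) (h2 : e ≡ r [ZMOD M]) : f % M = (r % M).toNat := by
  have h3 : (f:ℤ) % M = r % M := h1.trans h2
  zify
  have : 0 ≤ r % (M:ℤ) := Int.emod_nonneg _ (by omega)
  rw [Int.toNat_of_nonneg this]
  exact h3

theorem noSq_sound (M : ℕ) (hM : 0 < M) (r0 r1 r2 : ℤ) (h : noSq M r0 r1 r2 = true) (x y z : ℤ)
    (h0 : x^2+14*y*z ≡ r0 [ZMOD M]) (h1 : 2*x*y+7*z^2 ≡ r1 [ZMOD M]) (h2 : y^2+2*x*z ≡ r2 [ZMOD M]) : False := by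
  have ex : ∀ x : ℤ, ∃ a : ℕ, a < M ∧ (a:ℤ) ≡ x [ZMOD M] := by
    intro x
    have p : 0 ≤ x % (M:ℤ) := Int.emod_nonneg _ (by omega)
    have q : x % (M:ℤ) < M := Int.emod_lt_of_pos _ (by omega)
    refine ⟨(x % (M:ℤ)).toNat, by omega, ?_⟩
    rw [Int.toNat_of_nonneg p]; exact Int.mod_modEq x M
  obtain ⟨a, ha, ea⟩ := ex x
  obtain ⟨b, hb, eb⟩ := ex y
  obtain ⟨c, hc, ec⟩ := ex z
  simp only [noSq, List.all_eq_true, List.mem_range] at h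
  have h := h a ha b hb c hc
  rw [modnat M hM (b*b+2*a*c) _ _ (by
      push_cast; rw [← pow_two]
      exact (eb.pow 2).add (((Int.ModEq.refl 2).mul ea).mul ec)) h2,
    modnat M hM (2*a*b+7*c*c) _ _ (by
      push_cast; rw [mul_assoc 7, ← pow_two]
      exact (((Int.ModEq.refl 2).mul ea).mul eb).add ((Int.ModEq.refl 7).mul (ec.pow 2))) h1,
    modnat M hM (a*a+14*b*c) _ _ (by
      push_cast; rw [← pow_two]
      exact (ea.pow 2).add (((Int.ModEq.refl 14).mul eb).mul ec)) h0] at h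
  simp at h

def sqm (n : ℕ) : Bool := [16,9,5,7,11,13,17,19,23,29,31,37].all fun q => (List.range q).any fun r => Nat.beq (r*r%q) (n%q)

theorem sqm_sq (m : ℕ) : sqm (m*m) = true := by
  simp only [sqm, List.all_eq_true]
  intro q hq
  rw [List.any_eq_true]
  have hq0 : 0 < q := by
    simp at hq; omega
  refine ⟨m % q, List.mem_range.mpr (Nat.mod_lt _ hq0), ?_⟩
  rw [← Nat.mul_mod]; simp

def nrm (a b c : ℤ) : ℤ := a*a*a+7*b*b*b+49*c*c*c-21*a*b*c
def isgood0 (l : ℤ × ℤ × ℤ) (m : ℤ × ℤ × ℤ) : Bool :=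
  decide (l.1 = m.1*m.1+14*m.2.1*m.2.2) && (decide (l.2.1 = 2*m.1*m.2.1+7*m.2.2*m.2.2) && decide (l.2.2 = m.2.1*m.2.1+2*m.1*m.2.2))
def isgood1 (l : ℤ × ℤ × ℤ) (m : ℤ × ℤ × ℤ) : Bool :=
  decide (l.1 = 2*(m.1*m.1+14*m.2.1*m.2.2)-7*(m.2.1*m.2.1+2*m.1*m.2.2)) &&
  (decide (l.2.1 = 2*(2*m.1*m.2.1+7*m.2.2*m.2.2)-(m.1*m.1+14*m.2.1*m.2.2)) &&
   decide (l.2.2 = 2*(m.2.1*m.2.1+2*m.1*m.2.2)-(2*m.1*m.2.1+7*m.2.2*m.2.2)))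
def inlist (B : List (ℕ × ℤ × ℤ × ℤ)) (l : ℤ × ℤ × ℤ) : Bool :=
  B.any fun b => decide (l.1 = b.2.1) && (decide (l.2.1 = b.2.2.1) && decide (l.2.2 = b.2.2.2))
def classify (G0 G1 : List (ℤ × ℤ × ℤ)) (B : List (ℕ × ℤ × ℤ × ℤ)) (l : ℤ × ℤ × ℤ) : Bool :=
  decide (nrm l.1 l.2.1 l.2.2 < 0) || (!sqm (nrm l.1 l.2.1 l.2.2).toNat || ((decide (l.1 = 0) && (decide (l.2.1 = 0) && decide (l.2.2 = 0))) ||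
   (G0.any (isgood0 l) || (G1.any (isgood1 l) || inlist B l))))

theorem classify_sound (G0 G1 : List (ℤ × ℤ × ℤ)) (B : List (ℕ × ℤ × ℤ × ℤ)) (a b c m : ℤ)
    (h : classify G0 G1 B (a, b, c) = true) (hm : nrm a b c = m^2) :
    (a = 0 ∧ b = 0 ∧ c = 0) ∨ (∃ μ ∈ G0, isgood0 (a, b, c) μ = true) ∨ (∃ μ ∈ G1, isgood1 (a, b, c) μ = true) ∨
    (∃ M : ℕ, (M, a, b, c) ∈ B) := by
  have h1 : ¬ nrm a b c < 0 := by rw [hm]; nlinarith [sq_nonneg m]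
  have h2 : sqm (nrm a b c).toNat = true := by
    have : (nrm a b c).toNat = m.natAbs*m.natAbs := by
      rw [hm]; zify; rw [Int.toNat_of_nonneg (sq_nonneg m), ← pow_two, sq_abs]
    rw [this]; exact sqm_sq _
  simp only [classify, h1, h2, Bool.or_eq_true, Bool.and_eq_true, decide_eq_true_eq, Bool.not_true, Bool.false_eq_true, false_or, List.any_eq_true, inlist] at h
  rcases h with h | h | h | ⟨⟨M, l⟩, hl, h⟩
  · left; exact h
  · right; left; exact h
  · right; right; left; exact h
  · right; right; right
    refine ⟨M, ?_⟩
    obtain ⟨e1, e2, e3⟩ := h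
    dsimp only at e1 e2 e3
    rw [e1, e2, e3]; exact hl

theorem x_zero (x y z : ℤ) (h0 : x^2+14*y*z = 0) (h1 : 2*x*y+7*z^2 = 0) (h2 : y^2+2*x*z = 0) : x = 0 ∧ y = 0 ∧ z = 0 := by
  have H : ∀ d : ℤ, d ≠ 0 → d ∣ x ∧ d ∣ y ∧ d ∣ z := by
    intro d hd
    exact int_lem d hd x y z (h0 ▸ dvd_zero _) (h1 ▸ dvd_zero _) (h2 ▸ dvd_zero _)
  have K : ∀ x : ℤ, |x|+1 ≠ 0 := by intro x; have := abs_nonneg x; omega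
  exact ⟨Int.eq_zero_of_abs_lt_dvd (H _ (K x)).1 (by omega), Int.eq_zero_of_abs_lt_dvd (H _ (K y)).2.1 (by omega),
    Int.eq_zero_of_abs_lt_dvd (H _ (K z)).2.2 (by omega)⟩

def g0A : List (ℤ × ℤ × ℤ) := [(-1, 1, 0), (-1, 0, 0), (-2, 1, 0), (0, -1, 0), (-2, 0, 0), (-1, -1, 0), (-1, 0, 1), (-3, 0, 0)]
def g1A : List (ℤ × ℤ × ℤ) := [(-1, 1, 0), (0, -1, 0), (-1, -1, 0), (-4, -1, -1), (-1, 0, 0), (-3, -1, -1), (-2, -1, 0), (-2, -1, -1), (-2, 0, 0), (-3, -2, -1), (-2, -2, -1), (-4, -2, -1), (-1, -1, -1)]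
def badA : List (ℕ × ℤ × ℤ × ℤ) := [(4, -10, 3, 2), (16, -5, -3, 3), (4, -5, 1, 1), (8, -6, 3, 1), (4, -5, 1, 2), (4, -6, 6, 0), (4, -3, 5, -1), (16, 1, -1, 1), (8, 4, -2, 1), (4, 1, 1, 1), (4, 4, 2, -2), (4, 2, 4, -2), (4, 2, 2, 0), (4, 2, 0, 2), (16, 11, -3, -1), (4, 9, -1, -1), (4, 9, -3, 1)]
theorem badA_ok : ∀ p ∈ badA, (0 < p.1 ∧ p.1 ∣ 16) ∧ ∀ t ∈ ([0, 1, 5, 8, 9, 13] : List ℤ), noSq p.1 (p.2.1+7*t*(p.2.1+p.2.2.1+p.2.2.2)) (p.2.2.1+t*(p.2.1+7*p.2.2.1+7*p.2.2.2)) (p.2.2.2+t*(p.2.1+p.2.2.1+7*p.2.2.2)) = true := by decide +kernel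
theorem g0A_ok : ∀ p ∈ g0A, nrm p.1 p.2.1 p.2.2 ≠ 0 := by decide +kernel
theorem g1A_ok : ∀ p ∈ g1A, nrm p.1 p.2.1 p.2.2 ≠ 0 := by decide +kernel
def g0B : List (ℤ × ℤ × ℤ) := [(-2, 1, 1), (-1, 0, 1), (-3, 0, 0), (0, -1, 1), (-1, 1, 0), (-2, -1, 0), (-1, -1, -1), (-1, -2, 0), (-2, 0, -1)]
def g1B : List (ℤ × ℤ × ℤ) := [(-1, -1, -1), (-2, -1, 0), (-5, -3, -1), (-3, -2, -1), (-6, -2, -1), (-4, -1, -1), (-1, 1, 0), (-7, -3, -2), (-6, -4, -2), (-9, -4, -2)]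
def badB : List (ℕ × ℤ × ℤ × ℤ) := [(4, 4, 7, -2), (4, 16, -2, -2), (4, 16, 10, -2), (4, 22, -5, -2), (4, 22, 4, -2), (4, -6, 6, 0), (4, -5, 1, 1), (4, 1, 1, 1), (8, 4, -2, 1), (4, 7, 7, 1), (4, 16, 4, 1), (4, -3, 9, 3), (8, -14, 7, 4), (4, 1, -2, 4), (16, 4, 4, 4), (4, 16, 7, 4), (4, 22, -2, 4), (4, 22, 10, 4), (4, 9, 3, 6), (4, 18, 3, 6)]
theorem badB_ok : ∀ p ∈ badB, (0 < p.1 ∧ p.1 ∣ 16) ∧ ∀ t ∈ ([5, 13] : List ℤ), noSq p.1 (11*(7*t*p.2.2.2-2*p.2.1)) (11*(t*p.2.1-2*p.2.2.1)) (11*(t*p.2.2.1-2*p.2.2.2)) = true := by decide +kernel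
theorem g0B_ok : ∀ p ∈ g0B, nrm p.1 p.2.1 p.2.2 ≠ 0 := by decide +kernel
theorem g1B_ok : ∀ p ∈ g1B, nrm p.1 p.2.1 p.2.2 ≠ 0 := by decide +kernel
theorem boxA : ∀ i : ℕ, i < 16 → ∀ j : ℕ, j < 8 → ∀ k : ℕ, k < 16 → (!(decide (-12 ≤ ((i:ℤ)-6)+6*((j:ℤ)-3)) && (decide (((i:ℤ)-6)+6*((j:ℤ)-3) ≤ 19) &&
    (decide (-24 ≤ ((i:ℤ)-6)+6*((j:ℤ)-3)+6*((k:ℤ)-7)) && decide (((i:ℤ)-6)+6*((j:ℤ)-3)+6*((k:ℤ)-7) ≤ 36)))) || 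
    classify g0A g1A badA (((i:ℤ)-6)-((k:ℤ)-7)-((j:ℤ)-3), (k:ℤ)-7, (j:ℤ)-3)) = true := by decide +kernel
theorem boxB : ∀ i : ℕ, i < 11 → ∀ j : ℕ, j < 38 → ∀ k : ℕ, k < 19 → (decide (¬ (9:ℤ) ∣ nrm ((j:ℤ)-15) ((k:ℤ)-7) ((i:ℤ)-4)) || 
    classify g0B g1B badB ((j:ℤ)-15, (k:ℤ)-7, (i:ℤ)-4)) = true := by decide +kernel

theorem goodA0 (x y z n a b c l0 l1 l2 : ℤ) (hn : nrm a b c ≠ 0)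
    (hl : isgood0 (l0, l1, l2) (a, b, c) = true)
    (h0 : x^2+14*y*z = l0 + 7*n*(l0+l1+l2)) (h1 : 2*x*y+7*z^2 = l1 + n*(l0+7*l1+7*l2)) (h2 : y^2+2*x*z = l2 + n*(l0+l1+7*l2)) :
    6*n+1 = 1 := by
  simp only [isgood0, Bool.and_eq_true, decide_eq_true_eq] at hl
  obtain ⟨e0, e1, e2⟩ := hl
  rw [e0, e1, e2] at h0 h1 h2
  obtain ⟨u, v, w, g0, g1, g2⟩ := sqdesc x y z a b c (7*n+1) n n _ rfl (by intro h; apply hn; unfold nrm; linear_combination h)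
    (by linear_combination h0) (by linear_combination h1) (by linear_combination h2)
  exact endA0 u v w (6*n+1) (by rw [g2, g0]; ring) (by rw [g0, g1]; ring) (by rw [g1, g2])
theorem goodA1 (x y z n a b c l0 l1 l2 : ℤ) (hn : nrm a b c ≠ 0)
    (hl : isgood1 (l0, l1, l2) (a, b, c) = true)
    (h0 : x^2+14*y*z = l0 + 7*n*(l0+l1+l2)) (h1 : 2*x*y+7*z^2 = l1 + n*(l0+7*l1+7*l2)) (h2 : y^2+2*x*z = l2 + n*(l0+l1+7*l2)) :
    6*n+1 = 7 := by
  simp only [isgood1, Bool.and_eq_true, decide_eq_true_eq] at hl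
  obtain ⟨e0, e1, e2⟩ := hl
  rw [e0, e1, e2] at h0 h1 h2
  obtain ⟨u, v, w, g0, g1, g2⟩ := sqdesc x y z a b c (7*n+2) (-5*n-1) n _ rfl (by intro h; apply hn; unfold nrm; linear_combination h)
    (by linear_combination h0) (by linear_combination h1) (by linear_combination h2)
  exact endA1 u v w (6*n+1) (by rw [g0, g1, g2]; ring) (by rw [g0, g1, g2]; ring) (by rw [g0, g1, g2]; ring)
theorem badA_no (x y z n l0 l1 l2 : ℤ) (M : ℕ) (hM : (M, l0, l1, l2) ∈ badA) (t : ℤ) (ht : t ∈ ([0, 1, 5, 8, 9, 13] : List ℤ)) (hnt : n ≡ t [ZMOD 16])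
    (h0 : x^2+14*y*z = l0 + 7*n*(l0+l1+l2)) (h1 : 2*x*y+7*z^2 = l1 + n*(l0+7*l1+7*l2)) (h2 : y^2+2*x*z = l2 + n*(l0+l1+7*l2)) : False := by
  obtain ⟨⟨M0, Md⟩, hb⟩ := badA_ok _ hM
  have hb := hb t ht
  dsimp only at hb M0 Md
  have hnt : n ≡ t [ZMOD M] := hnt.of_dvd (by exact_mod_cast Md)
  refine noSq_sound M M0 _ _ _ hb x y z ?_ ?_ ?_
  · rw [h0]; exact (Int.ModEq.refl _).add (((Int.ModEq.refl 7).mul hnt).mul (Int.ModEq.refl _))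
  · rw [h1]; exact (Int.ModEq.refl _).add (hnt.mul (Int.ModEq.refl _))
  · rw [h2]; exact (Int.ModEq.refl _).add (hnt.mul (Int.ModEq.refl _))
theorem nmodA (n v : ℤ) (h : 7*(6*n+1)^3 = 6*v^2+1) : ∃ t ∈ ([0, 1, 5, 8, 9, 13] : List ℤ), n ≡ t [ZMOD 16] := by
  have key : ∀ n v : ZMod 16, 7*(6*n+1)^3 = 6*v^2+1 → n = 0 ∨ n = 1 ∨ n = 5 ∨ n = 8 ∨ n = 9 ∨ n = 13 := by decide +kernel
  have h1 := congrArg (Int.cast : ℤ → ZMod 16) h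
  push_cast at h1
  have c : ∀ t : ℤ, (n : ZMod 16) = (t : ZMod 16) → n ≡ t [ZMOD 16] := fun t ht => (ZMod.intCast_eq_intCast_iff n t 16).mp ht
  rcases key n v h1 with h | h | h | h | h | h
  · exact ⟨0, by simp, c _ (by rw [h]; rfl)⟩
  · exact ⟨1, by simp, c _ (by rw [h]; rfl)⟩
  · exact ⟨5, by simp, c _ (by rw [h]; rfl)⟩
  · exact ⟨8, by simp, c _ (by rw [h]; rfl)⟩
  · exact ⟨9, by simp, c _ (by rw [h]; rfl)⟩
  · exact ⟨13, by simp, c _ (by rw [h]; rfl)⟩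
theorem smallA : ∀ i : ℕ, i < 40 → i = 0 ∨ i = 1 ∨ sqm ((7*(6*i+1)^3-1)/6) = false := by decide +kernel
/-- `x y` is bounded by `k z` when `x ^ 2 ≤ a z`, `y ^ 2 ≤ b z` and `a b ≤ k ^ 2` (all scaled). -/
theorem prod_bd (x y z a b k : ℤ) (hz : 0 ≤ z) (ha : 0 ≤ a) (hk : 0 ≤ k) (hx : 1000*x^2 ≤ a*z) (hy : 1000*y^2 ≤ b*z) (hab : a*b ≤ k^2) :
    1000*(x*y) ≤ k*z ∧ -(k*z) ≤ 1000*(x*y) := by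
  have h : (1000*(x*y))^2 ≤ (k*z)^2 := by
    calc (1000*(x*y))^2 = (1000*x^2)*(1000*y^2) := by ring
      _ ≤ (a*z)*(b*z) := mul_le_mul hx hy (by positivity) (by positivity)
      _ = (a*b)*z^2 := by ring
      _ ≤ k^2*z^2 := mul_le_mul_of_nonneg_right hab (by positivity)
      _ = _ := by ring
  have := abs_le_of_sq_le_sq' h (by positivity)
  exact ⟨this.2, by linarith [this.1]⟩
theorem sqrt_bd (c z : ℕ) : ∃ P : ℕ, 1000*P^2 ≤ c*z ∧ c*z < 1000*(P+1)^2 := by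
  obtain ⟨P, h1, h2⟩ := exists_sqrt (c*z/1000)
  exact ⟨P, by omega, by omega⟩
theorem sq_bd (x : ℤ) (P c z : ℕ) (h : |x| ≤ P) (hP : 1000*P^2 ≤ c*z) : 1000*x^2 ≤ (c:ℤ)*z := by
  have h1 : x^2 ≤ (P:ℤ)^2 := by
    rw [← sq_abs x]; exact pow_le_pow_left₀ (abs_nonneg x) h 2
  have : 1000*(P:ℤ)^2 ≤ (c:ℤ)*z := by exact_mod_cast hP
  linarith
/-- The combined pigeonhole step. -/
theorem short_vec (v z c0 c1 c2 : ℕ) (hv : 0 < v) (r0 r1 r2 : ℤ) (h : 1000000000*v^2 < c0*c1*c2*z^3) :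
    ∃ x0 x1 x2 : ℤ, ¬ (x0 = 0 ∧ x1 = 0 ∧ x2 = 0) ∧ 1000*x0^2 ≤ (c0:ℤ)*z ∧ 1000*x1^2 ≤ (c1:ℤ)*z ∧ 1000*x2^2 ≤ (c2:ℤ)*z ∧
      (v:ℤ) ∣ r0*x0+r1*x1+r2*x2 := by
  obtain ⟨P0, a0, b0⟩ := sqrt_bd c0 z
  obtain ⟨P1, a1, b1⟩ := sqrt_bd c1 z
  obtain ⟨P2, a2, b2⟩ := sqrt_bd c2 z
  have hlt : v < (P0+1)*(P1+1)*(P2+1) := by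
    have h3 : (c0*z)*(c1*z)*(c2*z) < (1000*(P0+1)^2)*(1000*(P1+1)^2)*(1000*(P2+1)^2) :=
      Nat.mul_lt_mul'' (Nat.mul_lt_mul'' b0 b1) b2
    have h4 : v^2 < ((P0+1)*(P1+1)*(P2+1))^2 := by
      have e1 : (c0*z)*(c1*z)*(c2*z) = c0*c1*c2*z^3 := by ring
      have e2 : (1000*(P0+1)^2)*(1000*(P1+1)^2)*(1000*(P2+1)^2) = 1000000000*((P0+1)*(P1+1)*(P2+1))^2 := by ring
      rw [e1, e2] at h3
      omega
    exact lt_of_pow_lt_pow_left₀ 2 (by positivity) h4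
  obtain ⟨x0, x1, x2, hne, h0, h1, h2, hd⟩ := pigeon3 v hv r0 r1 r2 P0 P1 P2 hlt
  exact ⟨x0, x1, x2, hne, sq_bd x0 P0 c0 z h0 a0, sq_bd x1 P1 c1 z h1 a1, sq_bd x2 P2 c2 z h2 a2, hd⟩

set_option maxHeartbeats 1000000 in
theorem largeA (n v : ℤ) (hn : 40 ≤ n) (hv : 0 < v) (h : 7*(6*n+1)^3 = 6*v^2+1) : False := by
  obtain ⟨z, hz⟩ : ∃ z, z = 6*n+1 := ⟨_, rfl⟩
  have hz241 : 241 ≤ z := by omega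
  have hzv : 7*z^3 = 6*v^2+1 := by rw [hz]; exact h
  obtain ⟨zn, hzn⟩ := Int.eq_ofNat_of_zero_le (show 0 ≤ z by omega)
  obtain ⟨vn, hvn⟩ := Int.eq_ofNat_of_zero_le hv.le
  obtain ⟨x0, x1, x2, hne, b0, b1, b2, hd⟩ := short_vec vn zn 3862 1062 287 (by omega) (z^2) z 1 (by
    have : (1000000000*(vn:ℤ)^2) < 3862*1062*287*(zn:ℤ)^3 := by
      rw [← hvn, ← hzn]
      have : 0 < z^3 := by positivity
      linarith
    exact_mod_cast this)
  rw [← hzn] at b0 b1 b2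
  rw [← hvn] at hd
  push_cast at b0 b1 b2
  obtain ⟨A, hA⟩ : ∃ A, A = x0^2+14*x1*x2 := ⟨_, rfl⟩
  obtain ⟨B, hB⟩ : ∃ B, B = 2*x0*x1+7*x2^2 := ⟨_, rfl⟩
  obtain ⟨C, hC⟩ : ∃ C, C = x1^2+2*x0*x2 := ⟨_, rfl⟩
  have z0 : 0 ≤ z := by omega
  obtain ⟨p1, p2⟩ := prod_bd x1 x2 z 1062 287 553 z0 (by norm_num) (by norm_num) b1 b2 (by norm_num)
  obtain ⟨q1, q2⟩ := prod_bd x0 x1 z 3862 1062 2026 z0 (by norm_num) (by norm_num) b0 b1 (by norm_num)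
  obtain ⟨r1, r2⟩ := prod_bd x0 x2 z 3862 287 1053 z0 (by norm_num) (by norm_num) b0 b2 (by norm_num)
  have A1 : 1000*A ≤ 11604*z := by rw [hA]; linarith
  have A2 : -7742*z ≤ 1000*A := by rw [hA]; linarith [sq_nonneg x0]
  have B1 : 1000*B ≤ 6061*z := by rw [hB]; linarith
  have B2 : -4052*z ≤ 1000*B := by rw [hB]; linarith [sq_nonneg x2]
  have C1 : 1000*C ≤ 3168*z := by rw [hC]; linarith
  have C2 : -2106*z ≤ 1000*C := by rw [hC]; linarith [sq_nonneg x1]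
  have hcop : IsCoprime v z := ⟨-6*v, 7*z^2, by linear_combination hzv⟩
  obtain ⟨L, hL⟩ := hd
  obtain ⟨S0, hS0⟩ : v^2 ∣ A*z^2+B*z+C := by
    have : v^2 ∣ z^2*(A*z^2+B*z+C) := ⟨L^2+6*(2*x1*x2*z+x2^2), by
      rw [hA, hB, hC]
      linear_combination (z^2*x0+z*x1+1*x2+v*L)*hL + (2*x1*x2*z+x2^2)*hzv⟩
    exact (hcop.pow (m := 2) (n := 2)).dvd_of_dvd_mul_left this
  obtain ⟨S1, hS1⟩ : ∃ S1, S1 = 7*z*S0-6*A := ⟨_, rfl⟩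
  obtain ⟨S2, hS2⟩ : ∃ S2, S2 = z*S1-6*B := ⟨_, rfl⟩
  have hS3 : z*S2-S0 = 6*C := by rw [hS2, hS1]; linear_combination S0*hzv - 6*hS0
  have key : (7*z^3-1)*S0 = 6*(A*z^2+B*z+C) := by rw [hzv, hS0]; ring
  have z2 : 0 ≤ z^2 := by positivity
  have A1' := mul_le_mul_of_nonneg_right A1 z2
  have A2' := mul_le_mul_of_nonneg_right A2 z2
  have B1' := mul_le_mul_of_nonneg_right B1 z0
  have B2' := mul_le_mul_of_nonneg_right B2 z0
  have w1 : 241*z ≤ z^2 := by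
    have := mul_le_mul_of_nonneg_right hz241 z0
    linarith only [this]
  have w2 : 241*z^2 ≤ z^3 := by
    have := mul_le_mul_of_nonneg_right hz241 z2
    linarith only [this]
  have hp0 : 0 ≤ 7*z^3-1 := by linarith
  have s0 : S0 ≤ 9 := by
    by_contra hc
    have hc : 10 ≤ S0 := by omega
    have := mul_le_mul_of_nonneg_left hc hp0
    linarith
  have s0' : -6 ≤ S0 := by
    by_contra hc
    have hc : S0 ≤ -7 := by omega
    have := mul_le_mul_of_nonneg_left hc hp0
    linarith
  have s2 : S2 ≤ 19 := by
    by_contra hc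
    have hc : 20 ≤ S2 := by omega
    have := mul_le_mul_of_nonneg_left hc z0
    linarith
  have s2' : -12 ≤ S2 := by
    by_contra hc
    have hc : S2 ≤ -13 := by omega
    have := mul_le_mul_of_nonneg_left hc z0
    linarith
  have s1 : S1 ≤ 36 := by
    by_contra hc
    have hc : 37 ≤ S1 := by omega
    have := mul_le_mul_of_nonneg_left hc z0
    linarith
  have s1' : -24 ≤ S1 := by
    by_contra hc
    have hc : S1 ≤ -25 := by omega
    have := mul_le_mul_of_nonneg_left hc z0
    linarith
  obtain ⟨l1, hl1⟩ : ∃ l, l = B - n*S1 := ⟨_, rfl⟩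
  obtain ⟨l2, hl2⟩ : ∃ l, l = C - n*S2 := ⟨_, rfl⟩
  obtain ⟨l0, hl0⟩ : ∃ l, l = A - 7*n*S0 := ⟨_, rfl⟩
  rw [hz] at hS1 hS2 hS3
  have t0 : S0 = l0+l1+l2 := by
    have : 6*S0 = 6*(l0+l1+l2) := by rw [hl0, hl1, hl2]; linarith
    linarith
  have t2 : S2 = S0+6*l2 := by rw [hl2]; linarith
  have t1 : S1 = S2+6*l1 := by rw [hl1]; linarith
  have u1 : S1 = l0+7*l1+7*l2 := by linarith
  have u2 : S2 = l0+l1+7*l2 := by linarith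
  have h0 : x0^2+14*x1*x2 = l0 + 7*n*(l0+l1+l2) := by rw [← t0, ← hA, hl0]; ring
  have h1 : 2*x0*x1+7*x2^2 = l1 + n*(l0+7*l1+7*l2) := by rw [← u1, ← hB, hl1]; ring
  have h2 : x1^2+2*x0*x2 = l2 + n*(l0+l1+7*l2) := by rw [← u2, ← hC, hl2]; ring
  have hN : (nrm x0 x1 x2)^2 = nrm l0 l1 l2 * v^2 := by
    have e1 : (nrm x0 x1 x2)^2 = nrm (x0^2+14*x1*x2) (2*x0*x1+7*x2^2) (x1^2+2*x0*x2) := by unfold nrm; ring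
    have e2 : 6*v^2 = 6*(42*n^2*6*n+126*n^2+21*n+1) := by linear_combination (-1)*h
    have e3 : v^2 = 42*n^2*6*n+126*n^2+21*n+1 := by linarith
    rw [e1, h0, h1, h2, e3]; unfold nrm; ring
  obtain ⟨m, hm⟩ : v ∣ nrm x0 x1 x2 := by
    rw [← Int.pow_dvd_pow_iff (n := 2) (by norm_num)]
    exact ⟨nrm l0 l1 l2, by linear_combination hN⟩
  have hm2 : nrm l0 l1 l2 = m^2 := by
    have : v^2 ≠ 0 := by positivity
    apply mul_left_cancel₀ this
    rw [hm] at hN; linear_combination (-1)*hN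
  have hbox := boxA (S0+6).toNat (by omega) (l2+3).toNat (by omega) (l1+7).toNat (by omega)
  rw [Int.toNat_of_nonneg (by omega), Int.toNat_of_nonneg (by omega), Int.toNat_of_nonneg (by omega)] at hbox
  have f0 : S0+6-6 = S0 := by ring
  have f1 : l1+7-7 = l1 := by ring
  have f2 : l2+3-3 = l2 := by ring
  have f3 : S0-l1-l2 = l0 := by linarith
  rw [f0, f1, f2, f3, ← t2, ← t1] at hbox
  simp only [s2, s2', s1, s1', decide_true, Bool.and_self, Bool.not_true, Bool.false_or] at hbox
  rcases classify_sound _ _ _ _ _ _ m hbox hm2 with ⟨c0, c1, c2⟩ | ⟨⟨a, b, c⟩, hμ, hg⟩ | ⟨⟨a, b, c⟩, hμ, hg⟩ | ⟨M, hM⟩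
  · rw [c0, c1, c2] at h0 h1 h2
    exact hne (x_zero x0 x1 x2 (by linarith) (by linarith) (by linarith))
  · have := goodA0 x0 x1 x2 n a b c l0 l1 l2 (g0A_ok _ hμ) hg h0 h1 h2
    omega
  · have := goodA1 x0 x1 x2 n a b c l0 l1 l2 (g1A_ok _ hμ) hg h0 h1 h2
    omega
  · obtain ⟨t, ht, hnt⟩ := nmodA n v h
    exact badA_no x0 x1 x2 n l0 l1 l2 M hM t ht hnt h0 h1 h2
theorem hA_main (z v : ℤ) (h : 7*z^3 = 6*v^2 + 1) : z = 1 ∨ z = 7 := by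
  have hpos : 0 < z := by
    by_contra hc
    have hc : z ≤ 0 := by omega
    have : z^3 ≤ 0 := by nlinarith [sq_nonneg z]
    nlinarith [sq_nonneg v]
  have hmod : z % 6 = 1 := by
    have key : ∀ z v : ZMod 6, 7*z^3 = 6*v^2+1 → z = 1 := by decide +kernel
    have h1 := congrArg (Int.cast : ℤ → ZMod 6) h
    push_cast at h1
    have := key z v h1
    exact (ZMod.intCast_eq_intCast_iff z 1 6).mp (by rw [this]; rfl)
  obtain ⟨n, rfl⟩ : ∃ n, z = 6*n+1 := ⟨z/6, by omega⟩
  have hn : 0 ≤ n := by omega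
  by_cases h40 : 40 ≤ n
  · exfalso
    rcases lt_trichotomy v 0 with hv | hv | hv
    · exact largeA n (-v) h40 (by omega) (by linarith)
    · rw [hv] at h
      have : 0 < (6*n+1)^2 := by positivity
      nlinarith
    · exact largeA n v h40 hv h
  · obtain ⟨i, rfl⟩ := Int.eq_ofNat_of_zero_le hn
    rcases smallA i (by omega) with h0 | h0 | h0
    · left; rw [h0]; norm_num
    · right; rw [h0]; norm_num
    · exfalso
      have e : 7*(6*i+1)^3 = 6*(v.natAbs*v.natAbs)+1 := by
        zify; rw [← pow_two, sq_abs]; exact h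
      rw [e] at h0
      have e2 : (6*(v.natAbs*v.natAbs)+1-1)/6 = v.natAbs*v.natAbs := by omega
      rw [e2, sqm_sq] at h0
      exact absurd h0 (by decide)

theorem goodB0 (x y z n a b c l0 l1 l2 : ℤ) (hn : nrm a b c ≠ 0)
    (hl : isgood0 (l0, l1, l2) (a, b, c) = true)
    (h0 : 3*(x^2+14*y*z) = 7*n*l2-2*l0) (h1 : 3*(2*x*y+7*z^2) = n*l0-2*l1) (h2 : 3*(y^2+2*x*z) = n*l1-2*l2) :
    False := by
  simp only [isgood0, Bool.and_eq_true, decide_eq_true_eq] at hl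
  obtain ⟨e0, e1, e2⟩ := hl
  simp only [e0, e1, e2] at h0 h1 h2
  obtain ⟨u, v, w, g0, g1, g2⟩ := sqdesc (3*x) (3*y) (3*z) a b c (-6) (3*n) 0 _ rfl (by intro h; apply hn; unfold nrm; linear_combination h)
    (by linear_combination 3*h0) (by linear_combination 3*h1) (by linear_combination 3*h2)
  exact endB0 u v w n g0 g2
theorem goodB1 (x y z n a b c l0 l1 l2 : ℤ) (hn : nrm a b c ≠ 0)
    (hl : isgood1 (l0, l1, l2) (a, b, c) = true)
    (h0 : 3*(x^2+14*y*z) = 7*n*l2-2*l0) (h1 : 3*(2*x*y+7*z^2) = n*l0-2*l1) (h2 : 3*(y^2+2*x*z) = n*l1-2*l2) :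
    n = 5 := by
  simp only [isgood1, Bool.and_eq_true, decide_eq_true_eq] at hl
  obtain ⟨e0, e1, e2⟩ := hl
  simp only [e0, e1, e2] at h0 h1 h2
  obtain ⟨u, v, w, g0, g1, g2⟩ := sqdesc (3*x) (3*y) (3*z) a b c (-12) (6*n+6) (-3*n) _ rfl (by intro h; apply hn; unfold nrm; linear_combination h)
    (by linear_combination 3*h0) (by linear_combination 3*h1) (by linear_combination 3*h2)
  exact endB1 u v w n (by rw [g0, g1, g2]; ring) (by rw [g0, g1, g2]; ring) (by rw [g0, g1, g2]; ring)
theorem badB_no (x y z n l0 l1 l2 : ℤ) (M : ℕ) (hM : (M, l0, l1, l2) ∈ badB) (t : ℤ) (ht : t ∈ ([5, 13] : List ℤ)) (hnt : n ≡ t [ZMOD 16])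
    (h0 : 3*(x^2+14*y*z) = 7*n*l2-2*l0) (h1 : 3*(2*x*y+7*z^2) = n*l0-2*l1) (h2 : 3*(y^2+2*x*z) = n*l1-2*l2) : False := by
  obtain ⟨⟨M0, Md⟩, hb⟩ := badB_ok _ hM
  have hb := hb t ht
  dsimp only at hb M0 Md
  have Md' : (M:ℤ) ∣ 16 := by exact_mod_cast Md
  have hnt : n ≡ t [ZMOD M] := hnt.of_dvd Md'
  have inv : ∀ a b c : ℤ, 3*a = b → b ≡ c [ZMOD M] → a ≡ 11*c [ZMOD M] := by
    intro a b c h1 h2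
    have h3 : 11*b ≡ 11*c [ZMOD M] := (Int.ModEq.refl 11).mul h2
    have h4 : a ≡ 11*b [ZMOD M] := by
      rw [← h1]
      apply Int.ModEq.of_dvd Md'
      apply (Int.modEq_iff_dvd).mpr
      exact ⟨2*a, by ring⟩
    exact h4.trans h3
  refine noSq_sound M M0 _ _ _ hb x y z (inv _ _ _ h0 ?_) (inv _ _ _ h1 ?_) (inv _ _ _ h2 ?_)
  · exact (((Int.ModEq.refl 7).mul hnt).mul (Int.ModEq.refl _)).sub (Int.ModEq.refl _)
  · exact (hnt.mul (Int.ModEq.refl _)).sub (Int.ModEq.refl _)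
  · exact (hnt.mul (Int.ModEq.refl _)).sub (Int.ModEq.refl _)
theorem smallB : ∀ i : ℕ, i < 50 → i = 0 ∨ (7*(8*i+5)^3-8) % 3 ≠ 0 ∨ sqm ((7*(8*i+5)^3-8)/3) = false := by decide +kernel
set_option maxHeartbeats 1000000 in
theorem largeB (z v : ℤ) (hz405 : 405 ≤ z) (hz8 : z % 8 = 5) (hv : 0 < v) (hzv : 7*z^3 = 3*v^2+8) : False := by
  obtain ⟨zn, hzn⟩ := Int.eq_ofNat_of_zero_le (show 0 ≤ z by omega)
  obtain ⟨vn, hvn⟩ := Int.eq_ofNat_of_zero_le hv.le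
  obtain ⟨x0, x1, x2, hne, b0, b1, b2, hd⟩ := short_vec vn zn 4855 1328 363 (by omega) (z^2) (2*z) 4 (by
    have : (1000000000*(vn:ℤ)^2) < 4855*1328*363*(zn:ℤ)^3 := by
      rw [← hvn, ← hzn]
      have : 0 < z^3 := by positivity
      linarith
    exact_mod_cast this)
  rw [← hzn] at b0 b1 b2
  rw [← hvn] at hd
  push_cast at b0 b1 b2
  obtain ⟨A, hA⟩ : ∃ A, A = x0^2+14*x1*x2 := ⟨_, rfl⟩
  obtain ⟨B, hB⟩ : ∃ B, B = 2*x0*x1+7*x2^2 := ⟨_, rfl⟩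
  obtain ⟨C, hC⟩ : ∃ C, C = x1^2+2*x0*x2 := ⟨_, rfl⟩
  have z0 : 0 ≤ z := by omega
  obtain ⟨p1, p2⟩ := prod_bd x1 x2 z 1328 363 695 z0 (by norm_num) (by norm_num) b1 b2 (by norm_num)
  obtain ⟨q1, q2⟩ := prod_bd x0 x1 z 4855 1328 2540 z0 (by norm_num) (by norm_num) b0 b1 (by norm_num)
  obtain ⟨r1, r2⟩ := prod_bd x0 x2 z 4855 363 1328 z0 (by norm_num) (by norm_num) b0 b2 (by norm_num)
  have A1 : 1000*A ≤ 14585*z := by rw [hA]; linarith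
  have A2 : -9730*z ≤ 1000*A := by rw [hA]; linarith [sq_nonneg x0]
  have B1 : 1000*B ≤ 7621*z := by rw [hB]; linarith
  have B2 : -5080*z ≤ 1000*B := by rw [hB]; linarith [sq_nonneg x2]
  have C1 : 1000*C ≤ 3984*z := by rw [hC]; linarith
  have C2 : -2656*z ≤ 1000*C := by rw [hC]; linarith [sq_nonneg x1]
  have hcop : IsCoprime v z := by
    have hc8 : IsCoprime (8:ℤ) z := ⟨-(5*(z/8)+3), 5, by omega⟩
    obtain ⟨a, b, hab⟩ := hc8
    exact ⟨-3*a*v, 7*a*z^2+b, by linear_combination a*hzv + hab⟩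
  obtain ⟨L, hL⟩ := hd
  obtain ⟨l2, hl2⟩ : v^2 ∣ A*z^2+2*B*z+4*C := by
    have : v^2 ∣ z^2*(A*z^2+2*B*z+4*C) := ⟨L^2+6*(z*x1*x2+x2^2), by
      rw [hA, hB, hC]
      linear_combination (z^2*x0+2*z*x1+4*x2+v*L)*hL + 2*(x1*x2*z+x2^2)*hzv⟩
    exact (hcop.pow (m := 2) (n := 2)).dvd_of_dvd_mul_left this
  have key : (7*z^3-8)*l2 = 3*(A*z^2+2*B*z+4*C) := by rw [hzv, hl2]; ring
  have z2 : 0 ≤ z^2 := by positivity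
  have A1' := mul_le_mul_of_nonneg_right A1 z2
  have A2' := mul_le_mul_of_nonneg_right A2 z2
  have B1' := mul_le_mul_of_nonneg_right B1 z0
  have B2' := mul_le_mul_of_nonneg_right B2 z0
  have w1 : 405*z ≤ z^2 := by
    have := mul_le_mul_of_nonneg_right hz405 z0
    linarith only [this]
  have w2 : 405*z^2 ≤ z^3 := by
    have := mul_le_mul_of_nonneg_right hz405 z2
    linarith only [this]
  have hp0 : 0 ≤ 7*z^3-8 := by linarith
  have s2 : l2 ≤ 6 := by
    by_contra hc
    have hc : 7 ≤ l2 := by omega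
    have := mul_le_mul_of_nonneg_left hc hp0
    linarith
  have s2' : -4 ≤ l2 := by
    by_contra hc
    have hc : l2 ≤ -5 := by omega
    have := mul_le_mul_of_nonneg_left hc hp0
    linarith
  have odd : ∀ t : ℤ, 2 ∣ z*t → 2 ∣ t := by
    intro t ht
    rcases Int.prime_two.dvd_or_dvd ht with h | h
    · omega
    · exact h
  obtain ⟨l0, hl0⟩ : 2 ∣ 7*z*l2-3*A := by
    apply odd; apply odd
    exact ⟨4*l2+3*B*z+6*C, by linear_combination key⟩
  have g0 : z*(z*l0-3*B) = 2*(2*l2+3*C) := by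
    have : 2*(z*(z*l0-3*B)) = 2*(2*(2*l2+3*C)) := by linear_combination key - z^2*hl0
    linarith
  obtain ⟨l1, hl1⟩ : 2 ∣ z*l0-3*B := odd _ ⟨_, g0⟩
  have g1 : z*l1 = 2*l2+3*C := by rw [hl1] at g0; linarith
  have s1 : l1 ≤ 11 := by
    by_contra hc
    have hc : 12 ≤ l1 := by omega
    have := mul_le_mul_of_nonneg_left hc z0
    linarith
  have s1' : -7 ≤ l1 := by
    by_contra hc
    have hc : l1 ≤ -8 := by omega
    have := mul_le_mul_of_nonneg_left hc z0
    linarith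
  have s0 : l0 ≤ 22 := by
    by_contra hc
    have hc : 23 ≤ l0 := by omega
    have := mul_le_mul_of_nonneg_left hc z0
    linarith
  have s0' : -15 ≤ l0 := by
    by_contra hc
    have hc : l0 ≤ -16 := by omega
    have := mul_le_mul_of_nonneg_left hc z0
    linarith
  have h0 : 3*(x0^2+14*x1*x2) = 7*z*l2-2*l0 := by rw [← hA]; linarith
  have h1 : 3*(2*x0*x1+7*x2^2) = z*l0-2*l1 := by rw [← hB]; linarith
  have h2 : 3*(x1^2+2*x0*x2) = z*l1-2*l2 := by rw [← hC]; linarith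
  have hN : (3*nrm x0 x1 x2)^2 = nrm l0 l1 l2 * v^2 := by
    have e1 : 3*(3*nrm x0 x1 x2)^2 = nrm (3*(x0^2+14*x1*x2)) (3*(2*x0*x1+7*x2^2)) (3*(x1^2+2*x0*x2)) := by unfold nrm; ring
    have e2 : nrm (7*z*l2-2*l0) (z*l0-2*l1) (z*l1-2*l2) = nrm l0 l1 l2 * (7*z^3-8) := by unfold nrm; ring
    rw [h0, h1, h2, e2, hzv] at e1
    linarith
  obtain ⟨m, hm⟩ : v ∣ 3*nrm x0 x1 x2 := by
    rw [← Int.pow_dvd_pow_iff (n := 2) (by norm_num)]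
    exact ⟨nrm l0 l1 l2, by linear_combination hN⟩
  have hm2 : nrm l0 l1 l2 = m^2 := by
    have : v^2 ≠ 0 := by positivity
    apply mul_left_cancel₀ this
    rw [hm] at hN; linear_combination (-1)*hN
  have h3v : ¬ (3:ℤ) ∣ v := by
    rintro ⟨t, rfl⟩
    have key : ∀ z : ZMod 9, 7*z^3 ≠ 8 := by decide +kernel
    apply key z
    have h9 := congrArg (Int.cast : ℤ → ZMod 9) hzv
    push_cast at h9
    have e27 : (3:ZMod 9)*(3*t)^2 = 0 := by
      have : (27:ZMod 9) = 0 := by decide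
      linear_combination (t:ZMod 9)^2*this
    rw [h9, e27, zero_add]
  have h3m : (3:ℤ) ∣ m := by
    rcases Int.prime_three.dvd_or_dvd (show (3:ℤ) ∣ v*m from ⟨_, hm.symm⟩) with h | h
    · exact absurd h h3v
    · exact h
  have h9 : (9:ℤ) ∣ nrm l0 l1 l2 := by
    rw [hm2]; obtain ⟨t, rfl⟩ := h3m; exact ⟨t^2, by ring⟩
  have hbox := boxB (l2+4).toNat (by omega) (l0+15).toNat (by omega) (l1+7).toNat (by omega)
  rw [Int.toNat_of_nonneg (by omega), Int.toNat_of_nonneg (by omega), Int.toNat_of_nonneg (by omega)] at hbox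
  have f0 : l0+15-15 = l0 := by ring
  have f1 : l1+7-7 = l1 := by ring
  have f2 : l2+4-4 = l2 := by ring
  rw [f0, f1, f2] at hbox
  simp only [h9, not_true_eq_false, decide_false, Bool.false_or] at hbox
  rcases classify_sound _ _ _ _ _ _ m hbox hm2 with ⟨c0, c1, c2⟩ | ⟨⟨a, b, c⟩, hμ, hg⟩ | ⟨⟨a, b, c⟩, hμ, hg⟩ | ⟨M, hM⟩
  · simp only [c0, c1, c2] at h0 h1 h2
    exact hne (x_zero x0 x1 x2 (by linarith) (by linarith) (by linarith))
  · exact goodB0 x0 x1 x2 z a b c l0 l1 l2 (g0B_ok _ hμ) hg h0 h1 h2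
  · have := goodB1 x0 x1 x2 z a b c l0 l1 l2 (g1B_ok _ hμ) hg h0 h1 h2
    omega
  · have ht : ∃ t ∈ ([5, 13] : List ℤ), z ≡ t [ZMOD 16] := by
      have : z % 16 = 5 ∨ z % 16 = 13 := by omega
      rcases this with h | h
      · exact ⟨5, by simp, h⟩
      · exact ⟨13, by simp, h⟩
    obtain ⟨t, ht, hnt⟩ := ht
    exact badB_no x0 x1 x2 z l0 l1 l2 M hM t ht hnt h0 h1 h2
theorem hB_main (z v : ℤ) (h2 : ¬ 2 ∣ z) (h : 7*z^3 = 3*v^2 + 8) : z = 5 := by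
  have hpos : 0 < z := by
    by_contra hc
    have hc : z ≤ 0 := by omega
    have : z^3 ≤ 0 := by nlinarith [sq_nonneg z]
    nlinarith [sq_nonneg v]
  have hmod : z % 8 = 5 := by
    have key : ∀ z v : ZMod 8, 7*z^3 = 3*v^2+8 → 4*z ≠ 0 → z = 5 := by decide +kernel
    have h1 := congrArg (Int.cast : ℤ → ZMod 8) h
    push_cast at h1
    have := key z v h1 (by
      intro h4
      have : ((4*z : ℤ) : ZMod 8) = 0 := by push_cast; exact h4
      rw [ZMod.intCast_zmod_eq_zero_iff_dvd] at this
      push_cast at this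
      omega)
    exact (ZMod.intCast_eq_intCast_iff z 5 8).mp (by rw [this]; rfl)
  by_cases h400 : 405 ≤ z
  · exfalso
    rcases lt_trichotomy v 0 with hv | hv | hv
    · exact largeB z (-v) h400 hmod (by omega) (by linarith)
    · rw [hv] at h
      have : 405^3 ≤ z^3 := pow_le_pow_left₀ (by norm_num) h400 3
      linarith
    · exact largeB z v h400 hmod hv h
  · obtain ⟨n, rfl⟩ : ∃ n, z = 8*n+5 := ⟨z/8, by omega⟩
    obtain ⟨i, rfl⟩ := Int.eq_ofNat_of_zero_le (show 0 ≤ n by omega)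
    have e : 7*(8*i+5)^3 = 3*(v.natAbs*v.natAbs)+8 := by
      zify; rw [← pow_two, sq_abs]; exact h
    rcases smallB i (by omega) with h0 | h0 | h0
    · rw [h0]; norm_num
    · exfalso
      rw [e] at h0; omega
    · exfalso
      rw [e] at h0
      have e2 : (3*(v.natAbs*v.natAbs)+8-8)/3 = v.natAbs*v.natAbs := by omega
      rw [e2, sqm_sq] at h0
      exact absurd h0 (by decide)

theorem stmt_11 :
    (∀ X Y : ℤ, Y ^ 2 = X ^ 3 - 10584 ↔
      (X = 22 ∧ (Y = 8 ∨ Y = -8)) ∨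
      (X = 25 ∧ (Y = 71 ∨ Y = -71)) ∨
      (X = 42 ∧ (Y = 252 ∨ Y = -252)) ∨
      (X = 105 ∧ (Y = 1071 ∨ Y = -1071)) ∨
      (X = 294 ∧ (Y = 5040 ∨ Y = -5040)) ∨
      (X = 394 ∧ (Y = 7820 ∨ Y = -7820))) ∧
    (¬ ∃ X Y : ℤ, Y ^ 2 = X ^ 3 + 10584) := by
  refine ⟨fun X Y => ⟨fun h => ?_, ?_⟩, part_two⟩
  · have hy : ∀ a : ℤ, Y ^ 2 = a ^ 2 → Y = a ∨ Y = -a := fun a ha => sq_eq_sq_iff_eq_or_eq_neg.mp ha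
    rcases reduction hA_main hB_main X Y h with e | e | e | e | e | e
    · exact Or.inl ⟨e, hy 8 (by rw [h, e]; norm_num)⟩
    · exact Or.inr (Or.inl ⟨e, hy 71 (by rw [h, e]; norm_num)⟩)
    · exact Or.inr (Or.inr (Or.inl ⟨e, hy 252 (by rw [h, e]; norm_num)⟩))
    · exact Or.inr (Or.inr (Or.inr (Or.inl ⟨e, hy 1071 (by rw [h, e]; norm_num)⟩)))
    · exact Or.inr (Or.inr (Or.inr (Or.inr (Or.inl ⟨e, hy 5040 (by rw [h, e]; norm_num)⟩))))
    · exact Or.inr (Or.inr (Or.inr (Or.inr (Or.inr ⟨e, hy 7820 (by rw [h, e]; norm_num)⟩))))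
  · rintro (⟨rfl, rfl | rfl⟩ | ⟨rfl, rfl | rfl⟩ | ⟨rfl, rfl | rfl⟩ | ⟨rfl, rfl | rfl⟩ | ⟨rfl, rfl | rfl⟩ | ⟨rfl, rfl | rfl⟩) <;> norm_num
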